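/- arXiv:2402.12135 — 4 statements merged into one kernel-verified Lean document; each statement's English description precedes it below -/
import Mathlib

section
/- There exist constants δ > 0 and C > 0 (depending only on the ground state Q) such that for every complex-valued Schwartz function ε = ε₁ + iε₂ on ℝ² (with ε₁, ε₂ real-valued) one has ⟨L₊ε₁, ε₁⟩ + ⟨L₋ε₂, ε₂⟩ ≥ δ‖ε‖²_{H¹} − C( (∫ε₁Q)² + (∫ε₁|y|²Q)² + |∫ε₁ yQ|² + (∫ε₂Q)² ), where ⟨f,g⟩ = ∫_{ℝ²} f g dy, ‖ε‖²_{H¹} = ∫_{ℝ²}(|∇ε|² + |ε|²) dy, and ∫ε₁ yQ ∈ ℝ² is the vector with components ∫ε₁ yⱼ Q. -/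
open MeasureTheory

noncomputable section

abbrev E2 := EuclideanSpace ℝ (Fin 2)

/-- Partial derivative in the `j`-th coordinate direction. -/
def pd (j : Fin 2) (f : E2 → ℝ) (y : E2) : ℝ :=
  fderiv ℝ f y (EuclideanSpace.single j 1)

/-- The Laplacian on `ℝ²`. -/
def lap (f : E2 → ℝ) (y : E2) : ℝ := ∑ j : Fin 2, pd j (pd j f) y

/-- The linearized operator `L₊ f = -Δf + f - 3Q²f`. -/
def Lplus (Q f : E2 → ℝ) (y : E2) : ℝ := -lap f y + f y - 3 * (Q y) ^ 2 * f y

/-- The linearized operator `L₋ f = -Δf + f - Q²f`. -/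
def Lminus (Q f : E2 → ℝ) (y : E2) : ℝ := -lap f y + f y - (Q y) ^ 2 * f y

section Aux
open MeasureTheory Set Filter Topology

/-- rapid decay on the positive half line -/
def Dec (f : ℝ → ℝ) : Prop := ∀ n : ℕ, ∃ C : ℝ, ∀ r > 0, (1 + r) ^ n * |f r| ≤ C

lemma Dec.mono {f g : ℝ → ℝ} (hf : Dec f) (K : ℝ) (k : ℕ)
    (h : ∀ r > 0, |g r| ≤ K * (1 + r) ^ k * |f r|) : Dec g := by
  intro n
  obtain ⟨C, hC⟩ := hf (n + k)
  refine ⟨|K| * C, fun r hr => ?_⟩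
  have h1 := hC r hr
  have h2 : (0:ℝ) < (1 + r) ^ n := by positivity
  calc (1 + r) ^ n * |g r| ≤ (1 + r) ^ n * (K * (1 + r) ^ k * |f r|) := by gcongr; exact h r hr
    _ = K * ((1 + r) ^ (n + k) * |f r|) := by rw [pow_add]; ring
    _ ≤ |K| * ((1 + r) ^ (n + k) * |f r|) := by gcongr; exact le_abs_self K
    _ ≤ |K| * C := by gcongr

lemma Dec.bdd {f : ℝ → ℝ} (hf : Dec f) : ∃ C : ℝ, 0 ≤ C ∧ ∀ r > 0, |f r| ≤ C := by
  obtain ⟨C, hC⟩ := hf 0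
  refine ⟨|C|, abs_nonneg _, fun r hr => ?_⟩
  have := hC r hr
  simp at this
  exact this.trans (le_abs_self _)

lemma Dec.add {f g : ℝ → ℝ} (hf : Dec f) (hg : Dec g) : Dec (fun r => f r + g r) := by
  intro n
  obtain ⟨C, hC⟩ := hf n
  obtain ⟨D, hD⟩ := hg n
  refine ⟨C + D, fun r hr => ?_⟩
  have h2 : (0:ℝ) < (1 + r) ^ n := by positivity
  have := abs_add_le (f r) (g r)
  nlinarith [hC r hr, hD r hr]

lemma Dec.const_mul {f : ℝ → ℝ} (hf : Dec f) (K : ℝ) : Dec (fun r => K * f r) :=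
  hf.mono |K| 0 (fun r hr => by simp [abs_mul])

lemma Dec.neg {f : ℝ → ℝ} (hf : Dec f) : Dec (fun r => - f r) :=
  hf.mono 1 0 (fun r hr => by simp)

lemma Dec.sub {f g : ℝ → ℝ} (hf : Dec f) (hg : Dec g) : Dec (fun r => f r - g r) := by
  simpa [sub_eq_add_neg] using hf.add hg.neg

lemma Dec.mul {f g : ℝ → ℝ} (hf : Dec f) (hg : Dec g) : Dec (fun r => f r * g r) := by
  obtain ⟨C, hC0, hC⟩ := hg.bdd
  refine hf.mono C 0 (fun r hr => ?_)
  rw [abs_mul]; have := hC r hr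
  simp only [pow_zero, mul_one]
  rw [mul_comm]; gcongr

lemma Dec.pow_mul {f : ℝ → ℝ} (hf : Dec f) (k : ℕ) : Dec (fun r => r ^ k * f r) := by
  refine hf.mono 1 k (fun r hr => ?_)
  rw [abs_mul, abs_of_pos (by positivity), one_mul]
  gcongr; linarith

lemma Dec.id_mul {f : ℝ → ℝ} (hf : Dec f) : Dec (fun r => r * f r) := by
  simpa using hf.pow_mul 1

lemma Dec.sq {f : ℝ → ℝ} (hf : Dec f) : Dec (fun r => f r ^ 2) := by
  simpa [pow_two] using hf.mul hf

lemma Dec.tendsto {f : ℝ → ℝ} (hf : Dec f) : Tendsto f atTop (𝓝 0) := by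
  obtain ⟨C, hC⟩ := hf 1
  have h : Tendsto (fun r : ℝ => C / r) atTop (𝓝 0) := tendsto_const_nhds.div_atTop tendsto_id
  refine squeeze_zero_norm' ?_ h
  filter_upwards [eventually_gt_atTop 0] with r hr
  have := hC r hr
  rw [Real.norm_eq_abs, le_div_iff₀ hr]
  nlinarith [abs_nonneg (f r)]

lemma Dec.integrable {f : ℝ → ℝ} (hf : Dec f) (hc : ContinuousOn f (Ioi 0)) :
    IntegrableOn f (Ioi 0) := by
  obtain ⟨C, hC⟩ := hf 2
  have h1 : Integrable (fun r : ℝ => C * (1 + r ^ 2)⁻¹) := integrable_inv_one_add_sq.const_mul C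
  refine Integrable.mono' (h1.integrableOn (s := Ioi 0)) (hc.aestronglyMeasurable measurableSet_Ioi) ?_
  rw [ae_restrict_iff' measurableSet_Ioi]
  refine Eventually.of_forall (fun r hr => ?_)
  have hr' : 0 < r := hr
  have := hC r hr
  rw [Real.norm_eq_abs, ← div_eq_mul_inv, le_div_iff₀ (by positivity)]
  nlinarith [abs_nonneg (f r), mul_nonneg hr'.le (abs_nonneg (f r))]

/-- the profile of the ground state -/
structure GS (q p : ℝ → ℝ) : Prop where
  hq : ∀ r, HasDerivAt q (p r) r
  hp : ∀ r > 0, HasDerivAt p (q r - q r ^ 3 - p r / r) r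
  pc : Continuous p
  pos : ∀ r, 0 < q r
  dq : Dec q
  dp : Dec p

/-- logarithmic derivative of the profile -/
noncomputable def th (q p : ℝ → ℝ) (r : ℝ) : ℝ := - r * p r / q r

lemma antitone_of_deriv {f f' : ℝ → ℝ} {a : ℝ} (hc : ContinuousOn f (Ici a))
    (hd : ∀ r > a, HasDerivAt f (f' r) r) (h : ∀ r > a, f' r ≤ 0) : AntitoneOn f (Ici a) := by
  refine antitoneOn_of_deriv_nonpos (convex_Ici a) hc ?_ ?_
  · rw [interior_Ici]; exact fun r hr => (hd r hr).differentiableAt.differentiableWithinAt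
  · rw [interior_Ici]; intro r hr; rw [(hd r hr).deriv]; exact h r hr

lemma monotone_of_deriv {f f' : ℝ → ℝ} {a : ℝ} (hc : ContinuousOn f (Ici a))
    (hd : ∀ r > a, HasDerivAt f (f' r) r) (h : ∀ r > a, 0 ≤ f' r) : MonotoneOn f (Ici a) := by
  refine monotoneOn_of_deriv_nonneg (convex_Ici a) hc ?_ ?_
  · rw [interior_Ici]; exact fun r hr => (hd r hr).differentiableAt.differentiableWithinAt
  · rw [interior_Ici]; intro r hr; rw [(hd r hr).deriv]; exact h r hr

lemma antitone_of_deriv_Icc {f f' : ℝ → ℝ} {a b : ℝ} (hc : ContinuousOn f (Icc a b))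
    (hd : ∀ r, a < r → r < b → HasDerivAt f (f' r) r) (h : ∀ r, a < r → r < b → f' r ≤ 0) :
    AntitoneOn f (Icc a b) := by
  refine antitoneOn_of_deriv_nonpos (convex_Icc a b) hc ?_ ?_
  · rw [interior_Icc]; exact fun r hr => (hd r hr.1 hr.2).differentiableAt.differentiableWithinAt
  · rw [interior_Icc]; intro r hr; rw [(hd r hr.1 hr.2).deriv]; exact h r hr.1 hr.2

namespace GS
variable {q p : ℝ → ℝ} (H : GS q p)
include H

lemma qc : Continuous q := continuous_iff_continuousAt.2 fun r => (H.hq r).continuousAt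

lemma thc : Continuous (th q p) := by
  unfold th
  have := H.qc; have := H.pc
  exact (by fun_prop : Continuous (fun r => - r * p r)).div H.qc (fun r => (H.pos r).ne')

lemma p_eq (r : ℝ) : r * p r = - th q p r * q r := by
  unfold th; field_simp [(H.pos r).ne']

lemma energy (r : ℝ) (hr : 0 ≤ r) : 0 ≤ p r ^ 2 / 2 - q r ^ 2 / 2 + q r ^ 4 / 4 := by
  have hqc := H.qc; have hpc := H.pc
  have hanti : AntitoneOn (fun r => p r ^ 2 / 2 - q r ^ 2 / 2 + q r ^ 4 / 4) (Ici 0) := by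
    refine antitone_of_deriv (f' := fun r => - (p r ^ 2) / r) (by fun_prop) ?_ ?_
    · intro r hr
      have := ((((H.hp r hr).pow 2).div_const 2).sub (((H.hq r).pow 2).div_const 2)).add
        (((H.hq r).pow 4).div_const 4)
      refine this.congr_deriv ?_
      have : r ≠ 0 := ne_of_gt hr
      field_simp
      ring
    · intro r hr
      have : 0 ≤ p r ^ 2 / r := by positivity
      rw [neg_div]; linarith
  have ht : Tendsto (fun r => p r ^ 2 / 2 - q r ^ 2 / 2 + q r ^ 4 / 4) atTop (𝓝 0) := by
    have h1 := H.dp.tendsto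
    have h2 := H.dq.tendsto
    have := (((h1.pow 2).div_const 2).sub ((h2.pow 2).div_const 2)).add ((h2.pow 4).div_const 4)
    simpa using this
  refine le_of_tendsto ht ?_
  · filter_upwards [eventually_ge_atTop r] with s hs
    exact hanti hr (hr.trans hs) hs

lemma hth (r : ℝ) (hr : 0 < r) :
    HasDerivAt (th q p) ((th q p r ^ 2 - r ^ 2 * (1 - q r ^ 2)) / r) r := by
  have h := (((hasDerivAt_id r).neg.mul (H.hp r hr)).div (H.hq r) (H.pos r).ne')
  refine h.congr_deriv ?_
  have := (H.pos r).ne'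
  simp only [th, Pi.neg_apply, id, Pi.mul_apply]
  field_simp
  ring

lemma th'_ge (r : ℝ) (hr : 0 < r) :
    r * q r ^ 2 / 2 ≤ (th q p r ^ 2 - r ^ 2 * (1 - q r ^ 2)) / r := by
  have h := H.energy r hr.le
  have hq := H.pos r
  rw [le_div_iff₀ hr]
  have : th q p r ^ 2 = r ^ 2 * p r ^ 2 / q r ^ 2 := by unfold th; field_simp
  have h3 : th q p r ^ 2 ≥ r ^ 2 * (1 - q r ^ 2 / 2) := by
    rw [this, ge_iff_le, le_div_iff₀ (by positivity), mul_assoc]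
    gcongr
    nlinarith
  nlinarith

lemma th_zero : th q p 0 = 0 := by simp [th]

lemma th_strictMono : StrictMonoOn (th q p) (Ici 0) := by
  refine strictMonoOn_of_deriv_pos (convex_Ici 0) H.thc.continuousOn ?_
  rw [interior_Ici]; intro r hr
  have hr' : 0 < r := hr
  rw [(H.hth r hr).deriv]
  refine lt_of_lt_of_le ?_ (H.th'_ge r hr)
  have := H.pos r
  positivity

lemma th_pos (r : ℝ) (hr : 0 < r) : 0 < th q p r := by
  rw [← H.th_zero]; exact H.th_strictMono (mem_Ici.2 le_rfl) hr.le hr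

lemma p_neg (r : ℝ) (hr : 0 < r) : p r < 0 := by
  have h := H.th_pos r hr
  have h2 := H.p_eq r
  have := H.pos r
  by_contra hc
  push Not at hc
  nlinarith [mul_pos h this, mul_nonneg hr.le hc]

lemma q_anti : AntitoneOn q (Ici 0) :=
  antitone_of_deriv H.qc.continuousOn (fun r _ => H.hq r) (fun r hr => (H.p_neg r hr).le)

lemma q_strictAnti : StrictAntiOn q (Ici 0) := by
  refine strictAntiOn_of_deriv_neg (convex_Ici 0) H.qc.continuousOn ?_
  rw [interior_Ici]; intro r hr
  rw [(H.hq r).deriv]; exact H.p_neg r hr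

lemma th_ge (r : ℝ) (hr : 0 ≤ r) : r ^ 2 * q r ^ 2 ≤ 4 * th q p r := by
  have hqc := H.qc
  have hthc := H.thc
  have : MonotoneOn (fun r => th q p r - r ^ 2 * q r ^ 2 / 4) (Ici 0) := by
    refine monotone_of_deriv (by fun_prop) (fun r hr => (H.hth r hr).sub
      ((((hasDerivAt_id r).pow 2).mul ((H.hq r).pow 2)).div_const 4)) ?_
    intro r hr
    have h1 := H.th'_ge r hr
    have h2 := H.p_neg r hr
    have h3 := H.pos r
    have hr' : 0 < r := hr
    have h4 : 0 ≤ r ^ 2 * (q r * -p r) := by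
      have : 0 ≤ - p r := by linarith
      positivity
    simp
    nlinarith
  have h := this (mem_Ici.2 le_rfl) hr hr
  simp [H.th_zero] at h
  linarith

/-- key comparison -/
lemma key (ρ : ℝ) (hρ : 0 < ρ) (r : ℝ) (hr : 0 < r) :
    q r ^ 2 * (th q p r - th q p ρ) ^ 2 ≤
      (th q p ρ + 2) * ((q ρ ^ 2 - q r ^ 2) * (th q p r - th q p ρ)) := by
  have hqc := H.qc
  have hthc := H.thc
  set t := th q p ρ with ht
  have ht0 : 0 < t := H.th_pos ρ hρ
  have hanti : AntitoneOn (fun r => q r ^ 2 * (t + 2 + (th q p r - t))) (Ici 0) := by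
    refine antitone_of_deriv (by fun_prop) (fun r hr => ((H.hq r).pow 2).mul
      (((H.hth r hr).sub_const t).const_add (t+2))) ?_
    intro r hr
    have h1 := H.th_pos r hr
    have h2 := H.th_ge r (le_of_lt hr)
    have h3 := H.pos r
    have h4 := H.p_eq r
    have hr' : 0 < r := hr
    have hp : p r = - th q p r * q r / r := by field_simp; linarith
    simp only [hp]
    have : (2 * q r * (-th q p r * q r / r)) * (t + 2 + (th q p r - t)) +
      q r ^ 2 * ((th q p r ^ 2 - r ^ 2 * (1 - q r ^ 2)) / r) = q r ^ 2 / r *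
       (-2 * th q p r * (2 + th q p r) + th q p r ^ 2 - r ^ 2 + r ^ 2 * q r ^ 2) := by
      field_simp; ring
    simp only [Pi.pow_apply, Nat.cast_ofNat, Nat.add_one_sub_one, pow_one]
    rw [this]
    refine mul_nonpos_of_nonneg_of_nonpos (by positivity) ?_
    nlinarith
  rcases le_total r ρ with h | h
  · have h1 := hanti hr.le hρ.le h
    have h2 := H.th_strictMono.monotoneOn hr.le hρ.le h
    simp only [← ht, sub_self] at h1 h2
    nlinarith
  · have h1 := hanti hρ.le hr.le h
    have h2 := H.th_strictMono.monotoneOn hρ.le hr.le h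
    simp only [← ht, sub_self] at h1 h2
    nlinarith

lemma q0 : 2 ≤ q 0 ^ 2 := by
  have h := H.energy 0 le_rfl
  have hp : p 0 = 0 := by
    -- |p| ≤ C r near zero is not needed: r p = - θ q and θ ≤ ... ; use monotonicity of r ↦ r p
    have hqc := H.qc
    have hpc := H.pc
    obtain ⟨C, hC0, hC⟩ := H.dq.bdd
    have hanti : AntitoneOn (fun r => - (r * p r) - r ^ 2 * C ^ 3 / 2) (Ici 0) := by
      refine antitone_of_deriv (by fun_prop) (fun r hr => ((hasDerivAt_id r).mul (H.hp r hr)).neg.sub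
        ((((hasDerivAt_id r).pow 2).mul_const (C^3)).div_const 2)) ?_
      intro r hr
      have hr' : 0 < r := hr
      have h3 := H.pos r
      have h4 := hC r hr
      rw [abs_of_pos h3] at h4
      have : q r ^ 3 ≤ C ^ 3 := by gcongr
      simp
      field_simp
      nlinarith
    have hb : ∀ r > 0, ‖p r‖ ≤ r * C ^ 3 / 2 := by
      intro r hr
      have h := hanti (mem_Ici.2 le_rfl) (le_of_lt hr) (le_of_lt hr)
      simp at h
      rw [Real.norm_eq_abs, abs_of_neg (H.p_neg r hr)]
      have : r * (- p r) ≤ r * (r * C ^ 3 / 2) := by nlinarith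
      exact le_of_mul_le_mul_left this hr
    have h1 : Tendsto p (𝓝[>] 0) (𝓝 0) := by
      refine squeeze_zero_norm' (a := fun r => r * C ^ 3 / 2) ?_ ?_
      · filter_upwards [self_mem_nhdsWithin] with r hr using hb r hr
      · have : Continuous (fun r : ℝ => r * C ^ 3 / 2) := by fun_prop
        have h := this.tendsto 0
        simp at h
        exact h.mono_left nhdsWithin_le_nhds
    exact tendsto_nhds_unique (hpc.continuousAt.tendsto.mono_left nhdsWithin_le_nhds) h1
  rw [hp] at h
  have := H.pos 0
  by_contra hc
  push Not at hc
  nlinarith [sq_nonneg (q 0), pow_pos this 2]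

lemma p_bound : ∃ C, 0 ≤ C ∧ ∀ r > 0, - p r ≤ C * r := by
  have hqc := H.qc
  have hpc := H.pc
  obtain ⟨C, hC0, hC⟩ := H.dq.bdd
  have hanti : AntitoneOn (fun r => - (r * p r) - r ^ 2 * C ^ 3 / 2) (Ici 0) := by
    refine antitone_of_deriv (by fun_prop) (fun r hr => ((hasDerivAt_id r).mul (H.hp r hr)).neg.sub
      ((((hasDerivAt_id r).pow 2).mul_const (C^3)).div_const 2)) ?_
    intro r hr
    have hr' : 0 < r := hr
    have h3 := H.pos r
    have h4 := hC r hr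
    rw [abs_of_pos h3] at h4
    have : q r ^ 3 ≤ C ^ 3 := by gcongr
    simp
    field_simp
    nlinarith
  refine ⟨C ^ 3 / 2, by positivity, fun r hr => ?_⟩
  have h := hanti (mem_Ici.2 le_rfl) (le_of_lt hr) (le_of_lt hr)
  simp at h
  have : r * (- p r) ≤ r * (C ^ 3 / 2 * r) := by nlinarith
  exact le_of_mul_le_mul_left this hr

lemma exists_th_one : ∃ ρ > 0, th q p ρ = 1 := by
  have hqc := H.qc
  by_cases hex : ∃ b > 0, 1 < th q p b
  · obtain ⟨b, hb, hb1⟩ := hex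
    obtain ⟨ρ, hρ, h⟩ := intermediate_value_Icc hb.le H.thc.continuousOn
      (show (1:ℝ) ∈ Icc (th q p 0) (th q p b) from ⟨by rw [H.th_zero]; norm_num, hb1.le⟩)
    refine ⟨ρ, lt_of_le_of_ne hρ.1 ?_, h⟩
    rintro rfl
    rw [H.th_zero] at h; norm_num at h
  · push Not at hex
    exfalso
    have hm : MonotoneOn (fun r => r * q r) (Ici 0) := by
      refine monotone_of_deriv (by fun_prop) (fun r hr => (hasDerivAt_id r).mul (H.hq r)) ?_
      intro r hr
      have h1 := H.p_eq r
      have h2 := hex r hr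
      have h3 := H.pos r
      simp only [one_mul, id]
      rw [h1]; nlinarith
    have ht := (H.dq.id_mul).tendsto
    have : (1:ℝ) * q 1 ≤ 0 := by
      refine le_of_tendsto' (f := fun _ : ℝ => (1:ℝ) * q 1) (x := atTop) tendsto_const_nhds (fun _ => ?_)
      refine ge_of_tendsto ht ?_
      filter_upwards [eventually_ge_atTop 1] with s hs
      exact hm (by norm_num : (0:ℝ) ≤ 1) (by simp; linarith) hs
    have := H.pos 1
    linarith

lemma exists_rho : ∃ ρ > 0, (1 - th q p ρ) * q ρ ^ 2 = 1 := by
  have hqc := H.qc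
  have hthc := H.thc
  obtain ⟨b, hb, hb1⟩ := H.exists_th_one
  have hc : ContinuousOn (fun r => (1 - th q p r) * q r ^ 2) (Icc 0 b) := by fun_prop
  obtain ⟨ρ, hρ, h⟩ := intermediate_value_Icc' hb.le hc
      (show (1:ℝ) ∈ Icc _ _ from ⟨by simp [hb1], by
        have := H.q0; simp only [H.th_zero]; linarith⟩)
  refine ⟨ρ, lt_of_le_of_ne hρ.1 ?_, h⟩
  rintro rfl
  have := H.q0; simp only [H.th_zero] at h; linarith

lemma exists_q_one : ∃ ρ > 0, q ρ = 1 := by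
  have ht := H.dq.tendsto
  obtain ⟨b, hb1, hb⟩ := ((ht.eventually_lt_const (show (0:ℝ) < 1 by norm_num)).and
    (eventually_gt_atTop 0)).exists
  have h0 := H.q0
  have h0' := H.pos 0
  have h1 : 1 < q 0 := by nlinarith
  obtain ⟨ρ, hρ, h⟩ := intermediate_value_Icc' (le_of_lt hb) H.qc.continuousOn
      (show (1:ℝ) ∈ Icc _ _ from ⟨hb1.le, h1.le⟩)
  refine ⟨ρ, lt_of_le_of_ne hρ.1 ?_, h⟩
  rintro rfl
  linarith

lemma th_upper : ∃ C > 0, ∃ R > 0, ∀ r ≥ R, th q p r ≤ C * r := by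
  have hqc := H.qc
  have hpc := H.pc
  obtain ⟨ρ, hρ, h1⟩ := H.exists_q_one
  have hm : MonotoneOn (fun r => 2 * (p r ^ 2 / 2 - q r ^ 2 / 2 + q r ^ 4 / 4) + 2 * (q r * p r / r)) (Ici ρ) := by
    refine monotone_of_deriv (f' := fun r => 2 * (q r * (q r - q r ^ 3 - p r / r) / r)
       - 2 * (q r * p r / r ^ 2)) ?_ ?_ ?_
    · have : ∀ r ∈ Ici ρ, r ≠ 0 := fun r hr => (hρ.trans_le hr).ne'
      fun_prop (disch := assumption)
    · intro r hr
      have hr : 0 < r := hρ.trans hr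
      have e1 := ((((H.hp r hr).pow 2).div_const 2).sub (((H.hq r).pow 2).div_const 2)).add
        (((H.hq r).pow 4).div_const 4)
      have e2 := ((H.hq r).mul (H.hp r hr)).div (hasDerivAt_id r) hr.ne'
      refine ((e1.const_mul 2).add (e2.const_mul 2)).congr_deriv ?_
      simp
      field_simp
      ring
    · intro r hr
      have hr0 : 0 < r := hρ.trans hr
      have hq := H.pos r
      have hp := H.p_neg r hr0
      have hq1 : q r ≤ 1 := h1 ▸ H.q_anti hρ.le hr0.le (le_of_lt hr)
      have h3 : 0 ≤ q r - q r ^ 3 := by nlinarith [sq_nonneg (q r)]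
      have h4 : 0 ≤ - p r / r := by have : 0 ≤ -p r := by linarith
                                    positivity
      have h5 : 0 ≤ q r * (q r - q r ^ 3 - p r / r) / r := by
        have : 0 ≤ q r - q r ^ 3 - p r / r := by rw [neg_div] at h4; linarith
        positivity
      have h6 : 0 ≤ q r * (- p r) / r ^ 2 := by
        have : 0 ≤ -p r := by linarith
        positivity
      have : q r * (- p r) / r ^ 2 = - (q r * p r / r ^ 2) := by ring
      linarith
  have ht : Tendsto (fun r => 2 * (p r ^ 2 / 2 - q r ^ 2 / 2 + q r ^ 4 / 4) + 2 * (q r * p r / r)) atTop (𝓝 0) := by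
    have h1 := H.dp.tendsto
    have h2 := H.dq.tendsto
    have h3 : Tendsto (fun r => q r * p r / r) atTop (𝓝 0) := (h2.mul h1).div_atTop tendsto_id
    have := ((((h1.pow 2).div_const 2).sub ((h2.pow 2).div_const 2)).add ((h2.pow 4).div_const 4)).const_mul 2
    simpa using this.add (h3.const_mul 2)
  refine ⟨1 + 2 / ρ, by positivity, ρ, hρ, fun r hr => ?_⟩
  have hr0 : 0 < r := hρ.trans_le hr
  have h : 2 * (p r ^ 2 / 2 - q r ^ 2 / 2 + q r ^ 4 / 4) + 2 * (q r * p r / r) ≤ 0 := by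
    refine ge_of_tendsto ht ?_
    filter_upwards [eventually_ge_atTop r] with s hs
    exact hm hr (hr.trans hs : ρ ≤ s) hs
  have hq := H.pos r
  set y := th q p r / r with hy
  have hp : p r = - y * q r := by have := H.p_eq r; rw [hy]; field_simp; linarith
  rw [hp] at h
  have hy0 : 0 < y := div_pos (H.th_pos r hr0) hr0
  have e : 2 * ((-y * q r) ^ 2 / 2 - q r ^ 2 / 2 + q r ^ 4 / 4) + 2 * (q r * (-y * q r) / r)
     = q r ^ 2 * (y ^ 2 - 1 + q r ^ 2 / 2 - 2 * y / r) := by field_simp; ring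
  rw [e] at h
  have h2 : y ^ 2 - 1 + q r ^ 2 / 2 - 2 * y / r ≤ 0 := by
    by_contra hc
    push Not at hc
    have : 0 < q r ^ 2 * (y ^ 2 - 1 + q r ^ 2 / 2 - 2 * y / r) := by positivity
    linarith
  have h3 : 2 * y / r ≤ y * (2 / ρ) := by
    have : 2 * y / r = y * (2 / r) := by ring
    rw [this]; gcongr
  have h4 : y ≤ 1 + 2 / ρ := by
    by_contra hc
    push Not at hc
    have : 0 < 2 / ρ := by positivity
    nlinarith [sq_nonneg (q r)]
  rw [hy, div_le_iff₀ hr0] at h4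
  exact h4

end GS


structure Dat (κ : ℝ) (m m' n : ℝ → ℝ) : Prop where
  hd : ∀ r > 0, HasDerivAt m (m' r) r
  quad : ∀ r > 0, ∀ x, 0 ≤ n r - m' r * x + m r * x ^ 2
  nc : ContinuousOn n (Ioi 0)
  m0 : ∀ r > 0, 0 ≤ m r
  dm : Dec m
  dn : Dec n
  lip : ∃ C, ∀ r > 0, κ * m r ≤ C * r ^ 2

structure Nice (κ : ℝ) (u u' : ℝ → ℝ) : Prop where
  hd : ∀ r > 0, HasDerivAt u (u' r) r
  uc' : ContinuousOn u' (Ioi 0)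
  du : Dec u
  du' : Dec u'
  lip : ∃ C, ∀ r > 0, κ * |u r| ≤ C * r

noncomputable def pot (κ j : ℝ) (q : ℝ → ℝ) (r : ℝ) : ℝ := κ / r ^ 2 + 1 - j * q r ^ 2

noncomputable def Bf (κ j : ℝ) (q m n : ℝ → ℝ) : ℝ :=
  ∫ r in Ioi (0:ℝ), r * (n r + pot κ j q r * m r)

lemma Nice.uc {κ : ℝ} {u u' : ℝ → ℝ} (h : Nice κ u u') : ContinuousOn u (Ioi 0) :=
  fun r hr => (h.hd r hr).continuousAt.continuousWithinAt

lemma Dat.mc {κ : ℝ} {m m' n : ℝ → ℝ} (h : Dat κ m m' n) : ContinuousOn m (Ioi 0) :=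
  fun r hr => (h.hd r hr).continuousAt.continuousWithinAt

lemma Dat.n0 {κ : ℝ} {m m' n : ℝ → ℝ} (h : Dat κ m m' n) (r : ℝ) (hr : 0 < r) : 0 ≤ n r := by
  simpa using h.quad r hr 0

lemma Nice.dat {κ : ℝ} (hκ : κ = 0 ∨ κ = 1) {u u' : ℝ → ℝ} (h : Nice κ u u') :
    Dat κ (fun r => u r ^ 2) (fun r => 2 * u r * u' r) (fun r => u' r ^ 2) where
  hd r hr := ((h.hd r hr).pow 2).congr_deriv (by simp)
  quad r hr x := by nlinarith [sq_nonneg (u' r - x * u r)]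
  nc := h.uc'.pow 2
  m0 r hr := sq_nonneg _
  dm := h.du.sq
  dn := h.du'.sq
  lip := by
    obtain ⟨C, hC⟩ := h.lip
    refine ⟨C ^ 2, fun r hr => ?_⟩
    rcases hκ with rfl | rfl
    · simp; positivity
    · have := hC r hr
      rw [one_mul] at this ⊢
      rw [← mul_pow, ← sq_abs]
      gcongr

lemma Nice.combo {κ : ℝ} (hκ : κ = 0 ∨ κ = 1) {u u' e e' : ℝ → ℝ} (h : Nice κ u u') (he : Nice κ e e') (a : ℝ) :
    Nice κ (fun r => u r - a * e r) (fun r => u' r - a * e' r) where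
  hd r hr := (h.hd r hr).sub ((he.hd r hr).const_mul a)
  uc' := h.uc'.sub (he.uc'.const_smul a)
  du := h.du.sub (he.du.const_mul a)
  du' := h.du'.sub (he.du'.const_mul a)
  lip := by
    obtain ⟨C, hC⟩ := h.lip
    obtain ⟨D, hD⟩ := he.lip
    refine ⟨C + |a| * D, fun r hr => ?_⟩
    have hκ0 : 0 ≤ κ := by rcases hκ with rfl | rfl <;> norm_num
    calc κ * |u r - a * e r| ≤ κ * (|u r| + |a * e r|) := by gcongr; exact abs_sub _ _
      _ = κ * |u r| + |a| * (κ * |e r|) := by rw [abs_mul]; ring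
      _ ≤ C * r + |a| * (D * r) := by
          have := hC r hr
          have := mul_le_mul_of_nonneg_left (hD r hr) (abs_nonneg a)
          linarith
      _ = _ := by ring

section
variable {q p : ℝ → ℝ} (H : GS q p)
include H

lemma Dat.dec {κ : ℝ} (hκ : 0 ≤ κ) {m m' n : ℝ → ℝ} (h : Dat κ m m' n) (j : ℝ) :
    Dec (fun r => r * (n r + pot κ j q r * m r)) := by
  have h1 : Dec (fun r => κ * m r / r) := by
    obtain ⟨C, hC⟩ := h.lip
    have hκ0 : 0 ≤ κ := hκ
    intro N
    obtain ⟨D, hD⟩ := h.dm N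
    refine ⟨2 ^ N * |C| + κ * |D|, fun r hr => ?_⟩
    have hr0 : 0 < r := hr
    have hm := h.m0 r hr
    rw [abs_of_nonneg (by positivity)]
    rcases le_total r 1 with h1 | h1
    · have : κ * m r / r ≤ |C| := by
        rw [div_le_iff₀ hr]
        calc κ * m r ≤ C * r ^ 2 := hC r hr
          _ ≤ |C| * r ^ 2 := by gcongr; exact le_abs_self C
          _ ≤ |C| * r := by gcongr; nlinarith
      calc (1 + r) ^ N * (κ * m r / r) ≤ 2 ^ N * |C| := by gcongr; linarith
        _ ≤ _ := by have := mul_nonneg hκ0 (abs_nonneg D); linarith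
    · have e : (1 + r) ^ N * |m r| ≤ |D| := (hD r hr).trans (le_abs_self _)
      rw [abs_of_nonneg hm] at e
      calc (1 + r) ^ N * (κ * m r / r) ≤ (1 + r) ^ N * (κ * m r) := by
            gcongr; exact div_le_self (by positivity) h1
        _ = κ * ((1 + r) ^ N * m r) := by ring
        _ ≤ κ * |D| := by gcongr
        _ ≤ _ := by have : 0 ≤ 2 ^ N * |C| := by positivity
                    linarith
  have h2 := (h.dn.id_mul.add h1).add ((h.dm.id_mul).sub ((((H.dq.sq).mul h.dm).id_mul).const_mul j))
  refine h2.mono 1 0 (fun r hr => ?_)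
  have hr' : 0 < r := hr
  simp only [pow_zero, one_mul]
  apply le_of_eq; congr 1
  unfold pot
  field_simp
  ring

lemma Dat.integrable {κ : ℝ} (hκ : 0 ≤ κ) {m m' n : ℝ → ℝ} (h : Dat κ m m' n) (j : ℝ) :
    IntegrableOn (fun r => r * (n r + pot κ j q r * m r)) (Ioi 0) := by
  refine (h.dec H hκ j).integrable ?_
  have h1 := h.mc; have h2 := h.nc; have h3 := H.qc
  unfold pot
  have : ∀ r ∈ Ioi (0:ℝ), r ^ 2 ≠ 0 := fun r hr => pow_ne_zero _ (ne_of_gt hr)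
  fun_prop (disch := assumption)

lemma Dat.integrable_m {κ : ℝ} {m m' n : ℝ → ℝ} (h : Dat κ m m' n) :
    IntegrableOn (fun r => r * m r) (Ioi 0) :=
  h.dm.id_mul.integrable (continuousOn_id.mul h.mc)

lemma Dat.integrable_qm {κ : ℝ} {m m' n : ℝ → ℝ} (h : Dat κ m m' n) :
    IntegrableOn (fun r => r * (q r ^ 2 * m r)) (Ioi 0) :=
  (H.dq.sq.mul h.dm).id_mul.integrable (continuousOn_id.mul ((H.qc.pow 2).continuousOn.mul h.mc))

lemma Dat.coercive {κ : ℝ} (hκ : 0 ≤ κ) {m m' n : ℝ → ℝ} (h : Dat κ m m' n) {j c : ℝ}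
    (hj : j ≤ 3) (hc : 0 < c) (hB : c * ∫ r in Ioi (0:ℝ), r * (q r ^ 2 * m r) ≤ Bf κ j q m n) :
    c / (c + 3) * ∫ r in Ioi (0:ℝ), r * m r ≤ Bf κ j q m n := by
  have h1 : (∫ r in Ioi (0:ℝ), r * m r) - 3 * (∫ r in Ioi (0:ℝ), r * (q r ^ 2 * m r)) ≤ Bf κ j q m n := by
    rw [← integral_const_mul, ← integral_sub (h.integrable_m H) ((h.integrable_qm H).const_mul 3)]
    refine setIntegral_mono_on ((h.integrable_m H).sub ((h.integrable_qm H).const_mul 3))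
      (h.integrable H hκ j) measurableSet_Ioi ?_
    intro r hr
    have hr0 : 0 < r := hr
    have hn := h.n0 r hr
    have hm := h.m0 r hr
    have hκ0 : 0 ≤ κ := hκ
    have e : 0 ≤ κ / r ^ 2 * m r := by positivity
    have e2 : 0 ≤ (3 - j) * (q r ^ 2 * m r) := mul_nonneg (by linarith) (by positivity)
    unfold pot
    have : m r - 3 * (q r ^ 2 * m r) ≤ n r + (κ / r ^ 2 + 1 - j * q r ^ 2) * m r := by nlinarith
    nlinarith
  rw [div_mul_eq_mul_div, div_le_iff₀ (by linarith)]
  nlinarith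

end

lemma F_lemma {F G F' : ℝ → ℝ} {ρ : ℝ} (hρ : 0 < ρ) (hFc : ContinuousOn F (Ici 0)) (hF0 : F 0 = 0)
    (hFinf : Tendsto F atTop (𝓝 0)) (hd : ∀ r > 0, r ≠ ρ → HasDerivAt F (F' r) r)
    (hle : ∀ r > 0, r ≠ ρ → F' r ≤ G r) (hG : IntegrableOn G (Ioi 0)) :
    0 ≤ ∫ r in Ioi 0, G r := by
  have hG' : IntegrableOn G (Ici 0) := (integrableOn_Ici_iff_integrableOn_Ioi (by simp)).2 hG
  have h1 : F ρ - F 0 ≤ ∫ r in (0:ℝ)..ρ, G r :=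
    intervalIntegral.sub_le_integral_of_hasDeriv_right_of_le hρ.le (hFc.mono Icc_subset_Ici_self)
      (fun r hr => (hd r hr.1 hr.2.ne).hasDerivWithinAt) (hG'.mono_set Icc_subset_Ici_self)
      (fun r hr => hle r hr.1 hr.2.ne)
  have h2 : ∀ b ≥ ρ, F b - F ρ ≤ ∫ r in ρ..b, G r := fun b hb =>
    intervalIntegral.sub_le_integral_of_hasDeriv_right_of_le hb
      (hFc.mono (fun x hx => hρ.le.trans hx.1))
      (fun r hr => (hd r (hρ.trans hr.1) hr.1.ne').hasDerivWithinAt)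
      (hG'.mono_set (fun x hx => hρ.le.trans hx.1))
      (fun r hr => hle r (hρ.trans hr.1) hr.1.ne')
  have h3 : ∀ b ≥ ρ, F b ≤ ∫ r in (0:ℝ)..b, G r := by
    intro b hb
    have := h2 b hb
    rw [← intervalIntegral.integral_add_adjacent_intervals (b := ρ)]
    · linarith
    · exact (intervalIntegrable_iff_integrableOn_Icc_of_le hρ.le).2 (hG'.mono_set Icc_subset_Ici_self)
    · exact (intervalIntegrable_iff_integrableOn_Icc_of_le hb).2
        (hG'.mono_set (fun x hx => hρ.le.trans hx.1))
  have h4 := intervalIntegral_tendsto_integral_Ioi 0 hG tendsto_id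
  refine le_of_tendsto_of_tendsto hFinf h4 ?_
  filter_upwards [eventually_ge_atTop ρ] with b hb using h3 b hb

/-- a comparison function for the Jacobi argument -/
structure Comp (κ j c : ℝ) (q w w1 w2 : ℝ → ℝ) (ρ : ℝ) : Prop where
  rpos : 0 < ρ
  hw : ∀ r > 0, HasDerivAt w (w1 r) r
  hw1 : ∀ r > 0, HasDerivAt w1 (w2 r) r
  ne : ∀ r > 0, r ≠ ρ → w r ≠ 0
  sup : ∀ r > 0, (w2 r + w1 r / r - pot κ j q r * w r) * w r ≤ - c * q r ^ 2 * w r ^ 2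
  zero : ∃ C, ∀ᶠ r in 𝓝[>] 0, |r * w1 r / w r| ≤ C * κ + C * r
  infty : ∃ C, ∀ᶠ r in atTop, |w1 r / w r| ≤ C * r

lemma jacobi {q p : ℝ → ℝ} (H : GS q p) {κ : ℝ} (hκ : 0 ≤ κ) {j c ρ : ℝ}
    {m m' n w w1 w2 : ℝ → ℝ} (h : Dat κ m m' n) (hw : Comp κ j c q w w1 w2 ρ)
    (hρ : w ρ ≠ 0 ∨ (w ρ = 0 ∧ w1 ρ ≠ 0 ∧ ∃ C, ∀ᶠ r in 𝓝 ρ, m r ≤ C * (r - ρ) ^ 2)) :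
    c * ∫ r in Ioi (0:ℝ), r * (q r ^ 2 * m r) ≤ Bf κ j q m n := by
  have hmain : 0 ≤ ∫ r in Ioi (0:ℝ), (r * (n r + pot κ j q r * m r) - c * (r * (q r ^ 2 * m r))) := by
    refine F_lemma (F := fun r => r * m r * w1 r / w r) (F' := fun r => ((1 * m r + r * m' r) * w1 r
      + r * m r * w2 r) / w r - r * m r * w1 r * w1 r / w r ^ 2) hw.rpos ?_ (by simp) ?_ ?_ ?_ ?_
    · intro r hr
      rcases eq_or_lt_of_le (show (0:ℝ) ≤ r from hr) with rfl | hr0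
      · have hs : Ici (0:ℝ) = insert 0 (Ioi 0) := by ext x; simp [le_iff_eq_or_lt, eq_comm]
        rw [hs, continuousWithinAt_insert_self, ContinuousWithinAt]
        simp only [zero_mul, zero_div]
        obtain ⟨C, hC⟩ := hw.zero
        obtain ⟨D, hD⟩ := h.lip
        obtain ⟨K, hK0, hK⟩ := h.dm.bdd
        refine squeeze_zero_norm' (a := fun r => |C| * (|D| * r ^ 2) + |C| * r * K) ?_ ?_
        · filter_upwards [hC, self_mem_nhdsWithin] with r h1 hr
          have hr0 : 0 < r := hr
          have hm := h.m0 r hr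
          have h3 := hK r hr
          rw [abs_of_nonneg hm] at h3
          have h4 : κ * m r ≤ |D| * r ^ 2 := (hD r hr).trans (by gcongr; exact le_abs_self _)
          have hκ0 : 0 ≤ κ := hκ
          rw [Real.norm_eq_abs]
          calc |r * m r * w1 r / w r| = |r * w1 r / w r| * m r := by
                rw [show r * m r * w1 r / w r = (r * w1 r / w r) * m r by ring, abs_mul, abs_of_nonneg hm]
            _ ≤ (|C| * κ + |C| * r) * m r := by
                gcongr
                exact h1.trans (by gcongr <;> exact le_abs_self _)
            _ = |C| * (κ * m r) + |C| * r * m r := by ring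
            _ ≤ _ := by gcongr
        · have : Continuous (fun r : ℝ => |C| * (|D| * r ^ 2) + |C| * r * K) := by fun_prop
          have h := this.tendsto 0
          simp at h
          exact h.mono_left nhdsWithin_le_nhds
      · refine ContinuousAt.continuousWithinAt ?_
        have hmc := (h.hd r hr0).continuousAt
        have hw1c := (hw.hw1 r hr0).continuousAt
        have hwc := (hw.hw r hr0).continuousAt
        by_cases hwr : w r = 0
        · have hrρ : r = ρ := by
            by_contra hne
            exact hw.ne r hr0 hne hwr
          subst hrρ
          rcases hρ with h' | ⟨_, h1, C, hC⟩
          · exact absurd hwr h'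
          have hO := (HasDerivAtFilter.isTheta_sub (hw.hw r hr0) h1).isBigO_symm.bound
          obtain ⟨K, hK'⟩ := hO
          have hK : ∀ᶠ s in 𝓝 r, ‖s - r‖ ≤ K * ‖w s - w r‖ := by
            rw [prod_pure, eventually_map] at hK'
            exact hK'
          rw [ContinuousAt, hwr, div_zero]
          refine squeeze_zero_norm' (a := fun s => |s * w1 s| * (|C| * |K| * |s - r|)) ?_ ?_
          · filter_upwards [hC, hK, lt_mem_nhds hr0] with s h2 h3 hs
            have hm := h.m0 s hs
            rw [hwr, sub_zero, Real.norm_eq_abs, Real.norm_eq_abs] at h3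
            rw [Real.norm_eq_abs]
            rw [show s * m s * w1 s / w s = (s * w1 s) * (m s / w s) by ring, abs_mul]
            gcongr
            rw [abs_div, abs_of_nonneg hm]
            rcases eq_or_lt_of_le (abs_nonneg (w s)) with h4 | h4
            · rw [← h4]; simp; positivity
            · rw [div_le_iff₀ h4]
              calc m s ≤ C * (s - r) ^ 2 := h2
                _ ≤ |C| * |s - r| ^ 2 := by rw [sq_abs]; gcongr; exact le_abs_self _
                _ = |C| * |s - r| * |s - r| := by ring
                _ ≤ |C| * |s - r| * (|K| * |w s|) := by
                    gcongr; exact h3.trans (by gcongr; exact le_abs_self _)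
                _ = _ := by ring
          · have : ContinuousAt (fun s => |s * w1 s| * (|C| * |K| * |s - r|)) r := by fun_prop
            simpa [ContinuousAt] using this
        · exact ((continuousAt_id.mul hmc).mul hw1c).div hwc hwr
    · obtain ⟨C, hC⟩ := hw.infty
      have := ((h.dm.pow_mul 2).const_mul C).tendsto
      refine squeeze_zero_norm' ?_ this
      filter_upwards [hC, eventually_gt_atTop 0] with r h1 hr
      have hm := h.m0 r hr
      rw [Real.norm_eq_abs, show r * m r * w1 r / w r = (r * m r) * (w1 r / w r) by ring, abs_mul,
        abs_of_nonneg (by positivity)]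
      calc r * m r * |w1 r / w r| ≤ r * m r * (C * r) := by gcongr
        _ = _ := by ring
    · intro r hr hne
      have hwr := hw.ne r hr hne
      refine ((((hasDerivAt_id r).mul (h.hd r hr)).mul (hw.hw1 r hr)).div (hw.hw r hr) hwr).congr_deriv ?_
      simp only [id, Pi.mul_apply]
      field_simp
    · intro r hr hne
      have hwr := hw.ne r hr hne
      have hr0 : 0 < r := hr
      have hm := h.m0 r hr
      have hs := hw.sup r hr
      have hq := h.quad r hr (w1 r / w r)
      have hw2 : 0 < w r ^ 2 := by positivity
      have hs' : w2 r / w r + w1 r / w r / r ≤ pot κ j q r - c * q r ^ 2 := by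
        have : w2 r / w r + w1 r / w r / r - pot κ j q r =
          ((w2 r + w1 r / r - pot κ j q r * w r) * w r) / w r ^ 2 := by field_simp
        have h2 : w2 r / w r + w1 r / w r / r - pot κ j q r ≤ - c * q r ^ 2 := by
          rw [this, div_le_iff₀ hw2]; exact hs
        linarith
      have e : ((1 * m r + r * m' r) * w1 r + r * m r * w2 r) / w r - r * m r * w1 r * w1 r / w r ^ 2
        = r * m' r * (w1 r / w r) - r * m r * (w1 r / w r) ^ 2 + r * m r * (w2 r / w r + w1 r / w r / r) := by
        field_simp; ring
      rw [e]
      have h3 : r * m r * (w2 r / w r + w1 r / w r / r) ≤ r * m r * (pot κ j q r - c * q r ^ 2) := by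
        gcongr
      nlinarith [mul_nonneg hr0.le hq]
    · exact (h.integrable H hκ j).sub ((h.integrable_qm H).const_mul c)
  rw [integral_sub (h.integrable H hκ j) ((h.integrable_qm H).const_mul c), integral_const_mul] at hmain
  unfold Bf
  linarith

lemma weighted_cs {f g : ℝ → ℝ} (hf : Dec f) (hg : Dec g) (hfc : ContinuousOn f (Ioi 0))
    (hgc : ContinuousOn g (Ioi 0)) :
    (∫ r in Ioi (0:ℝ), r * (f r * g r)) ^ 2 ≤
      (∫ r in Ioi (0:ℝ), r * f r ^ 2) * (∫ r in Ioi (0:ℝ), r * g r ^ 2) := by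
  have i1 : IntegrableOn (fun r => r * f r ^ 2) (Ioi 0) :=
    hf.sq.id_mul.integrable (continuousOn_id.mul (hfc.pow 2))
  have i2 : IntegrableOn (fun r => r * g r ^ 2) (Ioi 0) :=
    hg.sq.id_mul.integrable (continuousOn_id.mul (hgc.pow 2))
  have i3 : IntegrableOn (fun r => r * (f r * g r)) (Ioi 0) :=
    (hf.mul hg).id_mul.integrable (continuousOn_id.mul (hfc.mul hgc))
  set A := ∫ r in Ioi (0:ℝ), r * f r ^ 2
  set B := ∫ r in Ioi (0:ℝ), r * (f r * g r)
  set D := ∫ r in Ioi (0:ℝ), r * g r ^ 2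
  have h : ∀ t : ℝ, 0 ≤ D * (t * t) + (2 * B) * t + A := by
    intro t
    have : D * (t * t) + (2 * B) * t + A = ∫ r in Ioi (0:ℝ), ((t * t) * (r * g r ^ 2)
       + (2 * t) * (r * (f r * g r)) + r * f r ^ 2) := by
      have i4 : IntegrableOn (fun r => (t * t) * (r * g r ^ 2) + (2 * t) * (r * (f r * g r))) (Ioi 0) :=
        (i2.const_mul _).add (i3.const_mul _)
      rw [integral_add i4 i1, integral_add (i2.const_mul _) (i3.const_mul _),
        integral_const_mul, integral_const_mul]
      ring
    rw [this]
    refine setIntegral_nonneg measurableSet_Ioi (fun r hr => ?_)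
    have hr0 : 0 < r := hr
    nlinarith [mul_nonneg hr0.le (sq_nonneg (t * g r + f r))]
  have := discrim_le_zero h
  unfold discrim at this
  nlinarith

lemma alg_lemma (t K : ℝ) (ht : 0 < t) (hK : 0 < K) : ∃ c > 0, ∃ C > 0, ∀ B V a x y U γ : ℝ,
    t * V - 4 * a * (γ * x) ≤ B → a ^ 2 ≤ K * (y ^ 2 + V) → U ≤ K * (a ^ 2 + V) → 0 ≤ V →
    c * U - C * (γ ^ 2 * x ^ 2 + y ^ 2) ≤ B := by
  -- a^2 ≤ K (y^2+V); 4 a γ x ≤ η a^2 + (4/η) γ²x², η = t/(2K)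
  refine ⟨t / (2 * K * (K + 1)), by positivity, t + 8 * K / t + 1, by positivity, ?_⟩
  intro B V a x y U γ h1 h2 h3 h4
  have e1 : 4 * a * (γ * x) ≤ t / (2 * K) * a ^ 2 + 8 * K / t * (γ * x) ^ 2 := by
    have : t / (2 * K) * a ^ 2 + 8 * K / t * (γ * x) ^ 2 - 4 * a * (γ * x)
      = (t * a - 4 * K * (γ * x)) ^ 2 / (2 * K * t) := by field_simp; ring
    have h : 0 ≤ (t * a - 4 * K * (γ * x)) ^ 2 / (2 * K * t) := by positivity
    linarith
  have e2 : t / (2 * K) * a ^ 2 ≤ t / 2 * (y ^ 2 + V) := by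
    have : t / (2 * K) * a ^ 2 ≤ t / (2 * K) * (K * (y ^ 2 + V)) := by gcongr
    refine this.trans (le_of_eq ?_); field_simp
  have e3 : t / (2 * K * (K + 1)) * U ≤ t / 2 * (y ^ 2 + V) := by
    have : U ≤ K * ((K + 1) * (y ^ 2 + V)) := by
      refine h3.trans ?_
      gcongr
      nlinarith [sq_nonneg y]
    calc t / (2 * K * (K + 1)) * U ≤ t / (2 * K * (K + 1)) * (K * ((K + 1) * (y ^ 2 + V))) := by gcongr
      _ = _ := by field_simp
  have e4 : 0 ≤ 8 * K / t * y ^ 2 := by positivity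
  have e5 : 0 ≤ (t+1) * (γ * x) ^ 2 := by positivity
  nlinarith [sq_nonneg y]

lemma sector {q p : ℝ → ℝ} (H : GS q p) {κ : ℝ} (hκ : κ = 0 ∨ κ = 1) {j c ρ γ : ℝ} (hj : j ≤ 3)
    (hc : 0 < c) {w w1 w2 e e1 e2 χ : ℝ → ℝ} (hw : Comp κ j c q w w1 w2 ρ) (hwρ : w ρ = 0)
    (hw1ρ : w1 ρ ≠ 0) (he : Nice κ e e1) (he2 : ∀ r > 0, HasDerivAt e1 (e2 r) r)
    (heq : ∀ r > 0, e2 r + e1 r / r = pot κ j q r * e r + 2 * γ * q r) (heρ : e ρ ≠ 0)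
    (hχ : Dec χ) (hχc : ContinuousOn χ (Ioi 0)) (hM : ∫ r in Ioi (0:ℝ), r * (e r * χ r) ≠ 0)
    (hγ : γ * ∫ r in Ioi (0:ℝ), r * (e r * q r) = 0) :
    ∃ c > 0, ∃ C > 0, ∀ u u' : ℝ → ℝ, Nice κ u u' →
      c * (∫ r in Ioi (0:ℝ), r * u r ^ 2) - C * (γ ^ 2 * (∫ r in Ioi (0:ℝ), r * (u r * q r)) ^ 2
        + (∫ r in Ioi (0:ℝ), r * (u r * χ r)) ^ 2) ≤ Bf κ j q (fun r => u r ^ 2) (fun r => u' r ^ 2) := by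
  have hκ0 : 0 ≤ κ := by rcases hκ with rfl | rfl <;> norm_num
  set M := ∫ r in Ioi (0:ℝ), r * (e r * χ r) with hMdef
  set X := ∫ r in Ioi (0:ℝ), r * χ r ^ 2 with hX
  set Y := ∫ r in Ioi (0:ℝ), r * e r ^ 2 with hY
  have hX0 : 0 ≤ X := setIntegral_nonneg measurableSet_Ioi
    (fun r hr => mul_nonneg (le_of_lt hr) (sq_nonneg _))
  have hY0 : 0 ≤ Y := setIntegral_nonneg measurableSet_Ioi
    (fun r hr => mul_nonneg (le_of_lt hr) (sq_nonneg _))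
  obtain ⟨c', hc', C', hC', halg⟩ := alg_lemma (c / (c + 3)) (2 * (1 + X) / M ^ 2 + 2 * (1 + Y))
    (by positivity) (by positivity)
  refine ⟨c', hc', C', hC', ?_⟩
  intro u u' hu
  set a := u ρ / e ρ with ha
  set v : ℝ → ℝ := fun r => u r - a * e r with hv
  set v' : ℝ → ℝ := fun r => u' r - a * e1 r with hv'
  have hvN : Nice κ v v' := hu.combo hκ he a
  have hvρ : v ρ = 0 := by simp only [hv, ha]; field_simp; ring
  have hvD := hvN.dat hκ
  have huD := hu.dat hκ
  have hqc := H.qc.continuousOn (s := Ioi 0)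
  set V := ∫ r in Ioi (0:ℝ), r * v r ^ 2 with hV
  have hV0 : 0 ≤ V := setIntegral_nonneg measurableSet_Ioi
    (fun r hr => mul_nonneg (le_of_lt hr) (sq_nonneg _))
  have hBv : c / (c + 3) * V ≤ Bf κ j q (fun r => v r ^ 2) (fun r => v' r ^ 2) := by
    refine hvD.coercive H hκ0 hj hc (jacobi H hκ0 hvD hw (Or.inr ⟨hwρ, hw1ρ, ?_⟩))
    obtain ⟨K, hK⟩ := (hvN.hd ρ hw.rpos).isBigO_sub.bound
    refine ⟨K ^ 2, ?_⟩
    filter_upwards [hK] with r hr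
    rw [hvρ, sub_zero, Real.norm_eq_abs, Real.norm_eq_abs] at hr
    rw [← sq_abs, ← sq_abs (r - ρ), ← mul_pow]
    gcongr
  have I1 : ∀ {f g : ℝ → ℝ}, Dec f → Dec g → ContinuousOn f (Ioi 0) → ContinuousOn g (Ioi 0) →
      IntegrableOn (fun r => r * (f r * g r)) (Ioi 0) := fun hf hg hfc hgc =>
    (hf.mul hg).id_mul.integrable (continuousOn_id.mul (hfc.mul hgc))
  have I2 : ∀ {f : ℝ → ℝ}, Dec f → ContinuousOn f (Ioi 0) →
      IntegrableOn (fun r => r * f r ^ 2) (Ioi 0) := fun hf hfc =>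
    hf.sq.id_mul.integrable (continuousOn_id.mul (hfc.pow 2))
  have hx : ∀ {g : ℝ → ℝ}, Dec g → ContinuousOn g (Ioi 0) →
    ∫ r in Ioi (0:ℝ), r * (v r * g r) = (∫ r in Ioi (0:ℝ), r * (u r * g r)) -
      a * ∫ r in Ioi (0:ℝ), r * (e r * g r) := by
    intro g hg hgc
    rw [← integral_const_mul, ← integral_sub (I1 hu.du hg hu.uc hgc) ((I1 he.du hg he.uc hgc).const_mul a)]
    congr 1; ext r; simp only [hv]; ring
  -- the difference of the forms
  have hdiff : Bf κ j q (fun r => u r ^ 2) (fun r => u' r ^ 2) - Bf κ j q (fun r => v r ^ 2) (fun r => v' r ^ 2)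
      = - 4 * a * (γ * ∫ r in Ioi (0:ℝ), r * (u r * q r)) := by
    unfold Bf
    rw [← integral_sub (huD.integrable H hκ0 j) (hvD.integrable H hκ0 j)]
    have iF : IntegrableOn (fun r => (r * (u' r ^ 2 + pot κ j q r * u r ^ 2) -
       r * (v' r ^ 2 + pot κ j q r * v r ^ 2)) + 2 * a * γ * (r * (u r * q r) + r * (v r * q r))) (Ioi 0) :=
      ((huD.integrable H hκ0 j).sub (hvD.integrable H hκ0 j)).add
        (((I1 hu.du H.dq hu.uc hqc).add (I1 hvN.du H.dq hvN.uc hqc)).const_mul _)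
    have hF : ∫ r in Ioi (0:ℝ), ((r * (u' r ^ 2 + pot κ j q r * u r ^ 2) -
       r * (v' r ^ 2 + pot κ j q r * v r ^ 2)) + 2 * a * γ * (r * (u r * q r) + r * (v r * q r)))
       = 0 - (fun r => a * (r * e1 r * (u r + v r))) 0 := by
      have huv := hu.du.add hvN.du
      refine integral_Ioi_of_hasDerivAt_of_tendsto (f := fun r => a * (r * e1 r * (u r + v r))) ?_ ?_ iF ?_
      · have hs : Ici (0:ℝ) = insert 0 (Ioi 0) := by ext x; simp [le_iff_eq_or_lt, eq_comm]
        rw [hs, continuousWithinAt_insert_self, ContinuousWithinAt]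
        simp only [zero_mul, mul_zero]
        obtain ⟨K, hK0, hK⟩ := ((he.du'.mul huv).const_mul a).bdd
        refine squeeze_zero_norm' (a := fun r => r * K) ?_ ?_
        · filter_upwards [self_mem_nhdsWithin] with r hr
          have hr0 : 0 < r := hr
          have h1 := hK r hr
          rw [Real.norm_eq_abs, show a * (r * e1 r * (u r + v r)) = r * (a * (e1 r * (u r + v r))) by ring,
            abs_mul, abs_of_pos hr0]
          gcongr
        · have : Continuous (fun r : ℝ => r * K) := by fun_prop
          have h := this.tendsto 0
          simp at h
          exact h.mono_left nhdsWithin_le_nhds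
      · intro r hr
        have hr0 : 0 < r := hr
        have h1 := (((hasDerivAt_id r).mul (he2 r hr)).mul ((hu.hd r hr).add (hvN.hd r hr))).const_mul a
        refine h1.congr_deriv ?_
        have h2 := heq r hr
        have h3 : e1 r + r * e2 r = r * (pot κ j q r * e r + 2 * γ * q r) := by
          rw [← h2]; field_simp; ring
        simp only [id, Pi.mul_apply, one_mul, Pi.add_apply]
        rw [h3]
        simp only [hv, hv']
        ring
      · have := ((he.du'.mul huv).id_mul.const_mul a).tendsto
        refine this.congr (fun r => by ring)
    simp only [zero_mul, mul_zero, sub_zero] at hF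
    have J1 := (huD.integrable H hκ0 j).sub (hvD.integrable H hκ0 j)
    have J2 := (I1 hu.du H.dq hu.uc hqc)
    have J3 := (I1 hvN.du H.dq hvN.uc hqc)
    have J4 : IntegrableOn (fun r => 2 * a * γ * (r * (u r * q r) + r * (v r * q r))) (Ioi 0) :=
      (J2.add J3).const_mul (2 * a * γ)
    have J1' : IntegrableOn (fun r => r * (u' r ^ 2 + pot κ j q r * u r ^ 2) -
       r * (v' r ^ 2 + pot κ j q r * v r ^ 2)) (Ioi 0) := J1
    rw [integral_add J1' J4, integral_const_mul, integral_add J2 J3,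
      hx H.dq hqc] at hF
    simp only [Pi.sub_apply] at hF
    linear_combination hF + 2 * a ^ 2 * hγ
  refine halg _ V a _ _ _ γ ?_ ?_ ?_ hV0
  · linarith
  · have h1 := hx hχ hχc
    rw [← hMdef] at h1
    have h2 := weighted_cs hvN.du hχ hvN.uc hχc
    rw [← hV, ← hX] at h2
    set y := ∫ r in Ioi (0:ℝ), r * (u r * χ r)
    set z := ∫ r in Ioi (0:ℝ), r * (v r * χ r)
    have h3 : a * M = y - z := by linarith
    have hM2 : 0 < M ^ 2 := by positivity
    have h4 : a ^ 2 * M ^ 2 ≤ 2 * (1 + X) * (y ^ 2 + V) := by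
      rw [← mul_pow, h3]
      nlinarith [sq_nonneg (y + z), mul_nonneg hX0 (sq_nonneg y)]
    have h5 : a ^ 2 ≤ 2 * (1 + X) / M ^ 2 * (y ^ 2 + V) := by
      rw [div_mul_eq_mul_div, le_div_iff₀ hM2]; exact h4
    have : 0 ≤ 2 * (1 + Y) * (y ^ 2 + V) := by positivity
    linarith
  · have h1 : (∫ r in Ioi (0:ℝ), r * u r ^ 2) ≤ 2 * a ^ 2 * Y + 2 * V := by
      rw [hY, hV, ← integral_const_mul, ← integral_const_mul, ← integral_add ((I2 he.du he.uc).const_mul _)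
        ((I2 hvN.du hvN.uc).const_mul _)]
      refine setIntegral_mono_on (I2 hu.du hu.uc) (((I2 he.du he.uc).const_mul _).add
        ((I2 hvN.du hvN.uc).const_mul _)) measurableSet_Ioi ?_
      intro r hr
      have hr0 : 0 < r := hr
      simp only [hv]
      nlinarith [mul_nonneg hr0.le (sq_nonneg (u r - 2 * a * e r))]
    have h2 : 0 ≤ 2 * (1 + X) / M ^ 2 * (a ^ 2 + V) := by positivity
    nlinarith [mul_nonneg hY0 hV0, sq_nonneg a]


lemma Dec.div_id {f : ℝ → ℝ} (hf : Dec f) (h : ∃ C, ∀ r > 0, |f r| ≤ C * r) : Dec (fun r => f r / r) := by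
  obtain ⟨C, hC⟩ := h
  intro N
  obtain ⟨D, hD⟩ := hf N
  refine ⟨2 ^ N * |C| + |D|, fun r hr => ?_⟩
  have hr0 : 0 < r := hr
  rw [abs_div, abs_of_pos hr0]
  rcases le_total r 1 with h1 | h1
  · have : |f r| / r ≤ |C| := by
      rw [div_le_iff₀ hr]
      exact (hC r hr).trans (by gcongr; exact le_abs_self C)
    calc (1 + r) ^ N * (|f r| / r) ≤ 2 ^ N * |C| := by gcongr; linarith
      _ ≤ _ := by have := abs_nonneg D; linarith
  · calc (1 + r) ^ N * (|f r| / r) ≤ (1 + r) ^ N * |f r| := by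
          gcongr; exact div_le_self (by positivity) h1
      _ ≤ |D| := (hD r hr).trans (le_abs_self _)
      _ ≤ _ := by have : 0 ≤ 2 ^ N * |C| := by positivity
                  linarith

lemma int_deriv_zero {F f : ℝ → ℝ} (hF : Dec F) (hc : ContinuousWithinAt F (Ici 0) 0) (h0 : F 0 = 0)
    (hd : ∀ r > 0, HasDerivAt F (f r) r) (hf : IntegrableOn f (Ioi 0)) :
    ∫ r in Ioi (0:ℝ), f r = 0 := by
  have := integral_Ioi_of_hasDerivAt_of_tendsto hc (fun r hr => hd r hr) hf hF.tendsto
  rw [this, h0]; simp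

lemma int_pos {f : ℝ → ℝ} (hf : IntegrableOn f (Ioi 0)) (h : ∀ r > 0, 0 < f r) :
    0 < ∫ r in Ioi (0:ℝ), f r := by
  rw [setIntegral_pos_iff_support_of_nonneg_ae]
  · have : Function.support f ∩ Ioi 0 = Ioi 0 := by
      ext r; simp only [mem_inter_iff, Function.mem_support, mem_Ioi, and_iff_right_iff_imp]
      intro hr; exact (h r hr).ne'
    rw [this]; simp
  · exact (ae_restrict_iff' measurableSet_Ioi).2 (Eventually.of_forall fun r hr => (h r hr).le)
  · exact hf

namespace GS
variable {q p : ℝ → ℝ} (H : GS q p)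
include H

/-- first derivative of p -/
noncomputable def p1 (q p : ℝ → ℝ) (r : ℝ) : ℝ := q r - q r ^ 3 - p r / r
/-- second derivative of p -/
noncomputable def p2 (q p : ℝ → ℝ) (r : ℝ) : ℝ := p r - 3 * q r ^ 2 * p r - p1 q p r / r + p r / r ^ 2

lemma hp1 (r : ℝ) (hr : 0 < r) : HasDerivAt (p1 q p) (p2 q p r) r := by
  have h := ((H.hq r).sub ((H.hq r).pow 3)).sub ((H.hp r hr).div (hasDerivAt_id r) hr.ne')
  refine h.congr_deriv ?_
  simp only [p2, p1, id]
  field_simp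
  push_cast
  ring

lemma abs_p (r : ℝ) (hr : 0 < r) : |p r| = - p r := abs_of_neg (H.p_neg r hr)

lemma dec_p1 : Dec (p1 q p) := by
  obtain ⟨C, _, hC⟩ := H.p_bound
  have h1 : Dec (fun r => p r / r) := H.dp.div_id ⟨C, fun r hr => by rw [H.abs_p r hr]; exact hC r hr⟩
  have h2 : Dec (fun r => q r ^ 3) := by
    have := H.dq.sq.mul H.dq
    refine this.mono 1 0 (fun r hr => by simp [← pow_succ])
  exact (H.dq.sub h2).sub h1

lemma p1_cont : ContinuousOn (p1 q p) (Ioi 0) :=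
  fun r hr => (H.hp1 r hr).continuousAt.continuousWithinAt

lemma nice_q : Nice 0 q p where
  hd r _ := H.hq r
  uc' := H.pc.continuousOn
  du := H.dq
  du' := H.dp
  lip := ⟨0, fun r _ => by simp⟩

lemma nice_p : Nice 1 p (p1 q p) where
  hd r hr := H.hp r hr
  uc' := H.p1_cont
  du := H.dp
  du' := H.dec_p1
  lip := by
    obtain ⟨C, _, hC⟩ := H.p_bound
    exact ⟨C, fun r hr => by rw [H.abs_p r hr, one_mul]; exact hC r hr⟩

lemma hl1 (r : ℝ) (hr : 0 < r) : HasDerivAt (fun r => q r + r * p r) (p r + r * (q r - q r ^ 3)) r := by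
  refine ((H.hq r).add ((hasDerivAt_id r).mul (H.hp r hr))).congr_deriv ?_
  simp only [id]; field_simp; ring

lemma hl2 (r : ℝ) (hr : 0 < r) : HasDerivAt (fun r => p r + r * (q r - q r ^ 3))
    (p1 q p r + ((q r - q r ^ 3) + r * (p r - 3 * q r ^ 2 * p r))) r := by
  refine ((H.hp r hr).add ((hasDerivAt_id r).mul ((H.hq r).sub ((H.hq r).pow 3)))).congr_deriv ?_
  simp [p1]

lemma nice_l : Nice 0 (fun r => q r + r * p r) (fun r => p r + r * (q r - q r ^ 3)) where
  hd r hr := H.hl1 r hr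
  uc' := by have := H.qc; have := H.pc; fun_prop
  du := H.dq.add H.dp.id_mul
  du' := by
    have h2 : Dec (fun r => q r ^ 3) := by
      have := H.dq.sq.mul H.dq
      refine this.mono 1 0 (fun r hr => by simp [← pow_succ])
    exact H.dp.add (H.dq.sub h2).id_mul
  lip := ⟨0, fun r _ => by simp⟩

lemma y_infty : ∃ C > 0, ∀ᶠ r in atTop, |p r / q r| ≤ C := by
  obtain ⟨C, hC, R, hR, h⟩ := H.th_upper
  refine ⟨C, hC, ?_⟩
  filter_upwards [eventually_ge_atTop R] with r hr
  have hr0 : 0 < r := hR.trans_le hr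
  have h1 := h r hr
  have h2 := H.p_eq r
  have hq := H.pos r
  rw [abs_div, H.abs_p r hr0, abs_of_pos hq, div_le_iff₀ hq]
  have : r * (- p r) ≤ r * (C * q r) := by nlinarith
  exact le_of_mul_le_mul_left this hr0

lemma pp_zero : ∃ C > 0, ∀ᶠ r in 𝓝[>] 0, |r * p1 q p r / p r| ≤ C := by
  have hqc := H.qc
  have hc : ContinuousAt (fun r => 4 * |1 - q r ^ 2| / q r ^ 2 + 1) 0 := by
    have : q 0 ^ 2 ≠ 0 := (pow_pos (H.pos 0) 2).ne'
    fun_prop (disch := assumption)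
  refine ⟨4 * |1 - q 0 ^ 2| / q 0 ^ 2 + 1 + 1, by positivity, ?_⟩
  have := (hc.eventually (gt_mem_nhds (lt_add_one _))).filter_mono (nhdsWithin_le_nhds (s := Ioi 0))
  filter_upwards [this, self_mem_nhdsWithin] with r h1 hr
  have hr0 : 0 < r := hr
  refine le_trans ?_ h1.le
  have hp := H.p_neg r hr0
  have hq := H.pos r
  have ht := H.th_pos r hr0
  have h2 := H.th_ge r hr0.le
  have hpe : p r = - th q p r * q r / r := by have := H.p_eq r; field_simp; linarith
  have e : r * p1 q p r / p r = - (r ^ 2 / th q p r) * (1 - q r ^ 2) - 1 := by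
    unfold p1; rw [hpe]; field_simp; ring
  rw [e]
  have h3 : r ^ 2 / th q p r ≤ 4 / q r ^ 2 := by
    rw [div_le_div_iff₀ ht (by positivity)]; exact h2
  calc |-(r ^ 2 / th q p r) * (1 - q r ^ 2) - 1| ≤ |-(r ^ 2 / th q p r) * (1 - q r ^ 2)| + |1| := abs_sub _ _
    _ = (r ^ 2 / th q p r) * |1 - q r ^ 2| + 1 := by
      rw [abs_mul, abs_neg, abs_of_pos (by positivity : 0 < r ^ 2 / th q p r), abs_one]
    _ ≤ 4 / q r ^ 2 * |1 - q r ^ 2| + 1 := by gcongr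
    _ = _ := by ring

lemma pp_infty : ∃ C > 0, ∀ᶠ r in atTop, |p1 q p r / p r| ≤ C * r := by
  obtain ⟨K, hK0, hK⟩ := H.dq.bdd
  have ht1 := H.th_pos 1 one_pos
  refine ⟨(1 + K ^ 2) / th q p 1 + 1, by positivity, ?_⟩
  filter_upwards [eventually_ge_atTop 1] with r hr
  have hr0 : 0 < r := by linarith
  have hp := H.p_neg r hr0
  have hq := H.pos r
  have ht := H.th_pos r hr0
  have h2 := H.th_strictMono.monotoneOn (by simp : (1:ℝ) ∈ Ici 0) hr0.le hr
  have hpe : p r = - th q p r * q r / r := by have := H.p_eq r; field_simp; linarith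
  have e : p1 q p r / p r = - (r / th q p r) * (1 - q r ^ 2) - 1 / r := by
    unfold p1; rw [hpe]; field_simp; ring
  rw [e]
  have hk := hK r hr0
  rw [abs_of_pos hq] at hk
  have h5 : |1 - q r ^ 2| ≤ 1 + K ^ 2 := by
    have : q r ^ 2 ≤ K ^ 2 := by gcongr
    rw [abs_le]; constructor <;> nlinarith [sq_nonneg (q r)]
  calc |-(r / th q p r) * (1 - q r ^ 2) - 1 / r| ≤ |-(r / th q p r) * (1 - q r ^ 2)| + |1 / r| := abs_sub _ _
    _ = (r / th q p r) * |1 - q r ^ 2| + 1 / r := by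
      rw [abs_mul, abs_neg, abs_of_pos (by positivity : 0 < r / th q p r), abs_of_pos (by positivity : 0 < 1 / r)]
    _ ≤ (r / th q p 1) * (1 + K ^ 2) + r := by
      gcongr
      rw [div_le_iff₀ hr0]; nlinarith
    _ = _ := by ring

lemma comp_R : ∃ c > 0, Comp 4 3 c q p (p1 q p) (p2 q p) 1 := by
  obtain ⟨K, hK0, hK⟩ := (H.dq.sq.pow_mul 2).bdd
  refine ⟨3 / (K + 1), by positivity, ?_⟩
  refine ⟨one_pos, fun r hr => H.hp r hr, fun r hr => H.hp1 r hr, fun r hr _ => (H.p_neg r hr).ne, ?_, ?_, ?_⟩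
  · intro r hr
    have hr0 : 0 < r := hr
    have e : (p2 q p r + p1 q p r / r - pot 4 3 q r * p r) * p r = - (3 / r ^ 2) * p r ^ 2 := by
      unfold p2 pot; field_simp; ring
    rw [e]
    have h1 := hK r hr
    rw [abs_of_nonneg (by positivity)] at h1
    have : 3 / (K + 1) * q r ^ 2 ≤ 3 / r ^ 2 := by
      rw [div_mul_eq_mul_div, div_le_div_iff₀ (by positivity) (by positivity)]
      nlinarith
    nlinarith [mul_le_mul_of_nonneg_right this (sq_nonneg (p r))]
  · obtain ⟨C, hC0, hC⟩ := H.pp_zero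
    refine ⟨C, ?_⟩
    filter_upwards [hC, self_mem_nhdsWithin] with r h hr
    have hr0 : 0 < r := hr
    nlinarith [mul_pos hC0 hr0]
  · obtain ⟨C, _, hC⟩ := H.pp_infty
    exact ⟨C, hC⟩

lemma rp_zero : ∃ C > 0, ∀ᶠ r in 𝓝[>] 0, |r * p r / q r| ≤ C * r := by
  have hqc := H.qc
  have hpc := H.pc
  have hc : ContinuousAt (fun r => |p r / q r|) 0 := by
    have : q 0 ≠ 0 := (H.pos 0).ne'
    fun_prop (disch := assumption)
  refine ⟨|p 0 / q 0| + 1, by positivity, ?_⟩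
  have := (hc.eventually (gt_mem_nhds (lt_add_one _))).filter_mono (nhdsWithin_le_nhds (s := Ioi 0))
  filter_upwards [this, self_mem_nhdsWithin] with r h1 hr
  have hr0 : 0 < r := hr
  rw [mul_div_assoc, abs_mul, abs_of_pos hr0, mul_comm]
  gcongr

lemma comp_N : ∃ c > 0, Comp 1 1 c q q p (p1 q p) 1 := by
  obtain ⟨K, hK0, hK⟩ := (H.dq.sq.pow_mul 2).bdd
  refine ⟨1 / (K + 1), by positivity, ?_⟩
  refine ⟨one_pos, fun r _ => H.hq r, fun r hr => H.hp r hr, fun r _ _ => (H.pos r).ne', ?_, ?_, ?_⟩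
  · intro r hr
    have hr0 : 0 < r := hr
    have e : (p1 q p r + p r / r - pot 1 1 q r * q r) * q r = - (1 / r ^ 2) * q r ^ 2 := by
      unfold p1 pot; field_simp; ring
    rw [e]
    have h1 := hK r hr
    rw [abs_of_nonneg (by positivity)] at h1
    have : 1 / (K + 1) * q r ^ 2 ≤ 1 / r ^ 2 := by
      rw [div_mul_eq_mul_div, div_le_div_iff₀ (by positivity) (by positivity)]
      nlinarith
    nlinarith [mul_le_mul_of_nonneg_right this (sq_nonneg (q r))]
  · obtain ⟨C, hC0, hC⟩ := H.rp_zero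
    refine ⟨C, ?_⟩
    filter_upwards [hC] with r h
    linarith
  · obtain ⟨C, hC0, hC⟩ := H.y_infty
    refine ⟨C, ?_⟩
    filter_upwards [hC, eventually_ge_atTop 1] with r h hr
    nlinarith

/-- remaining part, `L₊` -/
lemma coer_R : ∃ c > 0, ∀ m m' n, Dat 4 m m' n → c * ∫ r in Ioi (0:ℝ), r * m r ≤ Bf 4 3 q m n := by
  obtain ⟨c, hc, h⟩ := H.comp_R
  refine ⟨c / (c + 3), by positivity, fun m m' n hd => ?_⟩
  exact hd.coercive H (by norm_num) le_rfl hc (jacobi H (by norm_num) hd h (Or.inl (H.p_neg 1 one_pos).ne))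

/-- nonradial part, `L₋` -/
lemma coer_N : ∃ c > 0, ∀ m m' n, Dat 1 m m' n → c * ∫ r in Ioi (0:ℝ), r * m r ≤ Bf 1 1 q m n := by
  obtain ⟨c, hc, h⟩ := H.comp_N
  refine ⟨c / (c + 3), by positivity, fun m m' n hd => ?_⟩
  exact hd.coercive H (by norm_num) (by norm_num) hc (jacobi H (by norm_num) hd h (Or.inl (H.pos 1).ne'))

lemma key3 {ρ : ℝ} (hρ : 0 < ρ) (hθ : th q p ρ = 1) : ∃ c > 0, ∀ r > 0,
    c * q r ^ 2 * (r ^ 2 - ρ ^ 2) ^ 2 ≤ 4 * (th q p r - 1) * (r ^ 2 - ρ ^ 2) := by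
  have hqc := H.qc
  have hthc := H.thc
  have hq0 := H.pos 0
  have hqρ := H.pos ρ
  have hle : q ρ ≤ q 0 := H.q_anti (mem_Ici.2 le_rfl) hρ.le hρ.le
  set d := q ρ ^ 2 / (4 * q 0 ^ 2) with hd
  have hd0 : 0 < d := by positivity
  have hd1 : d ≤ 1 / 4 := by
    rw [hd, div_le_div_iff₀ (by positivity) (by norm_num)]
    nlinarith
  refine ⟨4 * d, by positivity, fun r hr => ?_⟩
  have hr0 : 0 < r := hr
  rcases le_total r ρ with h | h
  · have hm : AntitoneOn (fun r => d * q 0 ^ 2 * (r ^ 2 - ρ ^ 2) - th q p r) (Icc 0 ρ) := by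
      refine antitone_of_deriv_Icc (by fun_prop) (fun r h1 h2 =>
        ((((hasDerivAt_id r).pow 2).sub_const (ρ ^ 2)).const_mul (d * q 0 ^ 2)).sub (H.hth r h1)) ?_
      intro r h1 h2
      have h3 := H.th'_ge r h1
      have h4 : q ρ ≤ q r := H.q_anti h1.le hρ.le h2.le
      have h5 : q ρ ^ 2 ≤ q r ^ 2 := by gcongr
      have h6 : d * q 0 ^ 2 = q ρ ^ 2 / 4 := by rw [hd]; field_simp
      simp only [id, Nat.cast_ofNat, Nat.add_one_sub_one, pow_one, mul_one]
      rw [h6]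
      nlinarith
    have h1 := hm ⟨hr0.le, h⟩ ⟨hρ.le, le_rfl⟩ h
    simp only [hθ, sub_self, mul_zero] at h1
    have h2 : q r ≤ q 0 := H.q_anti (mem_Ici.2 le_rfl) hr0.le hr0.le
    have h3 : q r ^ 2 ≤ q 0 ^ 2 := by have := H.pos r; gcongr
    have h4 : 0 ≤ ρ ^ 2 - r ^ 2 := by nlinarith
    have h5 : d * q r ^ 2 * (ρ ^ 2 - r ^ 2) ≤ d * q 0 ^ 2 * (ρ ^ 2 - r ^ 2) := by gcongr
    nlinarith
  · have hm : AntitoneOn (fun r => d * (q r ^ 2 * (r ^ 2 - ρ ^ 2)) - th q p r) (Ici ρ) := by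
      refine antitone_of_deriv (by fun_prop) (fun r h1 =>
        ((((H.hq r).pow 2).mul (((hasDerivAt_id r).pow 2).sub_const (ρ ^ 2))).const_mul d).sub (H.hth r (hρ.trans h1))) ?_
      intro r h1
      have hr0 : 0 < r := hρ.trans h1
      have h3 := H.th'_ge r hr0
      have hp := H.p_neg r hr0
      have hq := H.pos r
      have h1' : ρ < r := h1
      have h4 : 0 ≤ r ^ 2 - ρ ^ 2 := by nlinarith
      have h5 : 0 ≤ q r * (- p r) * (r ^ 2 - ρ ^ 2) := by
        have : 0 ≤ - p r := by linarith
        positivity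
      simp only [id, Nat.cast_ofNat, Nat.add_one_sub_one, pow_one, mul_one, Pi.pow_apply]
      have h6 : 0 ≤ r * q r ^ 2 := by positivity
      nlinarith [mul_nonneg hd0.le h5, mul_nonneg (sub_nonneg.2 hd1) h6]
    have h1 := hm (mem_Ici.2 le_rfl) h h
    simp only [hθ, sub_self, mul_zero] at h1
    have h4 : 0 ≤ r ^ 2 - ρ ^ 2 := by nlinarith
    nlinarith

lemma key2 {ρ : ℝ} (hρ : 0 < ρ) (hq1 : q ρ = 1) : ∃ c > 0, ∀ r > 0,
    c * q r ^ 2 * th q p r * (r ^ 2 - ρ ^ 2) ^ 2 ≤ 4 * (1 - q r ^ 2) * (r ^ 2 - ρ ^ 2) * r ^ 2 := by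
  have hqc := H.qc
  have hthc := H.thc
  have hq0 := H.pos 0
  obtain ⟨A, hA0, hA⟩ := H.p_bound
  have hle : 1 ≤ q 0 := hq1 ▸ H.q_anti (mem_Ici.2 le_rfl) hρ.le hρ.le
  set d := min (1/3) (1 / (4 * q 0 ^ 2 * (A + 1))) with hd
  have hd0 : 0 < d := by positivity
  have hd1 : d ≤ 1 / 3 := min_le_left _ _
  have hd2 : d * (q 0 ^ 2 * (A + 1)) ≤ 1 / 4 := by
    have := min_le_right (1/3) (1 / (4 * q 0 ^ 2 * (A + 1)))
    rw [← hd, le_div_iff₀ (by positivity)] at this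
    linarith
  refine ⟨4 * d, by positivity, fun r hr => ?_⟩
  have hr0 : 0 < r := hr
  rcases le_total r ρ with h | h
  · have hm : AntitoneOn (fun r => q r ^ 2 + 1 / 4 * (r ^ 2)) (Icc 0 ρ) := by
      refine antitone_of_deriv_Icc (by fun_prop) (fun r h1 h2 =>
        ((H.hq r).pow 2).add (((hasDerivAt_id r).pow 2).const_mul (1 / 4))) ?_
      intro r h1 h2
      have h3 := H.th_ge r h1.le
      have h4 : 1 ≤ q r := hq1 ▸ H.q_anti h1.le hρ.le h2.le
      have h5 := H.p_eq r
      simp only [id, Nat.cast_ofNat, Nat.add_one_sub_one, pow_one, mul_one]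
      have h6 : r * (- p r) ≥ r * (r / 4) := by
        have : 1 ≤ q r ^ 2 := by nlinarith
        nlinarith [H.th_pos r h1]
      have h7 : r / 4 ≤ - p r := le_of_mul_le_mul_left h6 h1
      nlinarith
    have h1 := hm ⟨hr0.le, h⟩ ⟨hρ.le, le_rfl⟩ h
    simp only [hq1] at h1
    have h2 : q r ≤ q 0 := H.q_anti (mem_Ici.2 le_rfl) hr0.le hr0.le
    have h2' : 1 ≤ q r := hq1 ▸ H.q_anti hr0.le hρ.le h
    have h3 : q r ^ 2 ≤ q 0 ^ 2 := by gcongr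
    have h4 : 0 ≤ ρ ^ 2 - r ^ 2 := by nlinarith
    have h5 : th q p r ≤ (A + 1) * r ^ 2 := by
      have e := H.p_eq r
      have e2 := hA r hr
      have e3 := H.th_pos r hr
      nlinarith
    have h6 : d * (q r ^ 2 * th q p r) ≤ 1 / 4 * r ^ 2 := by
      have : q r ^ 2 * th q p r ≤ q 0 ^ 2 * ((A + 1) * r ^ 2) := by
        have e3 := (H.th_pos r hr).le
        gcongr
      calc d * (q r ^ 2 * th q p r) ≤ d * (q 0 ^ 2 * ((A + 1) * r ^ 2)) := by gcongr
        _ = d * (q 0 ^ 2 * (A + 1)) * r ^ 2 := by ring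
        _ ≤ _ := by gcongr
    have h7 : d * (q r ^ 2 * th q p r) * (ρ ^ 2 - r ^ 2) ≤ (q r ^ 2 - 1) * r ^ 2 := by
      calc d * (q r ^ 2 * th q p r) * (ρ ^ 2 - r ^ 2) ≤ 1 / 4 * r ^ 2 * (ρ ^ 2 - r ^ 2) := by gcongr
        _ = (1 / 4 * (ρ ^ 2 - r ^ 2)) * r ^ 2 := by ring
        _ ≤ _ := by gcongr; linarith
    nlinarith [mul_le_mul_of_nonneg_right h7 h4]
  · have hm : AntitoneOn (fun r => q r ^ 2 * (1 + d * (th q p r * (1 - ρ ^ 2 / r ^ 2)))) (Ici ρ) := by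
      refine antitone_of_deriv (f' := fun r => q r ^ 2 / r * (-2 * th q p r + d * ((- th q p r ^ 2 - r ^ 2 * (1 - q r ^ 2))
         * (1 - ρ ^ 2 / r ^ 2) + th q p r * (2 * ρ ^ 2 / r ^ 2)))) ?_ ?_ ?_
      · have : ∀ r ∈ Ici ρ, r ^ 2 ≠ 0 := fun r hr => pow_ne_zero _ (hρ.trans_le hr).ne'
        fun_prop (disch := assumption)
      · intro r h1
        have hr0 : 0 < r := hρ.trans h1
        have e1 : HasDerivAt (fun r : ℝ => 1 - ρ ^ 2 / r ^ 2) (2 * ρ ^ 2 / r ^ 3) r := by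
          refine (((hasDerivAt_const r (ρ ^ 2)).div ((hasDerivAt_id r).pow 2) (by simp; positivity)).const_sub 1).congr_deriv ?_
          simp only [id, Pi.pow_apply]; field_simp; ring
        have e2 := ((H.hq r).pow 2).mul ((((H.hth r hr0).mul e1).const_mul d).const_add 1)
        refine e2.congr_deriv ?_
        have hpe : p r = - th q p r * q r / r := by have := H.p_eq r; field_simp; linarith
        simp only [Pi.pow_apply, Pi.mul_apply, hpe]
        field_simp
        push_cast
        ring
      · intro r h1
        have hr0 : 0 < r := hρ.trans h1
        have h1' : ρ < r := h1
        have hq := H.pos r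
        have ht := H.th_pos r hr0
        have h3 := H.th_ge r hr0.le
        refine mul_nonpos_of_nonneg_of_nonpos (by positivity) ?_
        set s := ρ ^ 2 / r ^ 2 with hs
        have hs0 : 0 ≤ s := by positivity
        have hs1 : s ≤ 1 := by rw [hs, div_le_one (by positivity)]; gcongr
        have e : 2 * ρ ^ 2 / r ^ 2 = 2 * s := by rw [hs]; ring
        rw [e]
        have h4 : (- th q p r ^ 2 - r ^ 2 * (1 - q r ^ 2)) * (1 - s) ≤ (4 * th q p r) * (1 - s) := by
          have : 0 ≤ 1 - s := by linarith
          gcongr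
          nlinarith [sq_nonneg (th q p r), sq_nonneg r]
        have h5 : (- th q p r ^ 2 - r ^ 2 * (1 - q r ^ 2)) * (1 - s) + th q p r * (2 * s) ≤ 6 * th q p r := by
          nlinarith [mul_nonneg ht.le hs0, mul_nonneg ht.le (sub_nonneg.2 hs1)]
        have h6 : d * ((- th q p r ^ 2 - r ^ 2 * (1 - q r ^ 2)) * (1 - s) + th q p r * (2 * s)) ≤ d * (6 * th q p r) := by
          gcongr
        nlinarith
    have h1 := hm (mem_Ici.2 le_rfl) h h
    have e : ρ ^ 2 / ρ ^ 2 = 1 := by field_simp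
    simp only [hq1, e, sub_self, mul_zero, add_zero, one_pow, mul_one] at h1
    have e2 : 1 - ρ ^ 2 / r ^ 2 = (r ^ 2 - ρ ^ 2) / r ^ 2 := by field_simp
    rw [e2] at h1
    have h4 : 0 ≤ r ^ 2 - ρ ^ 2 := by nlinarith
    have h5 : d * q r ^ 2 * th q p r * (r ^ 2 - ρ ^ 2) ≤ (1 - q r ^ 2) * r ^ 2 := by
      have : d * q r ^ 2 * th q p r * (r ^ 2 - ρ ^ 2) = (q r ^ 2 * (1 + d * (th q p r * ((r ^ 2 - ρ ^ 2) / r ^ 2))) - q r ^ 2) * r ^ 2 := by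
        field_simp; ring
      rw [this]
      gcongr
    nlinarith [mul_le_mul_of_nonneg_right h5 h4]

end GS


lemma ratio_zero {ρ : ℝ} (hρ : 0 < ρ) {κ : ℝ} {v v1 : ℝ → ℝ} (hκ : 0 ≤ κ)
    (hv : ∀ r > 0, v r ≠ 0) {C : ℝ} (_hC0 : 0 < C)
    (h : ∀ᶠ r in 𝓝[>] 0, |r * v1 r / v r| ≤ C * κ + C * r) :
    ∃ C, ∀ᶠ r in 𝓝[>] 0, |r * (v1 r * (r ^ 2 - ρ ^ 2) + 2 * r * v r) / (v r * (r ^ 2 - ρ ^ 2))| ≤ C * κ + C * r := by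
  refine ⟨C + 4 / ρ, ?_⟩
  have h2 : ∀ᶠ r in 𝓝[>] (0:ℝ), r < ρ / 2 :=
    (gt_mem_nhds (by positivity : (0:ℝ) < ρ / 2)).filter_mono nhdsWithin_le_nhds
  filter_upwards [h, h2, self_mem_nhdsWithin] with r h h2 hr
  have hr0 : 0 < r := hr
  have hd : 0 < ρ ^ 2 - r ^ 2 := by nlinarith
  have hd' : r ^ 2 - ρ ^ 2 ≠ 0 := by linarith
  have hv0 := hv r hr0
  have e : r * (v1 r * (r ^ 2 - ρ ^ 2) + 2 * r * v r) / (v r * (r ^ 2 - ρ ^ 2))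
      = r * v1 r / v r - 2 * r ^ 2 / (ρ ^ 2 - r ^ 2) := by
    have : ρ ^ 2 - r ^ 2 ≠ 0 := hd.ne'
    rw [show r ^ 2 - ρ ^ 2 = - (ρ ^ 2 - r ^ 2) by ring]
    field_simp
    ring
  rw [e]
  refine (abs_sub _ _).trans ?_
  have : |2 * r ^ 2 / (ρ ^ 2 - r ^ 2)| ≤ 4 / ρ * r := by
    rw [abs_of_pos (by positivity), div_le_iff₀ hd, div_mul_eq_mul_div, div_mul_eq_mul_div, le_div_iff₀ hρ]
    nlinarith [mul_pos hr0 hr0, mul_pos hr0 hρ, mul_pos (mul_pos hr0 hρ) (sub_pos.2 h2)]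
  have : 0 ≤ 4 / ρ * κ := by positivity
  nlinarith

lemma ratio_infty {ρ : ℝ} (hρ : 0 < ρ) {v v1 : ℝ → ℝ}
    (hv : ∀ r > 0, v r ≠ 0) {C : ℝ} (h : ∀ᶠ r in atTop, |v1 r / v r| ≤ C * r) :
    ∃ C, ∀ᶠ r in atTop, |(v1 r * (r ^ 2 - ρ ^ 2) + 2 * r * v r) / (v r * (r ^ 2 - ρ ^ 2))| ≤ C * r := by
  refine ⟨C + 4, ?_⟩
  filter_upwards [h, eventually_ge_atTop 1, eventually_ge_atTop (2 * ρ)] with r h h1 h2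
  have hr0 : 0 < r := by linarith
  have hd : 0 < r ^ 2 - ρ ^ 2 := by nlinarith
  have hv0 := hv r hr0
  have e : (v1 r * (r ^ 2 - ρ ^ 2) + 2 * r * v r) / (v r * (r ^ 2 - ρ ^ 2))
      = v1 r / v r + 2 * r / (r ^ 2 - ρ ^ 2) := by
    field_simp
  rw [e]
  refine (abs_add_le _ _).trans ?_
  have : |2 * r / (r ^ 2 - ρ ^ 2)| ≤ 4 * r := by
    rw [abs_of_pos (by positivity), div_le_iff₀ hd]
    have : 1 / 2 ≤ r ^ 2 - ρ ^ 2 := by nlinarith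
    nlinarith
  nlinarith

namespace GS
variable {q p : ℝ → ℝ} (H : GS q p)
include H

lemma int_rqq : ∫ r in Ioi (0:ℝ), r * ((q r + r * p r) * q r) = 0 := by
  have hqc := H.qc
  have hpc := H.pc
  refine int_deriv_zero (F := fun r => r ^ 2 * (q r) ^ 2 / 2) ?_ ?_ (by simp) ?_ ?_
  · refine (H.dq.sq.pow_mul 2).mono 1 0 fun r hr => ?_
    rw [abs_div]; simp only [pow_zero, one_mul, abs_two]
    exact div_le_self (abs_nonneg _) one_le_two
  · exact Continuous.continuousWithinAt (by fun_prop)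
  · intro r hr
    refine ((((hasDerivAt_id r).pow 2).mul ((H.hq r).pow 2)).div_const 2).congr_deriv ?_
    simp only [id, Pi.pow_apply]; push_cast; ring
  · refine Dec.integrable ?_ (by fun_prop)
    exact ((H.dq.add H.dp.id_mul).mul H.dq).id_mul

lemma int_M1 : ∫ r in Ioi (0:ℝ), r * ((q r + r * p r) * (r ^ 2 * q r)) ≠ 0 := by
  have hqc := H.qc
  have hpc := H.pc
  have i1 : IntegrableOn (fun r => r * ((q r + r * p r) * (r ^ 2 * q r))) (Ioi 0) := by
    refine Dec.integrable ?_ (by fun_prop)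
    exact ((H.dq.add H.dp.id_mul).mul (H.dq.pow_mul 2)).id_mul
  have i2 : IntegrableOn (fun r => r ^ 3 * q r ^ 2) (Ioi 0) :=
    (H.dq.sq.pow_mul 3).integrable (by fun_prop)
  have h0 : ∫ r in Ioi (0:ℝ), (r * ((q r + r * p r) * (r ^ 2 * q r)) + r ^ 3 * q r ^ 2) = 0 := by
    refine int_deriv_zero (F := fun r => r ^ 4 * (q r) ^ 2 / 2) ?_ ?_ (by simp) ?_ (i1.add i2)
    · refine (H.dq.sq.pow_mul 4).mono 1 0 fun r hr => ?_
      rw [abs_div]; simp only [pow_zero, one_mul, abs_two]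
      exact div_le_self (abs_nonneg _) one_le_two
    · exact Continuous.continuousWithinAt (by fun_prop)
    · intro r hr
      refine ((((hasDerivAt_id r).pow 4).mul ((H.hq r).pow 2)).div_const 2).congr_deriv ?_
      simp only [id, Pi.pow_apply]; push_cast; ring
  rw [integral_add i1 i2] at h0
  have := int_pos i2 (fun r hr => by have := H.pos r; positivity)
  intro h; rw [h] at h0; linarith

lemma int_M2 : ∫ r in Ioi (0:ℝ), r * (p r * (r * q r)) ≠ 0 := by
  have hqc := H.qc
  have hpc := H.pc
  have i1 : IntegrableOn (fun r => r * (p r * (r * q r))) (Ioi 0) := by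
    refine Dec.integrable ?_ (by fun_prop)
    exact (H.dp.mul H.dq.id_mul).id_mul
  have := int_pos (f := fun r => - (r * (p r * (r * q r)))) i1.neg (fun r hr => by
    have := H.pos r; have hr0 : 0 < r := hr
    have : 0 < - p r := by linarith [H.p_neg r hr]
    rw [show - (r * (p r * (r * q r))) = (r * (- p r * (r * q r))) by ring]
    positivity)
  rw [integral_neg] at this
  intro h; rw [h] at this; simp at this

lemma int_M3 : ∫ r in Ioi (0:ℝ), r * (q r * q r) ≠ 0 := by
  have hqc := H.qc
  have i1 : IntegrableOn (fun r => r * (q r * q r)) (Ioi 0) := by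
    refine Dec.integrable ?_ (by fun_prop)
    exact (H.dq.mul H.dq).id_mul
  exact (int_pos i1 (fun r hr => by have := H.pos r; have hr0 : 0 < r := hr; positivity)).ne'

lemma secD : ∃ c > 0, ∃ C > 0, ∀ u u' : ℝ → ℝ, Nice 0 u u' →
      c * (∫ r in Ioi (0:ℝ), r * u r ^ 2) - C * (∫ r in Ioi (0:ℝ), r * (u r * q r)) ^ 2
         ≤ Bf 0 1 q (fun r => u r ^ 2) (fun r => u' r ^ 2) := by
  obtain ⟨ρ, hρ, hθ⟩ := H.exists_th_one
  obtain ⟨c, hc, hk⟩ := H.key3 hρ hθ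
  have hne : ∀ r > 0, q r ≠ 0 := fun r _ => (H.pos r).ne'
  have hcomp : Comp 0 1 c q (fun r => q r * (r ^ 2 - ρ ^ 2)) (fun r => p r * (r ^ 2 - ρ ^ 2) + 2 * r * q r)
      (fun r => p1 q p r * (r ^ 2 - ρ ^ 2) + 4 * r * p r + 2 * q r) ρ := by
    refine ⟨hρ, ?_, ?_, ?_, ?_, ?_, ?_⟩
    · intro r hr
      refine ((H.hq r).mul (((hasDerivAt_id r).pow 2).sub_const (ρ ^ 2))).congr_deriv ?_
      simp only [id, Pi.pow_apply]; push_cast; ring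
    · intro r hr
      refine (((H.hp r hr).mul (((hasDerivAt_id r).pow 2).sub_const (ρ ^ 2))).add
        (((hasDerivAt_id r).const_mul 2).mul (H.hq r))).congr_deriv ?_
      simp only [id, Pi.pow_apply, p1]; push_cast; ring
    · intro r hr hne'
      refine mul_ne_zero (H.pos r).ne' ?_
      have hr0 : 0 < r := hr
      intro h
      have : (r - ρ) * (r + ρ) = 0 := by linarith
      rcases mul_eq_zero.1 this with h | h
      · exact hne' (by linarith)
      · linarith
    · intro r hr
      have hr0 : 0 < r := hr
      have h1 := hk r hr
      have hq := H.pos r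
      have hpe := H.p_eq r
      have e : (p1 q p r * (r ^ 2 - ρ ^ 2) + 4 * r * p r + 2 * q r) + (p r * (r ^ 2 - ρ ^ 2) + 2 * r * q r) / r
        - pot 0 1 q r * (q r * (r ^ 2 - ρ ^ 2)) = 4 * q r * (1 - th q p r) := by
        have : 4 * r * p r = 4 * (r * p r) := by ring
        rw [this, hpe]
        unfold p1 pot; field_simp; ring
      simp only [e]
      nlinarith [mul_le_mul_of_nonneg_left h1 (sq_nonneg (q r))]
    · obtain ⟨C, hC0, hC⟩ := H.rp_zero
      refine ratio_zero hρ le_rfl hne hC0 ?_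
      filter_upwards [hC] with r h
      linarith
    · obtain ⟨C, hC0, hC⟩ := H.y_infty
      refine ratio_infty hρ hne (C := C) ?_
      filter_upwards [hC, eventually_ge_atTop 1] with r h hr
      nlinarith
  obtain ⟨c, hc, C, hC, h⟩ := sector H (γ := 0) (e := q) (e1 := p) (e2 := p1 q p) (χ := q) (Or.inl rfl) (by norm_num) hc hcomp (by simp)
    (by have := (H.pos ρ).ne'; simp [this, hρ.ne']) H.nice_q (fun r hr => H.hp r hr)
    (fun r hr => by have hr0 : 0 < r := hr; unfold p1 pot; field_simp; ring) (H.pos ρ).ne' H.dq H.qc.continuousOn H.int_M3 (by simp)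
  refine ⟨c, hc, C, hC, fun u u' hu => ?_⟩
  simpa using h u u' hu

lemma secB : ∃ c > 0, ∃ C > 0, ∀ u u' : ℝ → ℝ, Nice 1 u u' →
      c * (∫ r in Ioi (0:ℝ), r * u r ^ 2) - C * (∫ r in Ioi (0:ℝ), r * (u r * (r * q r))) ^ 2
         ≤ Bf 1 3 q (fun r => u r ^ 2) (fun r => u' r ^ 2) := by
  obtain ⟨ρ, hρ, hθ⟩ := H.exists_q_one
  obtain ⟨c, hc, hk⟩ := H.key2 hρ hθ
  have hne : ∀ r > 0, p r ≠ 0 := fun r hr => (H.p_neg r hr).ne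
  have hcomp : Comp 1 3 c q (fun r => p r * (r ^ 2 - ρ ^ 2)) (fun r => p1 q p r * (r ^ 2 - ρ ^ 2) + 2 * r * p r)
      (fun r => p2 q p r * (r ^ 2 - ρ ^ 2) + 4 * r * p1 q p r + 2 * p r) ρ := by
    refine ⟨hρ, ?_, ?_, ?_, ?_, ?_, ?_⟩
    · intro r hr
      refine ((H.hp r hr).mul (((hasDerivAt_id r).pow 2).sub_const (ρ ^ 2))).congr_deriv ?_
      simp only [id, Pi.pow_apply, p1]; push_cast; ring
    · intro r hr
      refine (((H.hp1 r hr).mul (((hasDerivAt_id r).pow 2).sub_const (ρ ^ 2))).add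
        (((hasDerivAt_id r).const_mul 2).mul (H.hp r hr))).congr_deriv ?_
      simp only [id, Pi.pow_apply, p1]; push_cast; ring
    · intro r hr hne'
      refine mul_ne_zero (hne r hr) ?_
      have hr0 : 0 < r := hr
      intro h
      have : (r - ρ) * (r + ρ) = 0 := by linarith
      rcases mul_eq_zero.1 this with h | h
      · exact hne' (by linarith)
      · linarith
    · intro r hr
      have hr0 : 0 < r := hr
      have h1 := hk r hr
      have hq := H.pos r
      have ht := H.th_pos r hr
      have hpe : p r = - th q p r * q r / r := by have := H.p_eq r; field_simp; linarith
      have e : (p2 q p r * (r ^ 2 - ρ ^ 2) + 4 * r * p1 q p r + 2 * p r) + (p1 q p r * (r ^ 2 - ρ ^ 2) + 2 * r * p r) / r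
        - pot 1 3 q r * (p r * (r ^ 2 - ρ ^ 2)) = 4 * r * q r * (1 - q r ^ 2) := by
        unfold p2 p1 pot; field_simp; ring
      simp only [e]
      rw [hpe]
      have k := mul_le_mul_of_nonneg_left h1 (by positivity : 0 ≤ th q p r * q r ^ 2 / r ^ 2)
      have e1 : 4 * r * q r * (1 - q r ^ 2) * (-th q p r * q r / r * (r ^ 2 - ρ ^ 2))
        = - (th q p r * q r ^ 2 / r ^ 2 * (4 * (1 - q r ^ 2) * (r ^ 2 - ρ ^ 2) * r ^ 2)) := by
        field_simp
      have e2 : -c * q r ^ 2 * (-th q p r * q r / r * (r ^ 2 - ρ ^ 2)) ^ 2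
        = - (th q p r * q r ^ 2 / r ^ 2 * (c * q r ^ 2 * th q p r * (r ^ 2 - ρ ^ 2) ^ 2)) := by
        field_simp
      rw [e1, e2]
      linarith
    · obtain ⟨C, hC0, hC⟩ := H.pp_zero
      refine ratio_zero hρ zero_le_one hne hC0 ?_
      filter_upwards [hC, self_mem_nhdsWithin] with r h hr
      have hr0 : 0 < r := hr
      nlinarith [mul_pos hC0 hr0]
    · obtain ⟨C, hC0, hC⟩ := H.pp_infty
      exact ratio_infty hρ hne hC
  have hpρ := (H.p_neg ρ hρ).ne
  have hqc := H.qc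
  obtain ⟨c, hc, C, hC, h⟩ := sector H (γ := 0) (e := p) (e1 := p1 q p) (e2 := p2 q p) (χ := fun r => r * q r) (Or.inr rfl) le_rfl hc hcomp (by simp)
    (by simp [hpρ, hρ.ne']) H.nice_p (fun r hr => H.hp1 r hr)
    (fun r hr => by have hr0 : 0 < r := hr; unfold p2 p1 pot; field_simp; ring) hpρ H.dq.id_mul (by fun_prop) H.int_M2 (by simp)
  refine ⟨c, hc, C, hC, fun u u' hu => ?_⟩
  simpa using h u u' hu

lemma secA : ∃ c > 0, ∃ C > 0, ∀ u u' : ℝ → ℝ, Nice 0 u u' →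
      c * (∫ r in Ioi (0:ℝ), r * u r ^ 2) - C * ((∫ r in Ioi (0:ℝ), r * (u r * q r)) ^ 2
        + (∫ r in Ioi (0:ℝ), r * (u r * (r ^ 2 * q r))) ^ 2)
         ≤ Bf 0 3 q (fun r => u r ^ 2) (fun r => u' r ^ 2) := by
  obtain ⟨ρ, hρ, hβ⟩ := H.exists_rho
  have hqc := H.qc
  have hpc := H.pc
  set β := th q p ρ with hβd
  have hβ0 : 0 < β := H.th_pos ρ hρ
  have hqρ := H.pos ρ
  have hβ1 : 0 < 1 - β := by
    by_contra hcon
    have : (1 - β) * q ρ ^ 2 ≤ 0 := mul_nonpos_of_nonpos_of_nonneg (not_lt.1 hcon) (by positivity)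
    linarith
  have hwe : ∀ r, r * p r + β * q r = q r * (β - th q p r) := fun r => by
    rw [H.p_eq]; ring
  have hcomp : Comp 0 3 (2 * (1 - β) / (β + 2)) q (fun r => r * p r + β * q r) (fun r => r * (q r - q r ^ 3) + β * p r)
      (fun r => (q r - q r ^ 3) + r * (p r - 3 * q r ^ 2 * p r) + β * p1 q p r) ρ := by
    refine ⟨hρ, ?_, ?_, ?_, ?_, ?_, ?_⟩
    · intro r hr
      refine (((hasDerivAt_id r).mul (H.hp r hr)).add ((H.hq r).const_mul β)).congr_deriv ?_
      simp only [id]; field_simp; ring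
    · intro r hr
      refine (((hasDerivAt_id r).mul ((H.hq r).sub ((H.hq r).pow 3))).add ((H.hp r hr).const_mul β)).congr_deriv ?_
      simp [p1]
    · intro r hr hne'
      simp only [hwe]
      refine mul_ne_zero (H.pos r).ne' (sub_ne_zero.2 fun h => hne' ?_)
      exact (H.th_strictMono.injOn (le_of_lt hr) hρ.le (h.symm))
    · intro r hr
      have hr0 : 0 < r := hr
      have h1 := H.key ρ hρ r hr
      rw [← hβd] at h1
      have hq := H.pos r
      have e : ((q r - q r ^ 3) + r * (p r - 3 * q r ^ 2 * p r) + β * p1 q p r) + (r * (q r - q r ^ 3) + β * p r) / r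
        - pot 0 3 q r * (r * p r + β * q r) = 2 * q r * ((1 - β) * (q ρ ^ 2 - q r ^ 2)) := by
        have : (1 - β) * (q ρ ^ 2 - q r ^ 2) = 1 - (1 - β) * q r ^ 2 := by rw [mul_sub, hβ]
        rw [this]
        unfold p1 pot; field_simp; ring
      beta_reduce
      rw [e, hwe]
      have k := mul_le_mul_of_nonneg_left h1 (by positivity : 0 ≤ 2 * (1 - β) / (β + 2) * q r ^ 2)
      have e2 : 2 * (1 - β) / (β + 2) * q r ^ 2 * ((β + 2) * ((q ρ ^ 2 - q r ^ 2) * (th q p r - β)))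
        = 2 * (1 - β) * q r ^ 2 * ((q ρ ^ 2 - q r ^ 2) * (th q p r - β)) := by field_simp
      rw [e2] at k
      generalize 2 * (1 - β) / (β + 2) = c0 at k
      linear_combination k
    · have hc : ContinuousAt (fun r => |(r * (q r - q r ^ 3) + β * p r) / (r * p r + β * q r)|) 0 := by
        have : 0 * p 0 + β * q 0 ≠ 0 := by have := H.pos 0; simp; exact ⟨hβ0.ne', this.ne'⟩
        fun_prop (disch := assumption)
      refine ⟨|(0 * (q 0 - q 0 ^ 3) + β * p 0) / (0 * p 0 + β * q 0)| + 1, ?_⟩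
      have := (hc.eventually (gt_mem_nhds (lt_add_one _))).filter_mono (nhdsWithin_le_nhds (s := Ioi 0))
      filter_upwards [this, self_mem_nhdsWithin] with r h1 hr
      have hr0 : 0 < r := hr
      rw [mul_div_assoc, abs_mul, abs_of_pos hr0, mul_zero, zero_add, mul_comm]
      exact mul_le_mul_of_nonneg_right h1.le hr0.le
    · obtain ⟨K, hK0, hK⟩ := H.dq.bdd
      obtain ⟨C, hC, hCe⟩ := H.y_infty
      have hd : 0 < th q p (ρ + 1) - β := sub_pos.2 (H.th_strictMono hρ.le (by simp; linarith) (by linarith))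
      refine ⟨(1 + K ^ 2 + β * C) / (th q p (ρ + 1) - β), ?_⟩
      filter_upwards [hCe, eventually_ge_atTop (ρ + 1), eventually_ge_atTop 1] with r h1 h2 h3
      have hr0 : 0 < r := by linarith
      have hq := H.pos r
      have h4 : th q p (ρ + 1) ≤ th q p r := H.th_strictMono.monotoneOn (by simp; linarith) hr0.le h2
      have hpos : 0 < th q p r - β := by linarith
      have hk := hK r hr0
      rw [abs_of_pos hq] at hk
      have h5 : |1 - q r ^ 2| ≤ 1 + K ^ 2 := by
        have : q r ^ 2 ≤ K ^ 2 := by gcongr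
        rw [abs_le]; constructor <;> nlinarith [sq_nonneg (q r)]
      have e : (r * (q r - q r ^ 3) + β * p r) / (r * p r + β * q r)
          = (r * (1 - q r ^ 2) + β * (p r / q r)) / (- (th q p r - β)) := by
        rw [hwe, show β - th q p r = - (th q p r - β) by ring]
        field_simp
      rw [e, abs_div, abs_neg, abs_of_pos hpos, div_mul_eq_mul_div, div_le_div_iff₀ hpos hd]
      have h6 : |r * (1 - q r ^ 2) + β * (p r / q r)| ≤ (1 + K ^ 2 + β * C) * r := by
        calc _ ≤ |r * (1 - q r ^ 2)| + |β * (p r / q r)| := abs_add_le _ _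
          _ = r * |1 - q r ^ 2| + β * |p r / q r| := by rw [abs_mul, abs_mul, abs_of_pos hr0, abs_of_pos hβ0]
          _ ≤ r * (1 + K ^ 2) + β * (C * r) := by
            gcongr
            nlinarith
          _ = _ := by ring
      calc _ ≤ (1 + K ^ 2 + β * C) * r * (th q p (ρ + 1) - β) := by gcongr
        _ ≤ _ := by gcongr
  have hw1 : ρ * (q ρ - q ρ ^ 3) + β * p ρ ≠ 0 := by
    have h1 := H.th'_ge ρ hρ
    have hpe : p ρ = - th q p ρ * q ρ / ρ := by have := H.p_eq ρ; field_simp; linarith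
    have e : ρ * (q ρ - q ρ ^ 3) + β * p ρ = - q ρ * ((th q p ρ ^ 2 - ρ ^ 2 * (1 - q ρ ^ 2)) / ρ) := by
      rw [hpe, ← hβd]; field_simp; ring
    rw [e]
    refine mul_ne_zero (by linarith) (ne_of_gt (lt_of_lt_of_le ?_ h1))
    positivity
  obtain ⟨c, hc, C, hC, h⟩ := sector H (γ := 1) (χ := fun r => r ^ 2 * q r) (Or.inl rfl) le_rfl (by positivity) hcomp
    (by simp only [hwe]; rw [← hβd]; ring)
    hw1 H.nice_l (fun r hr => H.hl2 r hr)
    (fun r hr => by have hr0 : 0 < r := hr; unfold p1 pot; field_simp; ring)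
    (by have e : q ρ + ρ * p ρ = q ρ * (1 - β) := by rw [H.p_eq]; ring
        rw [e]; positivity) (H.dq.pow_mul 2) (by fun_prop) H.int_M1 (by rw [H.int_rqq]; ring)
  refine ⟨c, hc, C, hC, fun u u' hu => ?_⟩
  simpa using h u u' hu

end GS


open Real in
noncomputable def fc (g : ℝ → ℝ) (n : ℤ) : ℂ := fourierCoeffOn (neg_lt_self pi_pos) (fun x => (g x : ℂ)) n

open Real in
lemma fc_hasSum {g : ℝ → ℝ} (hg : Continuous g) :
    HasSum (fun n => ‖fc g n‖ ^ 2) ((2 * π)⁻¹ * ∫ x in (-π)..π, g x ^ 2) := by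
  have h := hasSum_sq_fourierCoeffOn (f := fun x => (g x : ℂ)) (neg_lt_self pi_pos) (by
    have hcc : Continuous (fun x => (g x : ℂ)) := Complex.continuous_ofReal.comp hg
    obtain ⟨K, hK⟩ := (isCompact_Icc (a := -π) (b := π)).exists_bound_of_continuousOn hcc.continuousOn
    refine MemLp.of_bound hcc.aestronglyMeasurable K ?_
    exact (ae_restrict_iff' measurableSet_Ioc).2 (Eventually.of_forall fun x hx => hK x (Ioc_subset_Icc_self hx)))
  have e : π - -π = 2 * π := by ring
  rw [e] at h
  simpa [fc] using h

open Real in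
lemma fc_eq {g : ℝ → ℝ} (hg : Continuous g) (n : ℤ) :
    ‖fc g n‖ ^ 2 = (2 * π)⁻¹ ^ 2 * ((∫ x in (-π)..π, g x * cos (n * x)) ^ 2 + (∫ x in (-π)..π, g x * sin (n * x)) ^ 2) := by
  have h1 : fc g n = ((2 * π)⁻¹ * (∫ x in (-π)..π, g x * cos (n * x)) : ℝ) - ((2 * π)⁻¹ * (∫ x in (-π)..π, g x * sin (n * x)) : ℝ) * Complex.I := by
    unfold fc
    rw [fourierCoeffOn_eq_integral]
    have e : π - -π = 2 * π := by ring
    have e2 : ∀ x : ℝ, (fourier (-n) (x : AddCircle (π - -π)) : ℂ) • (g x : ℂ) = ((g x * cos (n * x) : ℝ) : ℂ) - ((g x * sin (n * x) : ℝ) : ℂ) * Complex.I := by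
      intro x
      rw [fourier_coe_apply, e]
      have : 2 * (π:ℂ) * Complex.I * ((-n : ℤ):ℂ) * x / ((2 * π : ℝ) : ℂ) = ((-(n * x) : ℝ) : ℂ) * Complex.I := by
        have : (π : ℂ) ≠ 0 := by exact_mod_cast pi_ne_zero
        push_cast; field_simp
      rw [this, Complex.exp_mul_I, ← Complex.ofReal_cos, ← Complex.ofReal_sin, cos_neg, sin_neg]
      push_cast; simp only [smul_eq_mul]; ring
    simp_rw [e2]
    rw [intervalIntegral.integral_sub, intervalIntegral.integral_mul_const, intervalIntegral.integral_ofReal, intervalIntegral.integral_ofReal, e]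
    · rw [Complex.real_smul]; push_cast; ring
    · exact Continuous.intervalIntegrable (by fun_prop) _ _
    · exact Continuous.intervalIntegrable (by fun_prop) _ _
  rw [h1, Complex.sq_norm, Complex.normSq_apply]
  simp
  ring

open Real in
lemma fc_deriv {g g' : ℝ → ℝ} (hd : ∀ x, HasDerivAt g (g' x) x) (hc : Continuous g') (hper : g π = g (-π)) (n : ℤ) (hn : n ≠ 0) :
    ‖fc g' n‖ ^ 2 = n ^ 2 * ‖fc g n‖ ^ 2 := by
  have h := fourierCoeffOn_of_hasDerivAt (f := fun x => (g x : ℂ)) (f' := fun x => (g' x : ℂ)) (neg_lt_self pi_pos) hn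
    (fun x _ => (hd x).ofReal_comp) ((Complex.continuous_ofReal.comp hc).intervalIntegrable _ _)
  have hπ : (π : ℂ) ≠ 0 := by exact_mod_cast pi_ne_zero
  have hn' : (n : ℂ) ≠ 0 := by exact_mod_cast hn
  have e : fc g' n = Complex.I * n * fc g n := by
    unfold fc
    rw [h, hper]
    push_cast
    simp only [sub_self, mul_zero, zero_sub]
    field_simp
    ring_nf
  rw [e, norm_mul, norm_mul, Complex.norm_I, Complex.norm_intCast, mul_pow, mul_pow, sq_abs]
  ring

open Real in
/-- Bessel remainder -/
noncomputable def bes (g : ℝ → ℝ) : ℝ := (∫ x in (-π)..π, g x ^ 2) - (2 * π)⁻¹ * (∫ x in (-π)..π, g x) ^ 2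
  - π⁻¹ * (∫ x in (-π)..π, g x * cos x) ^ 2 - π⁻¹ * (∫ x in (-π)..π, g x * sin x) ^ 2

open Real in
lemma bessel {g : ℝ → ℝ} (hg : Continuous g) : 0 ≤ bes g := by
  have h := sum_le_hasSum ({0, 1, -1} : Finset ℤ) (fun i _ => sq_nonneg _) (fc_hasSum hg)
  rw [Finset.sum_insert (by simp), Finset.sum_insert (by simp), Finset.sum_singleton, fc_eq hg, fc_eq hg, fc_eq hg] at h
  simp only [Int.cast_zero, zero_mul, cos_zero, sin_zero, mul_one, mul_zero, intervalIntegral.integral_zero, Int.cast_one, one_mul,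
    Int.cast_neg, neg_mul, cos_neg, sin_neg, mul_neg, intervalIntegral.integral_neg, neg_sq] at h
  have := mul_le_mul_of_nonneg_left h (by positivity : 0 ≤ 2 * π)
  unfold bes
  have hπ := pi_pos
  have e : ∀ X Y Z : ℝ, 2 * π * ((2 * π)⁻¹ ^ 2 * (X ^ 2 + 0 ^ 2) + ((2 * π)⁻¹ ^ 2 * (Y ^ 2 + Z ^ 2) + (2 * π)⁻¹ ^ 2 * (Y ^ 2 + Z ^ 2)))
    = (2 * π)⁻¹ * X ^ 2 + π⁻¹ * Y ^ 2 + π⁻¹ * Z ^ 2 := by intro X Y Z; field_simp; ring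
  rw [e, mul_inv_cancel_left₀ (by positivity)] at this
  linarith

open Real in
lemma wirtinger {g g' : ℝ → ℝ} (hd : ∀ x, HasDerivAt g (g' x) x) (hc : Continuous g') (hper : g π = g (-π)) :
    π⁻¹ * (∫ x in (-π)..π, g x * cos x) ^ 2 + π⁻¹ * (∫ x in (-π)..π, g x * sin x) ^ 2 + 4 * bes g
      ≤ ∫ x in (-π)..π, g' x ^ 2 := by
  have hg : Continuous g := continuous_iff_continuousAt.2 fun x => (hd x).continuousAt
  have h1 := fc_hasSum hg
  have h2 := fc_hasSum hc
  have h3 := (h2.sub (h1.mul_left 4)).add (hasSum_sum_of_ne_finset_zero (s := ({0, 1, -1} : Finset ℤ)) 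
     (f := fun n : ℤ => if n ∈ ({0, 1, -1} : Finset ℤ) then (4 - (n:ℝ) ^ 2) * ‖fc g n‖ ^ 2 else 0) (fun b hb => if_neg hb))
  have h4 := h3.nonneg (fun n => by
    by_cases hn : n ∈ ({0, 1, -1} : Finset ℤ)
    · rw [if_pos hn]
      by_cases h0 : n = 0
      · subst h0; push_cast; nlinarith [sq_nonneg ‖fc g' 0‖]
      · rw [fc_deriv hd hc hper n h0]; nlinarith
    · rw [if_neg hn]
      have h0 : n ≠ 0 := fun h => hn (by simp [h])
      rw [fc_deriv hd hc hper n h0]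
      have : (4:ℝ) ≤ (n:ℝ) ^ 2 := by
        have : (4:ℤ) ≤ n ^ 2 := by
          simp only [Finset.mem_insert, Finset.mem_singleton, not_or] at hn
          have : n ≤ -2 ∨ 2 ≤ n := by omega
          rcases this with h | h <;> nlinarith
        exact_mod_cast this
      nlinarith [sq_nonneg ‖fc g n‖])
  rw [Finset.sum_congr rfl (fun n hn => if_pos hn)] at h4
  rw [Finset.sum_insert (by simp), Finset.sum_insert (by simp), Finset.sum_singleton, fc_eq hg, fc_eq hg, fc_eq hg] at h4
  simp only [Int.cast_zero, zero_mul, cos_zero, sin_zero, mul_one, mul_zero, intervalIntegral.integral_zero, Int.cast_one, one_mul,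
    Int.cast_neg, neg_mul, cos_neg, sin_neg, mul_neg, intervalIntegral.integral_neg, neg_sq] at h4
  have := mul_le_mul_of_nonneg_left h4 (by positivity : 0 ≤ 2 * π)
  unfold bes
  have hπ := pi_pos
  have e : ∀ X Y Z A B : ℝ, 2 * π * ((2 * π)⁻¹ * A - 4 * ((2 * π)⁻¹ * B) + ((4 - 0 ^ 2) * ((2 * π)⁻¹ ^ 2 * (X ^ 2 + 0 ^ 2)) + ((4 - 1 ^ 2) * ((2 * π)⁻¹ ^ 2 * (Y ^ 2 + Z ^ 2)) + (4 - 1 ^ 2) * ((2 * π)⁻¹ ^ 2 * (Y ^ 2 + Z ^ 2)))))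
    = A - 4 * B + 4 * ((2 * π)⁻¹ * X ^ 2) + 3 * (π⁻¹ * Y ^ 2) + 3 * (π⁻¹ * Z ^ 2) := by intro X Y Z A B; field_simp; ring
  rw [e] at this
  linarith



structure Fam (F : ℝ → ℝ → ℝ) : Prop where
  c : Continuous (Function.uncurry F)
  d : ∀ n : ℕ, ∃ C : ℝ, ∀ r > 0, ∀ t, (1 + r) ^ n * |F r t| ≤ C

namespace Fam
variable {F G : ℝ → ℝ → ℝ}

lemma sl (h : Fam F) (r : ℝ) : Continuous (F r) := h.c.comp (by fun_prop : Continuous fun t : ℝ => (r, t))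

lemma bdd (h : Fam F) : ∃ C, 0 ≤ C ∧ ∀ r > 0, ∀ t, |F r t| ≤ C := by
  obtain ⟨C, hC⟩ := h.d 0
  refine ⟨|C|, abs_nonneg _, fun r hr t => ?_⟩
  have := hC r hr t
  simp only [pow_zero, one_mul] at this
  exact this.trans (le_abs_self _)

lemma mul (hF : Fam F) (hG : Fam G) : Fam (fun r t => F r t * G r t) where
  c := hF.c.mul hG.c
  d n := by
    obtain ⟨C, hC⟩ := hF.d n
    obtain ⟨D, hD0, hD⟩ := hG.bdd
    refine ⟨|C| * D, fun r hr t => ?_⟩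
    rw [abs_mul, ← mul_assoc]
    have := (hC r hr t).trans (le_abs_self _)
    have := hD r hr t
    gcongr

lemma mulψ (hF : Fam F) {ψ : ℝ → ℝ} (hψ : Continuous ψ) (hb : ∀ t, |ψ t| ≤ 1) : Fam (fun r t => F r t * ψ t) where
  c := hF.c.mul (hψ.comp continuous_snd)
  d n := by
    obtain ⟨C, hC⟩ := hF.d n
    refine ⟨C, fun r hr t => ?_⟩
    refine le_trans ?_ (hC r hr t)
    have hr0 : 0 < r := hr
    rw [abs_mul]
    gcongr
    exact mul_le_of_le_one_right (abs_nonneg _) (hb t)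

lemma const_mul (hF : Fam F) (a : ℝ) : Fam (fun r t => a * F r t) where
  c := continuous_const.mul hF.c
  d n := by
    obtain ⟨C, hC⟩ := hF.d n
    refine ⟨|a| * C, fun r hr t => ?_⟩
    rw [abs_mul, mul_left_comm]
    gcongr
    exact hC r hr t

lemma add (hF : Fam F) (hG : Fam G) : Fam (fun r t => F r t + G r t) where
  c := hF.c.add hG.c
  d n := by
    obtain ⟨C, hC⟩ := hF.d n
    obtain ⟨D, hD⟩ := hG.d n
    refine ⟨C + D, fun r hr t => ?_⟩
    have hr0 : 0 < r := hr
    calc (1 + r) ^ n * |F r t + G r t| ≤ (1 + r) ^ n * (|F r t| + |G r t|) := by gcongr; exact abs_add_le _ _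
      _ ≤ C + D := by rw [mul_add]; exact add_le_add (hC r hr t) (hD r hr t)

lemma sq (hF : Fam F) : Fam (fun r t => F r t ^ 2) := by
  simpa only [pow_two] using hF.mul hF

open Real in
lemma dec (hF : Fam F) : Dec (fun r => ∫ t in (-π)..π, F r t) := by
  intro n
  obtain ⟨C, hC⟩ := hF.d n
  refine ⟨C * (2 * π), fun r hr => ?_⟩
  have hr0 : 0 < r := hr
  have h := intervalIntegral.norm_integral_le_of_norm_le_const (a := -π) (b := π) (f := F r) (C := C / (1 + r) ^ n) (fun t _ => by
    rw [le_div_iff₀ (by positivity), mul_comm]; exact hC r hr t)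
  rw [Real.norm_eq_abs, show |π - -π| = 2 * π by rw [sub_neg_eq_add, abs_of_pos (by positivity)]; ring] at h
  calc _ ≤ (1 + r) ^ n * (C / (1 + r) ^ n * (2 * π)) := by gcongr
    _ = _ := by field_simp

open Real in
lemma cont (hF : Fam F) : Continuous (fun r => ∫ t in (-π)..π, F r t) :=
  intervalIntegral.continuous_parametric_intervalIntegral_of_continuous' hF.c _ _

open Real in
lemma deriv (hF : Fam F) (hG : Fam G) (h : ∀ r t, HasDerivAt (fun r => F r t) (G r t) r) (r : ℝ) (hr : 0 < r) :
    HasDerivAt (fun r => ∫ t in (-π)..π, F r t) (∫ t in (-π)..π, G r t) r := by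
  obtain ⟨C, _, hC⟩ := hG.bdd
  exact (intervalIntegral.hasDerivAt_integral_of_dominated_loc_of_deriv_le (bound := fun _ => C) (Ioi_mem_nhds hr)
    (Eventually.of_forall fun x => (hF.sl x).aestronglyMeasurable) ((hF.sl r).intervalIntegrable _ _)
    (hG.sl r).aestronglyMeasurable (Eventually.of_forall fun t _ x hx => hC x hx t) (by simp)
    (Eventually.of_forall fun t _ x hx => h x t)).2

end Fam

lemma int_lin4 {f1 f2 f3 f4 : ℝ → ℝ} {s : Set ℝ} (i1 : IntegrableOn f1 s) (i2 : IntegrableOn f2 s)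
    (i3 : IntegrableOn f3 s) (i4 : IntegrableOn f4 s) (a b c : ℝ) :
    IntegrableOn (fun r => a * f1 r + b * f2 r + c * f3 r + f4 r) s ∧
    a * (∫ r in s, f1 r) + b * (∫ r in s, f2 r) + c * (∫ r in s, f3 r) + (∫ r in s, f4 r)
      = ∫ r in s, (a * f1 r + b * f2 r + c * f3 r + f4 r) := by
  have j1 : IntegrableOn (fun r => a * f1 r) s := i1.const_mul a
  have j2 : IntegrableOn (fun r => b * f2 r) s := i2.const_mul b
  have j3 : IntegrableOn (fun r => c * f3 r) s := i3.const_mul c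
  have j12 : IntegrableOn (fun r => a * f1 r + b * f2 r) s := j1.add j2
  have j123 : IntegrableOn (fun r => a * f1 r + b * f2 r + c * f3 r) s := j12.add j3
  refine ⟨j123.add i4, ?_⟩
  rw [integral_add j123 i4, integral_add j12 j3, integral_add j1 j2, integral_const_mul, integral_const_mul,
    integral_const_mul]

structure Pol (e D T : ℝ → ℝ → ℝ) : Prop where
  fe : Fam e
  fD : Fam D
  fT : Fam T
  hr : ∀ r t, HasDerivAt (fun r => e r t) (D r t) r
  ht : ∀ r t, HasDerivAt (e r) (r * T r t) t
  per : ∀ r, e r Real.pi = e r (-Real.pi)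

namespace Pol
open Real
variable {e D T : ℝ → ℝ → ℝ} (h : Pol e D T)
include h

/-- mode -/
noncomputable def _root_.md (ψ : ℝ → ℝ) (e : ℝ → ℝ → ℝ) (r : ℝ) : ℝ := ∫ t in (-π)..π, e r t * ψ t
noncomputable def _root_.mm (e D : ℝ → ℝ → ℝ) (r : ℝ) : ℝ := ∫ t in (-π)..π, e r t * D r t
noncomputable def _root_.m2 (e : ℝ → ℝ → ℝ) (r : ℝ) : ℝ := ∫ t in (-π)..π, e r t ^ 2

lemma tlip : ∃ C, 0 ≤ C ∧ ∀ r > 0, ∫ t in (-π)..π, (r * T r t) ^ 2 ≤ C * r ^ 2 := by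
  obtain ⟨C, hC0, hC⟩ := h.fT.sq.dec.bdd
  refine ⟨C, hC0, fun r hr => ?_⟩
  simp_rw [mul_pow]
  rw [intervalIntegral.integral_const_mul, mul_comm]
  gcongr
  exact (le_abs_self _).trans (hC r hr)

lemma wirt (r : ℝ) : π⁻¹ * (∫ x in (-π)..π, e r x * cos x) ^ 2 + π⁻¹ * (∫ x in (-π)..π, e r x * sin x) ^ 2 + 4 * bes (e r)
    ≤ ∫ x in (-π)..π, (r * T r x) ^ 2 :=
  wirtinger (h.ht r) (continuous_const.mul (h.fT.sl r)) (h.per r)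

lemma nice0 {ψ : ℝ → ℝ} (hψ : Continuous ψ) (hb : ∀ t, |ψ t| ≤ 1) : Nice 0 (md ψ e) (md ψ D) where
  hd r hr := (h.fe.mulψ hψ hb).deriv (h.fD.mulψ hψ hb) (fun r t => (h.hr r t).mul_const _) r hr
  uc' := (h.fD.mulψ hψ hb).cont.continuousOn
  du := (h.fe.mulψ hψ hb).dec
  du' := (h.fD.mulψ hψ hb).dec
  lip := ⟨0, fun r _ => by simp⟩

lemma nice1c : Nice 1 (md cos e) (md cos D) := by
  refine { h.nice0 continuous_cos abs_cos_le_one with lip := ?_ }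
  obtain ⟨C, hC0, hC⟩ := h.tlip
  refine ⟨√(π * C), fun r hr => ?_⟩
  have h1 := h.wirt r
  have h2 := bessel (h.fe.sl r)
  have h3 := hC r hr
  have hr0 : 0 < r := hr
  have h4 : 0 ≤ π⁻¹ * (∫ x in (-π)..π, e r x * sin x) ^ 2 := by positivity
  have h5 : π⁻¹ * (∫ x in (-π)..π, e r x * cos x) ^ 2 ≤ C * r ^ 2 := by linarith
  rw [one_mul]
  refine abs_le_of_sq_le_sq ?_ (by positivity)
  rw [mul_pow, sq_sqrt (by positivity)]
  rw [inv_mul_le_iff₀ pi_pos] at h5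
  unfold md
  linarith

lemma nice1s : Nice 1 (md sin e) (md sin D) := by
  refine { h.nice0 continuous_sin abs_sin_le_one with lip := ?_ }
  obtain ⟨C, hC0, hC⟩ := h.tlip
  refine ⟨√(π * C), fun r hr => ?_⟩
  have h1 := h.wirt r
  have h2 := bessel (h.fe.sl r)
  have h3 := hC r hr
  have hr0 : 0 < r := hr
  have h4 : 0 ≤ π⁻¹ * (∫ x in (-π)..π, e r x * cos x) ^ 2 := by positivity
  have h5 : π⁻¹ * (∫ x in (-π)..π, e r x * sin x) ^ 2 ≤ C * r ^ 2 := by linarith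
  rw [one_mul]
  refine abs_le_of_sq_le_sq ?_ (by positivity)
  rw [mul_pow, sq_sqrt (by positivity)]
  rw [inv_mul_le_iff₀ pi_pos] at h5
  unfold md
  linarith

lemma lin {ψ : ℝ → ℝ} (hψ : Continuous ψ) (r x : ℝ) :
    ∫ t in (-π)..π, (D r t - x * e r t) * ψ t = md ψ D r - x * md ψ e r := by
  unfold md
  have h1 := h.fe.sl r; have h2 := h.fD.sl r
  rw [← intervalIntegral.integral_const_mul, ← intervalIntegral.integral_sub]
  · congr 1; ext t; ring
  · exact Continuous.intervalIntegrable (by fun_prop) _ _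
  · exact Continuous.intervalIntegrable (by fun_prop) _ _

lemma lin1 (r x : ℝ) :
    ∫ t in (-π)..π, (D r t - x * e r t) = md (fun _ => 1) D r - x * md (fun _ => 1) e r := by
  simpa using h.lin (ψ := fun _ => 1) continuous_const r x

lemma quadr (r x : ℝ) :
    ∫ t in (-π)..π, (D r t - x * e r t) ^ 2 = m2 D r - 2 * x * mm e D r + x ^ 2 * m2 e r := by
  unfold mm m2
  have h1 := h.fe.sl r; have h2 := h.fD.sl r
  rw [← intervalIntegral.integral_const_mul, ← intervalIntegral.integral_const_mul, ← intervalIntegral.integral_sub, ← intervalIntegral.integral_add]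
  · congr 1; ext t; ring
  all_goals exact Continuous.intervalIntegrable (by fun_prop) _ _

lemma hm2 (r : ℝ) (hr : 0 < r) : HasDerivAt (m2 e) (2 * mm e D r) r := by
  have := h.fe.sq.deriv ((h.fe.mul h.fD).const_mul 2) (fun r t => ((h.hr r t).pow 2).congr_deriv (by simp; ring)) r hr
  rw [intervalIntegral.integral_const_mul] at this
  exact this

lemma bes_eq (r : ℝ) : bes (e r) = m2 e r - (2 * π)⁻¹ * md (fun _ => 1) e r ^ 2 - π⁻¹ * md cos e r ^ 2 - π⁻¹ * md sin e r ^ 2 := by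
  simp [bes, m2, md]

end Pol

open Real in
noncomputable def mR (e : ℝ → ℝ → ℝ) (r : ℝ) : ℝ :=
  m2 e r - (2 * π)⁻¹ * md (fun _ => 1) e r ^ 2 - π⁻¹ * md cos e r ^ 2 - π⁻¹ * md sin e r ^ 2
open Real in
noncomputable def mR' (e D : ℝ → ℝ → ℝ) (r : ℝ) : ℝ :=
  2 * mm e D r - (2 * π)⁻¹ * (2 * md (fun _ => 1) e r * md (fun _ => 1) D r) - π⁻¹ * (2 * md cos e r * md cos D r)
    - π⁻¹ * (2 * md sin e r * md sin D r)
open Real in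
noncomputable def mN (e : ℝ → ℝ → ℝ) (r : ℝ) : ℝ :=
  m2 e r - (2 * π)⁻¹ * md (fun _ => 1) e r ^ 2
open Real in
noncomputable def mN' (e D : ℝ → ℝ → ℝ) (r : ℝ) : ℝ :=
  2 * mm e D r - (2 * π)⁻¹ * (2 * md (fun _ => 1) e r * md (fun _ => 1) D r)

namespace Pol
open Real
variable {e D T : ℝ → ℝ → ℝ} (h : Pol e D T)
include h

lemma n1 : Nice 0 (md (fun _ => 1) e) (md (fun _ => 1) D) := h.nice0 continuous_const (by simp)

lemma mR_nonneg (r : ℝ) : 0 ≤ mR e r := by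
  have := bessel (h.fe.sl r); rw [h.bes_eq] at this; exact this

lemma datR : Dat 4 (mR e) (mR' e D) (mR D) where
  hd r hr := by
    refine ((((h.hm2 r hr).sub (((h.n1.hd r hr).pow 2).const_mul _)).sub (((h.nice1c.hd r hr).pow 2).const_mul _)).sub
      (((h.nice1s.hd r hr).pow 2).const_mul _)).congr_deriv ?_
    simp [mR']
  quad r hr x := by
    have h1 := bessel (g := fun t => D r t - x * e r t) ((h.fD.sl r).sub (continuous_const.mul (h.fe.sl r)))
    unfold bes at h1
    rw [h.quadr, h.lin1, h.lin continuous_cos, h.lin continuous_sin] at h1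
    unfold mR mR'
    linarith
  nc := ((((h.fD.sq.cont).continuousOn.sub (continuousOn_const.mul (h.n1.uc'.pow 2))).sub
    (continuousOn_const.mul (h.nice1c.uc'.pow 2))).sub (continuousOn_const.mul (h.nice1s.uc'.pow 2)))
  m0 r hr := h.mR_nonneg r
  dm := ((h.fe.sq.dec.sub (h.n1.du.sq.const_mul _)).sub (h.nice1c.du.sq.const_mul _)).sub (h.nice1s.du.sq.const_mul _)
  dn := ((h.fD.sq.dec.sub (h.n1.du'.sq.const_mul _)).sub (h.nice1c.du'.sq.const_mul _)).sub (h.nice1s.du'.sq.const_mul _)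
  lip := by
    obtain ⟨C, hC0, hC⟩ := h.tlip
    refine ⟨C, fun r hr => ?_⟩
    have h1 := h.wirt r
    rw [h.bes_eq] at h1
    have h3 := hC r hr
    have h4 : 0 ≤ π⁻¹ * (∫ x in (-π)..π, e r x * sin x) ^ 2 := by positivity
    have h5 : 0 ≤ π⁻¹ * (∫ x in (-π)..π, e r x * cos x) ^ 2 := by positivity
    unfold mR
    linarith

lemma mN_eq (r : ℝ) : mN e r = mR e r + π⁻¹ * md cos e r ^ 2 + π⁻¹ * md sin e r ^ 2 := by
  unfold mN mR; ring

lemma datN : Dat 1 (mN e) (mN' e D) (mN D) where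
  hd r hr := by
    refine ((h.hm2 r hr).sub (((h.n1.hd r hr).pow 2).const_mul _)).congr_deriv ?_
    simp [mN']
  quad r hr x := by
    have h1 := bessel (g := fun t => D r t - x * e r t) ((h.fD.sl r).sub (continuous_const.mul (h.fe.sl r)))
    unfold bes at h1
    rw [h.quadr, h.lin1] at h1
    have h4 : 0 ≤ π⁻¹ * (∫ t in (-π)..π, (D r t - x * e r t) * sin t) ^ 2 := by positivity
    have h5 : 0 ≤ π⁻¹ * (∫ t in (-π)..π, (D r t - x * e r t) * cos t) ^ 2 := by positivity
    unfold mN mN'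
    linarith
  nc := (h.fD.sq.cont).continuousOn.sub (continuousOn_const.mul (h.n1.uc'.pow 2))
  m0 r hr := by
    rw [h.mN_eq]; have := h.mR_nonneg r; positivity
  dm := h.fe.sq.dec.sub (h.n1.du.sq.const_mul _)
  dn := h.fD.sq.dec.sub (h.n1.du'.sq.const_mul _)
  lip := by
    obtain ⟨C, hC0, hC⟩ := h.tlip
    refine ⟨C, fun r hr => ?_⟩
    have h1 := h.wirt r
    rw [h.bes_eq] at h1
    have h3 := hC r hr
    have h4 := h.mR_nonneg r
    rw [h.mN_eq]
    unfold mR at *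
    unfold md at *
    linarith

lemma t_ge (r : ℝ) (hr : 0 < r) : (π⁻¹ * md cos e r ^ 2 + π⁻¹ * md sin e r ^ 2 + 4 * mR e r) / r ^ 2 ≤ m2 T r := by
  have h1 := h.wirt r
  rw [h.bes_eq] at h1
  simp_rw [mul_pow] at h1
  rw [intervalIntegral.integral_const_mul] at h1
  rw [div_le_iff₀ (by positivity)]
  unfold mR m2 md at *
  linarith

lemma int_form {q p : ℝ → ℝ} (H : GS q p) (j : ℝ) :
   IntegrableOn (fun r => r * (m2 D r + m2 T r + (1 - j * q r ^ 2) * m2 e r)) (Ioi 0) := by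
  have hqc := H.qc
  have h1 := h.fe.sq.cont
  have h2 := h.fD.sq.cont
  have h3 := h.fT.sq.cont
  refine Dec.integrable ?_ (by unfold m2; fun_prop)
  have := ((h.fD.sq.dec.add h.fT.sq.dec).add (h.fe.sq.dec.sub ((H.dq.sq.mul h.fe.sq.dec).const_mul j))).id_mul
  convert this using 3
  unfold m2; ring

lemma mass : ∫ r in Ioi (0:ℝ), r * m2 e r = (2 * π)⁻¹ * (∫ r in Ioi (0:ℝ), r * md (fun _ => 1) e r ^ 2) + ∫ r in Ioi (0:ℝ), r * mN e r := by
  have i1 : IntegrableOn (fun r => r * md (fun _ => 1) e r ^ 2) (Ioi 0) :=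
    h.n1.du.sq.id_mul.integrable (continuousOn_id.mul (h.n1.uc.pow 2))
  have i2 : IntegrableOn (fun r => r * mN e r) (Ioi 0) :=
    h.datN.dm.id_mul.integrable (continuousOn_id.mul h.datN.mc)
  rw [← integral_const_mul, ← integral_add (i1.const_mul _) i2]
  congr 1; ext r; unfold mN; ring

lemma massN : ∫ r in Ioi (0:ℝ), r * mN e r = π⁻¹ * (∫ r in Ioi (0:ℝ), r * md cos e r ^ 2)
   + π⁻¹ * (∫ r in Ioi (0:ℝ), r * md sin e r ^ 2) + ∫ r in Ioi (0:ℝ), r * mR e r := by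
  have i1 : IntegrableOn (fun r => r * md cos e r ^ 2) (Ioi 0) :=
    h.nice1c.du.sq.id_mul.integrable (continuousOn_id.mul (h.nice1c.uc.pow 2))
  have i3 : IntegrableOn (fun r => r * md sin e r ^ 2) (Ioi 0) :=
    h.nice1s.du.sq.id_mul.integrable (continuousOn_id.mul (h.nice1s.uc.pow 2))
  have i2 : IntegrableOn (fun r => r * mR e r) (Ioi 0) :=
    h.datR.dm.id_mul.integrable (continuousOn_id.mul h.datR.mc)
  have := (int_lin4 i1 i3 i2 i2 π⁻¹ π⁻¹ 0).2
  rw [zero_mul, add_zero] at this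
  rw [this]
  congr 1; ext r; rw [h.mN_eq]; ring

lemma form_plus {q p : ℝ → ℝ} (H : GS q p) :
    (2 * π)⁻¹ * Bf 0 3 q (fun r => md (fun _ => 1) e r ^ 2) (fun r => md (fun _ => 1) D r ^ 2)
    + π⁻¹ * Bf 1 3 q (fun r => md cos e r ^ 2) (fun r => md cos D r ^ 2)
    + π⁻¹ * Bf 1 3 q (fun r => md sin e r ^ 2) (fun r => md sin D r ^ 2)
    + Bf 4 3 q (mR e) (mR D) ≤ ∫ r in Ioi (0:ℝ), r * (m2 D r + m2 T r + (1 - 3 * q r ^ 2) * m2 e r) := by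
  have i1 := (h.n1.dat (Or.inl rfl)).integrable H le_rfl 3
  have i2 := (h.nice1c.dat (Or.inr rfl)).integrable H zero_le_one 3
  have i3 := (h.nice1s.dat (Or.inr rfl)).integrable H zero_le_one 3
  have i4 := h.datR.integrable H (by norm_num) 3
  unfold Bf
  have := int_lin4 i1 i2 i3 i4 (2 * π)⁻¹ π⁻¹ π⁻¹
  beta_reduce at this ⊢
  rw [this.2]
  refine setIntegral_mono_on this.1 (h.int_form H 3) measurableSet_Ioi ?_
  intro r hr
  have hr0 : 0 < r := hr
  have h1 := mul_le_mul_of_nonneg_left (h.t_ge r hr) hr0.le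
  refine le_of_sub_nonneg ?_
  refine (sub_nonneg.2 h1).trans (le_of_eq ?_)
  unfold pot mR
  field_simp
  ring

lemma form_minus {q p : ℝ → ℝ} (H : GS q p) :
    (2 * π)⁻¹ * Bf 0 1 q (fun r => md (fun _ => 1) e r ^ 2) (fun r => md (fun _ => 1) D r ^ 2)
    + Bf 1 1 q (mN e) (mN D) ≤ ∫ r in Ioi (0:ℝ), r * (m2 D r + m2 T r + (1 - 1 * q r ^ 2) * m2 e r) := by
  have i1 := (h.n1.dat (Or.inl rfl)).integrable H le_rfl 1
  have i4 := h.datN.integrable H (by norm_num) 1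
  unfold Bf
  rw [← integral_const_mul, ← integral_add (i1.const_mul _) i4]
  refine setIntegral_mono_on ((i1.const_mul _).add i4) (h.int_form H 1) measurableSet_Ioi ?_
  intro r hr
  have hr0 : 0 < r := hr
  have h0 : (π⁻¹ * md cos e r ^ 2 + π⁻¹ * md sin e r ^ 2 + mR e r) / r ^ 2 ≤ m2 T r := by
    refine le_trans ?_ (h.t_ge r hr)
    have := h.mR_nonneg r
    gcongr
    linarith
  have h1 := mul_le_mul_of_nonneg_left h0 hr0.le
  refine le_of_sub_nonneg ?_
  refine (sub_nonneg.2 h1).trans (le_of_eq ?_)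
  unfold pot mN mR
  field_simp
  ring

end Pol

open Real in
lemma GS.plus {q p : ℝ → ℝ} (H : GS q p) : ∃ c > 0, ∃ C > 0, ∀ e D T, Pol e D T →
    c * (∫ r in Ioi (0:ℝ), r * m2 e r) - C * ((∫ r in Ioi (0:ℝ), r * (md (fun _ => 1) e r * q r)) ^ 2
      + (∫ r in Ioi (0:ℝ), r * (md (fun _ => 1) e r * (r ^ 2 * q r))) ^ 2
      + (∫ r in Ioi (0:ℝ), r * (md cos e r * (r * q r))) ^ 2 + (∫ r in Ioi (0:ℝ), r * (md sin e r * (r * q r))) ^ 2)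
    ≤ ∫ r in Ioi (0:ℝ), r * (m2 D r + m2 T r + (1 - 3 * q r ^ 2) * m2 e r) := by
  obtain ⟨c1, hc1, C1, hC1, h1⟩ := H.secA
  obtain ⟨c2, hc2, C2, hC2, h2⟩ := H.secB
  obtain ⟨c3, hc3, h3⟩ := H.coer_R
  refine ⟨min c1 (min c2 c3), by positivity, (2 * π)⁻¹ * C1 + π⁻¹ * C2, by positivity, fun e D T h => ?_⟩
  refine le_trans ?_ (h.form_plus H)
  rw [h.mass, h.massN]
  have k1 := mul_le_mul_of_nonneg_left (h1 _ _ h.n1) (by positivity : 0 ≤ (2 * π)⁻¹)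
  have k2 := mul_le_mul_of_nonneg_left (h2 _ _ h.nice1c) (by positivity : 0 ≤ π⁻¹)
  have k3 := mul_le_mul_of_nonneg_left (h2 _ _ h.nice1s) (by positivity : 0 ≤ π⁻¹)
  have k4 := h3 _ _ _ h.datR
  set c := min c1 (min c2 c3) with hc
  have l1 : c ≤ c1 := min_le_left _ _
  have l2 : c ≤ c2 := (min_le_right _ _).trans (min_le_left _ _)
  have l3 : c ≤ c3 := (min_le_right _ _).trans (min_le_right _ _)
  have p1 : 0 ≤ (2 * π)⁻¹ * (∫ r in Ioi (0:ℝ), r * md (fun _ => 1) e r ^ 2) :=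
    mul_nonneg (by positivity) (setIntegral_nonneg measurableSet_Ioi fun r hr => mul_nonneg (le_of_lt hr) (sq_nonneg _))
  have p2 : 0 ≤ π⁻¹ * (∫ r in Ioi (0:ℝ), r * md cos e r ^ 2) :=
    mul_nonneg (by positivity) (setIntegral_nonneg measurableSet_Ioi fun r hr => mul_nonneg (le_of_lt hr) (sq_nonneg _))
  have p3 : 0 ≤ π⁻¹ * (∫ r in Ioi (0:ℝ), r * md sin e r ^ 2) :=
    mul_nonneg (by positivity) (setIntegral_nonneg measurableSet_Ioi fun r hr => mul_nonneg (le_of_lt hr) (sq_nonneg _))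
  have p4 : 0 ≤ (∫ r in Ioi (0:ℝ), r * mR e r) :=
    (setIntegral_nonneg measurableSet_Ioi fun r hr => mul_nonneg (le_of_lt hr) (h.mR_nonneg r))
  have q1 := mul_le_mul_of_nonneg_right l1 p1
  have q2 := mul_le_mul_of_nonneg_right l2 p2
  have q3 := mul_le_mul_of_nonneg_right l2 p3
  have q4 := mul_le_mul_of_nonneg_right l3 p4
  set X1 := (∫ r in Ioi (0:ℝ), r * (md (fun _ => 1) e r * q r))
  set X2 := (∫ r in Ioi (0:ℝ), r * (md (fun _ => 1) e r * (r ^ 2 * q r)))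
  set X3 := (∫ r in Ioi (0:ℝ), r * (md cos e r * (r * q r)))
  set X4 := (∫ r in Ioi (0:ℝ), r * (md sin e r * (r * q r)))
  have s1 : 0 ≤ (2 * π)⁻¹ * C1 * (X3 ^ 2 + X4 ^ 2) := by positivity
  have s2 : 0 ≤ π⁻¹ * C2 * (X1 ^ 2 + X2 ^ 2) := by positivity
  linarith

open Real in
lemma GS.minus {q p : ℝ → ℝ} (H : GS q p) : ∃ c > 0, ∃ C > 0, ∀ e D T, Pol e D T →
    c * (∫ r in Ioi (0:ℝ), r * m2 e r) - C * (∫ r in Ioi (0:ℝ), r * (md (fun _ => 1) e r * q r)) ^ 2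
    ≤ ∫ r in Ioi (0:ℝ), r * (m2 D r + m2 T r + (1 - 1 * q r ^ 2) * m2 e r) := by
  obtain ⟨c1, hc1, C1, hC1, h1⟩ := H.secD
  obtain ⟨c3, hc3, h3⟩ := H.coer_N
  refine ⟨min c1 c3, by positivity, (2 * π)⁻¹ * C1, by positivity, fun e D T h => ?_⟩
  refine le_trans ?_ (h.form_minus H)
  rw [h.mass]
  have k1 := mul_le_mul_of_nonneg_left (h1 _ _ h.n1) (by positivity : 0 ≤ (2 * π)⁻¹)
  have k4 := h3 _ _ _ h.datN
  set c := min c1 c3 with hc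
  have l1 : c ≤ c1 := min_le_left _ _
  have l3 : c ≤ c3 := min_le_right _ _
  have p1 : 0 ≤ (2 * π)⁻¹ * (∫ r in Ioi (0:ℝ), r * md (fun _ => 1) e r ^ 2) :=
    mul_nonneg (by positivity) (setIntegral_nonneg measurableSet_Ioi fun r hr => mul_nonneg (le_of_lt hr) (sq_nonneg _))
  have p4 : 0 ≤ (∫ r in Ioi (0:ℝ), r * mN e r) :=
    (setIntegral_nonneg measurableSet_Ioi fun r hr => mul_nonneg (le_of_lt hr) (h.datN.m0 r hr))
  have q1 := mul_le_mul_of_nonneg_right l1 p1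
  have q4 := mul_le_mul_of_nonneg_right l3 p4
  linarith

open Real in
def vec (r t : ℝ) : E2 := !₂[r * cos t, r * sin t]

lemma vec_zero (r t : ℝ) : vec r t 0 = r * Real.cos t := by simp [vec]
lemma vec_one (r t : ℝ) : vec r t 1 = r * Real.sin t := by simp [vec]

lemma norm_vec (r t : ℝ) : ‖vec r t‖ = |r| := by
  rw [EuclideanSpace.norm_eq, Fin.sum_univ_two, vec_zero, vec_one, ← Real.sqrt_sq_eq_abs]
  congr 1
  simp only [Real.norm_eq_abs, sq_abs]
  nlinarith [Real.sin_sq_add_cos_sq t]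

lemma vec_eq (r t : ℝ) : vec r t = (r * Real.cos t) • EuclideanSpace.single 0 1 + (r * Real.sin t) • EuclideanSpace.single 1 1 := by
  ext i
  fin_cases i <;> simp [vec]

lemma vec_cont : Continuous (fun z : ℝ × ℝ => vec z.1 z.2) := by
  simp only [vec_eq]; fun_prop

structure SC (f : E2 → ℝ) : Prop where
  c : Continuous f
  d : ∀ n : ℕ, ∃ C : ℝ, ∀ y, (1 + ‖y‖) ^ n * |f y| ≤ C

namespace SC
variable {f g : E2 → ℝ}

lemma mono (hf : SC f) (hg : Continuous g) (K : ℝ) (k : ℕ)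
    (h : ∀ y, |g y| ≤ K * (1 + ‖y‖) ^ k * |f y|) : SC g := by
  refine ⟨hg, fun n => ?_⟩
  obtain ⟨C, hC⟩ := hf.d (n + k)
  refine ⟨|K| * C, fun y => ?_⟩
  calc (1 + ‖y‖) ^ n * |g y| ≤ (1 + ‖y‖) ^ n * (K * (1 + ‖y‖) ^ k * |f y|) := by gcongr; exact h y
    _ = K * ((1 + ‖y‖) ^ (n + k) * |f y|) := by ring
    _ ≤ |K| * ((1 + ‖y‖) ^ (n + k) * |f y|) := by gcongr; exact le_abs_self K
    _ ≤ |K| * C := by gcongr; exact hC y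

lemma bdd (hf : SC f) : ∃ C, 0 ≤ C ∧ ∀ y, |f y| ≤ C := by
  obtain ⟨C, hC⟩ := hf.d 0
  refine ⟨|C|, abs_nonneg _, fun y => ?_⟩
  have := hC y
  simp only [pow_zero, one_mul] at this
  exact this.trans (le_abs_self _)

lemma add (hf : SC f) (hg : SC g) : SC (fun y => f y + g y) := by
  refine ⟨hf.c.add hg.c, fun n => ?_⟩
  obtain ⟨C, hC⟩ := hf.d n
  obtain ⟨D, hD⟩ := hg.d n
  refine ⟨C + D, fun y => ?_⟩
  calc (1 + ‖y‖) ^ n * |f y + g y| ≤ (1 + ‖y‖) ^ n * (|f y| + |g y|) := by gcongr; exact abs_add_le _ _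
    _ ≤ C + D := by linarith [hC y, hD y]

lemma const_mul (hf : SC f) (K : ℝ) : SC (fun y => K * f y) :=
  hf.mono (hf.c.const_mul K) |K| 0 (fun y => by rw [abs_mul]; simp)

lemma neg (hf : SC f) : SC (fun y => - f y) :=
  hf.mono hf.c.neg 1 0 (fun y => by simp)

lemma sub (hf : SC f) (hg : SC g) : SC (fun y => f y - g y) := by
  simpa only [sub_eq_add_neg] using hf.add hg.neg

lemma mul (hf : SC f) (hg : SC g) : SC (fun y => f y * g y) := by
  obtain ⟨C, hC0, hC⟩ := hg.bdd
  refine hf.mono (hf.c.mul hg.c) C 0 fun y => ?_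
  rw [abs_mul, pow_zero, mul_one, mul_comm]
  gcongr; exact hC y

lemma sq (hf : SC f) : SC (fun y => f y ^ 2) := by simpa only [_root_.sq] using hf.mul hf

lemma mul_nsq (hf : SC f) : SC (fun y => f y * ‖y‖ ^ 2) := by
  refine hf.mono (hf.c.mul (by fun_prop)) 1 2 fun y => ?_
  rw [abs_mul, one_mul, mul_comm, abs_of_nonneg (by positivity : 0 ≤ ‖y‖ ^ 2)]
  gcongr; linarith

lemma mul_coord (hf : SC f) (j : Fin 2) : SC (fun y => f y * y j) := by
  refine hf.mono (hf.c.mul (by fun_prop)) 1 1 fun y => ?_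
  rw [abs_mul, one_mul, mul_comm, pow_one]
  gcongr
  have := PiLp.norm_apply_le y j
  rw [Real.norm_eq_abs] at this
  linarith

lemma integrable (hf : SC f) : Integrable f := by
  obtain ⟨C, hC⟩ := hf.d 3
  have h := (integrable_one_add_norm (E := E2) (μ := volume) (r := 3) (by simp; norm_num)).const_mul C
  refine h.mono' hf.c.aestronglyMeasurable (ae_of_all _ fun y => ?_)
  have h0 : 0 < 1 + ‖y‖ := by positivity
  rw [Real.rpow_neg h0.le, show (3:ℝ) = ((3:ℕ):ℝ) by norm_num, Real.rpow_natCast, Real.norm_eq_abs, ← div_eq_mul_inv, le_div_iff₀ (by positivity)]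
  linarith [hC y]

lemma fam (hf : SC f) : Fam (fun r t => f (vec r t)) := by
  refine ⟨hf.c.comp vec_cont, fun n => ?_⟩
  obtain ⟨C, hC⟩ := hf.d n
  refine ⟨C, fun r hr t => ?_⟩
  have := hC (vec r t)
  rwa [norm_vec, abs_of_pos hr] at this

open Real in
lemma polar (hf : SC f) : ∫ y, f y = ∫ r in Ioi (0:ℝ), r * ∫ t in (-π)..π, f (vec r t) := by
  have e1 : ∫ y, f y = ∫ z : ℝ × ℝ, f !₂[z.1, z.2] := by
    rw [← (EuclideanSpace.volume_preserving_symm_measurableEquiv_toLp (Fin 2)).symm.integral_comp (MeasurableEquiv.measurableEmbedding _) f]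
    rw [← (volume_preserving_finTwoArrow ℝ).symm.integral_comp (MeasurableEquiv.measurableEmbedding _)]
    rfl
  rw [e1, ← integral_comp_polarCoord_symm]
  have e2 : polarCoord.target = Ioi (0:ℝ) ×ˢ Ioo (-π) π := rfl
  rw [e2, Measure.volume_eq_prod, setIntegral_prod]
  · refine setIntegral_congr_fun measurableSet_Ioi fun r hr => ?_
    simp only [intervalIntegral.integral_of_le (by linarith [pi_pos] : -π ≤ π), integral_Ioc_eq_integral_Ioo, smul_eq_mul,
      integral_const_mul]
    rfl
  · obtain ⟨C, hC⟩ := hf.d 3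
    have h := (integrable_one_add_norm (E := ℝ) (μ := volume) (r := 2) (by simp)).const_mul C
    have h2 : Integrable (fun _ : ℝ => (1:ℝ)) (volume.restrict (Ioo (-π) π)) := by
      simp
    have h3 := (h.restrict (s := Ioi 0)).mul_prod h2
    rw [Measure.prod_restrict] at h3
    refine h3.mono' ?_ ?_
    · refine Continuous.aestronglyMeasurable ?_
      exact continuous_fst.smul (hf.c.comp vec_cont)
    · refine (ae_restrict_mem (measurableSet_Ioi.prod measurableSet_Ioo)).mono fun z hz => ?_
      have hr : 0 < z.1 := hz.1
      have hh := hC (vec z.1 z.2)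
      rw [norm_vec, abs_of_pos hr] at hh
      have : f !₂[(polarCoord.symm z).1, (polarCoord.symm z).2] = f (vec z.1 z.2) := rfl
      rw [this, smul_eq_mul, norm_mul, Real.norm_eq_abs, Real.norm_eq_abs, abs_of_pos hr, mul_one, Real.rpow_neg (by positivity), show (2:ℝ) = ((2:ℕ):ℝ) by norm_num, Real.rpow_natCast, ← div_eq_mul_inv, le_div_iff₀ (by positivity)]
      refine le_trans ?_ hh
      have : 0 ≤ |f (vec z.1 z.2)| := abs_nonneg _
      nlinarith [mul_nonneg this (sq_nonneg (1 + z.1))]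

end SC

open Real

def sd (j : Fin 2) (φ : SchwartzMap E2 ℝ) : SchwartzMap E2 ℝ :=
  LineDeriv.lineDerivOp (EuclideanSpace.single j (1:ℝ)) φ

lemma pd_eq (j : Fin 2) (φ : SchwartzMap E2 ℝ) : pd j (fun z => φ z) = fun z => sd j φ z := rfl

lemma lap_eq (φ : SchwartzMap E2 ℝ) (y : E2) : lap (fun z => φ z) y = sd 0 (sd 0 φ) y + sd 1 (sd 1 φ) y := by
  simp only [lap, Fin.sum_univ_two, pd_eq]

lemma schwartz_SC (φ : SchwartzMap E2 ℝ) : SC (fun y => φ y) := by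
  refine ⟨φ.continuous, fun n => ⟨2 ^ n * (Finset.Iic ((n, 0) : ℕ × ℕ)).sup (fun m => SchwartzMap.seminorm ℝ m.1 m.2) φ, fun y => ?_⟩⟩
  have := SchwartzMap.one_add_le_sup_seminorm_apply (𝕜 := ℝ) (m := (n, 0)) (k := n) (n := 0) le_rfl le_rfl φ y
  rwa [norm_iteratedFDeriv_zero, Real.norm_eq_abs] at this

lemma ibp (φ : SchwartzMap E2 ℝ) (j : Fin 2) : ∫ y, sd j (sd j φ) y * φ y = - ∫ y, sd j φ y ^ 2 := by
  have := SchwartzMap.integral_mul_lineDerivOp_right_eq_neg_left (μ := volume) φ (sd j φ) (EuclideanSpace.single j (1:ℝ))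
  simp only [_root_.sq]
  rw [show (∫ y, sd j φ y * sd j φ y) = ∫ y, (LineDeriv.lineDerivOp (EuclideanSpace.single j (1:ℝ)) φ : SchwartzMap E2 ℝ) y * sd j φ y from rfl,
    ← this]
  exact integral_congr_ae (ae_of_all _ fun y => mul_comm _ _)

lemma fd (φ : SchwartzMap E2 ℝ) (y : E2) (a b : ℝ) :
    fderiv ℝ φ y (a • EuclideanSpace.single 0 1 + b • EuclideanSpace.single 1 1) = a * sd 0 φ y + b * sd 1 φ y := by
  rw [map_add, map_smul, map_smul]; rfl

lemma schwartz_hr (φ : SchwartzMap E2 ℝ) (r t : ℝ) :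
    HasDerivAt (fun r => φ (vec r t)) (cos t * sd 0 φ (vec r t) + sin t * sd 1 φ (vec r t)) r := by
  have hv : HasDerivAt (fun r => vec r t) (cos t • EuclideanSpace.single 0 1 + sin t • EuclideanSpace.single 1 1) r := by
    simp only [vec_eq]
    have h1 := (hasDerivAt_mul_const (x := r) (cos t)).smul_const (EuclideanSpace.single 0 1 : E2)
    have h2 := (hasDerivAt_mul_const (x := r) (sin t)).smul_const (EuclideanSpace.single 1 1 : E2)
    exact h1.add h2
  have := (φ.differentiableAt (x := vec r t)).hasFDerivAt.comp_hasDerivAt r hv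
  rw [fd] at this
  exact this

lemma schwartz_ht (φ : SchwartzMap E2 ℝ) (r t : ℝ) :
    HasDerivAt (fun t => φ (vec r t)) (r * (- sin t * sd 0 φ (vec r t) + cos t * sd 1 φ (vec r t))) t := by
  have hv : HasDerivAt (fun t => vec r t) ((r * (- sin t)) • EuclideanSpace.single 0 1 + (r * cos t) • EuclideanSpace.single 1 1) t := by
    simp only [vec_eq]
    have h1 := ((hasDerivAt_cos t).const_mul r).smul_const (EuclideanSpace.single 0 1 : E2)
    have h2 := ((hasDerivAt_sin t).const_mul r).smul_const (EuclideanSpace.single 1 1 : E2)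
    exact h1.add h2
  have := (φ.differentiableAt (x := vec r t)).hasFDerivAt.comp_hasDerivAt t hv
  rw [fd] at this
  refine this.congr_deriv ?_
  ring

def pe (φ : SchwartzMap E2 ℝ) (r t : ℝ) : ℝ := φ (vec r t)
def pD (φ : SchwartzMap E2 ℝ) (r t : ℝ) : ℝ := cos t * sd 0 φ (vec r t) + sin t * sd 1 φ (vec r t)
def pT (φ : SchwartzMap E2 ℝ) (r t : ℝ) : ℝ := - sin t * sd 0 φ (vec r t) + cos t * sd 1 φ (vec r t)

lemma schwartz_fam (φ : SchwartzMap E2 ℝ) : Fam (fun r t => φ (vec r t)) := (schwartz_SC φ).fam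

lemma schwartz_pol (φ : SchwartzMap E2 ℝ) : Pol (pe φ) (pD φ) (pT φ) where
  fe := schwartz_fam φ
  fD := by
    have := ((schwartz_fam (sd 0 φ)).mulψ continuous_cos abs_cos_le_one).add ((schwartz_fam (sd 1 φ)).mulψ continuous_sin abs_sin_le_one)
    convert this using 3
    simp only [pD]; ring
  fT := by
    have := (((schwartz_fam (sd 0 φ)).mulψ continuous_sin abs_sin_le_one).const_mul (-1)).add ((schwartz_fam (sd 1 φ)).mulψ continuous_cos abs_cos_le_one)
    convert this using 3
    simp only [pT]; ring
  hr := schwartz_hr φ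
  ht := schwartz_ht φ
  per := fun r => by simp [pe, vec]

def gq (Q : SchwartzMap E2 ℝ) (r : ℝ) : ℝ := Q (vec r 0)
def gp (Q : SchwartzMap E2 ℝ) (r : ℝ) : ℝ := sd 0 Q (vec r 0)

lemma gq_vec {Q : SchwartzMap E2 ℝ} (hQrad : ∀ y z : E2, ‖y‖ = ‖z‖ → Q y = Q z) (r t : ℝ) : Q (vec r t) = gq Q r :=
  hQrad _ _ (by rw [norm_vec, norm_vec])

lemma fam_dec {F : ℝ → ℝ → ℝ} (h : Fam F) (t : ℝ) : Dec (fun r => F r t) := fun n => by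
  obtain ⟨C, hC⟩ := h.d n
  exact ⟨C, fun r hr => hC r hr t⟩

lemma GS_of (Q : SchwartzMap E2 ℝ)
    (hQpos : ∀ y, 0 < Q y)
    (hQrad : ∀ y z : E2, ‖y‖ = ‖z‖ → Q y = Q z)
    (hQeq : ∀ y, -lap (fun z => Q z) y + Q y = (Q y) ^ 3) : GS (gq Q) (gp Q) where
  hq := fun r => by
    have := schwartz_hr Q r 0
    simp only [cos_zero, sin_zero, one_mul, zero_mul, add_zero] at this
    exact this
  hp := fun r hr => by
    have h1 := schwartz_hr (sd 0 Q) r 0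
    simp only [cos_zero, sin_zero, one_mul, zero_mul, add_zero] at h1
    refine HasDerivAt.congr_deriv (show HasDerivAt (gp Q) _ r from h1) ?_
    have h2 := hQeq (vec r 0)
    rw [lap_eq] at h2
    have h3 : ∀ t, pT Q r t = 0 := fun t => by
      have := schwartz_ht Q r t
      simp only [gq_vec hQrad] at this
      have h4 := this.unique (hasDerivAt_const t (gq Q r))
      exact (mul_eq_zero.1 h4).resolve_left hr.ne'
    have h5 := (((hasDerivAt_sin (0:ℝ)).neg).mul (schwartz_ht (sd 0 Q) r 0)).add ((hasDerivAt_cos (0:ℝ)).mul (schwartz_ht (sd 1 Q) r 0))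
    have h6 : HasDerivAt (fun t => pT Q r t) _ 0 := h5
    simp only [h3] at h6
    have h7 := h6.unique (hasDerivAt_const (0:ℝ) (0:ℝ))
    simp at h7
    have h8 : gp Q r / r = sd 1 (sd 1 Q) (vec r 0) := by
      rw [div_eq_iff hr.ne', gp]; linarith
    rw [h8]
    simp only [gq]
    linarith
  pc := (sd 0 Q).continuous.comp (vec_cont.comp (by fun_prop : Continuous fun r : ℝ => (r, (0:ℝ))))
  pos := fun r => hQpos _
  dq := fam_dec (schwartz_fam Q) 0
  dp := fam_dec (schwartz_fam (sd 0 Q)) 0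

section
variable {Q : SchwartzMap E2 ℝ} (hQrad : ∀ y z : E2, ‖y‖ = ‖z‖ → Q y = Q z) (φ : SchwartzMap E2 ℝ)

lemma tr_mass : ∫ y, φ y ^ 2 = ∫ r in Ioi (0:ℝ), r * m2 (pe φ) r := (schwartz_SC φ).sq.polar

include hQrad in
lemma tr_one : ∫ y, φ y * Q y = ∫ r in Ioi (0:ℝ), r * (md (fun _ => 1) (pe φ) r * gq Q r) := by
  rw [((schwartz_SC φ).mul (schwartz_SC Q)).polar]
  refine setIntegral_congr_fun measurableSet_Ioi fun r hr => ?_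
  simp only [gq_vec hQrad, intervalIntegral.integral_mul_const, md, mul_one]
  rfl

include hQrad in
lemma tr_sq : ∫ y, φ y * ‖y‖ ^ 2 * Q y = ∫ r in Ioi (0:ℝ), r * (md (fun _ => 1) (pe φ) r * (r ^ 2 * gq Q r)) := by
  rw [((schwartz_SC φ).mul_nsq.mul (schwartz_SC Q)).polar]
  refine setIntegral_congr_fun measurableSet_Ioi fun r hr => ?_
  simp only [gq_vec hQrad, intervalIntegral.integral_mul_const, md, mul_one, norm_vec, sq_abs, mul_assoc]
  rfl

include hQrad in
lemma tr_cos : ∫ y, φ y * y 0 * Q y = ∫ r in Ioi (0:ℝ), r * (md cos (pe φ) r * (r * gq Q r)) := by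
  rw [((schwartz_SC φ).mul_coord 0 |>.mul (schwartz_SC Q)).polar]
  refine setIntegral_congr_fun measurableSet_Ioi fun r hr => ?_
  simp only [gq_vec hQrad, md, vec_zero]
  rw [← intervalIntegral.integral_mul_const]
  congr 2
  funext t
  simp only [pe]; ring

include hQrad in
lemma tr_sin : ∫ y, φ y * y 1 * Q y = ∫ r in Ioi (0:ℝ), r * (md sin (pe φ) r * (r * gq Q r)) := by
  rw [((schwartz_SC φ).mul_coord 1 |>.mul (schwartz_SC Q)).polar]
  refine setIntegral_congr_fun measurableSet_Ioi fun r hr => ?_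
  simp only [gq_vec hQrad, md, vec_one]
  rw [← intervalIntegral.integral_mul_const]
  congr 2
  funext t
  simp only [pe]; ring

lemma SC_form (Q φ : SchwartzMap E2 ℝ) (j : ℝ) : SC (fun y => sd 0 φ y ^ 2 + sd 1 φ y ^ 2 + (φ y ^ 2 - j * (Q y ^ 2 * φ y ^ 2))) :=
  ((schwartz_SC _).sq.add (schwartz_SC _).sq).add ((schwartz_SC φ).sq.sub (((schwartz_SC Q).sq.mul (schwartz_SC φ).sq).const_mul j))

include hQrad in
lemma tr_form (j : ℝ) : ∫ y, (sd 0 φ y ^ 2 + sd 1 φ y ^ 2 + (φ y ^ 2 - j * (Q y ^ 2 * φ y ^ 2))) =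
    ∫ r in Ioi (0:ℝ), r * (m2 (pD φ) r + m2 (pT φ) r + (1 - j * gq Q r ^ 2) * m2 (pe φ) r) := by
  rw [(SC_form Q φ j).polar]
  refine setIntegral_congr_fun measurableSet_Ioi fun r hr => ?_
  have hD : IntervalIntegrable (fun t => pD φ r t ^ 2) volume (-π) π := (((schwartz_pol φ).fD.sl r).pow 2).intervalIntegrable _ _
  have hT : IntervalIntegrable (fun t => pT φ r t ^ 2) volume (-π) π := (((schwartz_pol φ).fT.sl r).pow 2).intervalIntegrable _ _
  have he : IntervalIntegrable (fun t => (1 - j * gq Q r ^ 2) * pe φ r t ^ 2) volume (-π) π :=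
    (continuous_const.mul (((schwartz_pol φ).fe.sl r).pow 2)).intervalIntegrable _ _
  have hDT : IntervalIntegrable (fun t => pD φ r t ^ 2 + pT φ r t ^ 2) volume (-π) π := hD.add hT
  simp only [m2]
  rw [← intervalIntegral.integral_const_mul (1 - j * gq Q r ^ 2), ← intervalIntegral.integral_add hD hT, ← intervalIntegral.integral_add hDT he]
  congr 2
  funext t
  simp only [pe, pD, pT, gq_vec hQrad]
  linear_combination (- sd 0 φ (vec r t) ^ 2 - sd 1 φ (vec r t) ^ 2) * sin_sq_add_cos_sq t

lemma form_eq (Q φ : SchwartzMap E2 ℝ) (j : ℝ) :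
    ∫ y, (-lap (fun z => φ z) y + φ y - j * Q y ^ 2 * φ y) * φ y =
      ∫ y, (sd 0 φ y ^ 2 + sd 1 φ y ^ 2 + (φ y ^ 2 - j * (Q y ^ 2 * φ y ^ 2))) := by
  have a0 := ((schwartz_SC (sd 0 φ)).sq).integrable
  have a1 := ((schwartz_SC (sd 1 φ)).sq).integrable
  have b0 := ((schwartz_SC (sd 0 (sd 0 φ))).mul (schwartz_SC φ)).integrable
  have b1 := ((schwartz_SC (sd 1 (sd 1 φ))).mul (schwartz_SC φ)).integrable
  have c0 := ((schwartz_SC φ).sq.sub (((schwartz_SC Q).sq.mul (schwartz_SC φ).sq).const_mul j)).integrable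
  have e : ∀ y, (-lap (fun z => φ z) y + φ y - j * Q y ^ 2 * φ y) * φ y =
     (- (sd 0 (sd 0 φ) y * φ y) + - (sd 1 (sd 1 φ) y * φ y)) + (φ y ^ 2 - j * (Q y ^ 2 * φ y ^ 2)) := fun y => by
    rw [lap_eq]; ring
  simp only [e]
  have b0n : Integrable (fun y => - (sd 0 (sd 0 φ) y * φ y)) volume := b0.neg
  have b1n : Integrable (fun y => - (sd 1 (sd 1 φ) y * φ y)) volume := b1.neg
  have bn : Integrable (fun y => - (sd 0 (sd 0 φ) y * φ y) + - (sd 1 (sd 1 φ) y * φ y)) volume := b0n.add b1n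
  have an : Integrable (fun y => sd 0 φ y ^ 2 + sd 1 φ y ^ 2) volume := a0.add a1
  rw [integral_add bn c0, integral_add an c0, integral_add b0n b1n, integral_add a0 a1, integral_neg, integral_neg, ibp, ibp, neg_neg, neg_neg]

def H1 (φ : SchwartzMap E2 ℝ) : ℝ := ∫ y, (sd 0 φ y ^ 2 + sd 1 φ y ^ 2 + φ y ^ 2)

/-- Interpolation of a mass lower bound into an `H¹` lower bound. -/
lemma interp (Q : SchwartzMap E2 ℝ) (j : ℝ) (hj : 0 ≤ j) (c : ℝ) (hc : 0 < c) : ∃ δ > 0, ∀ (φ : SchwartzMap E2 ℝ) (R : ℝ), 0 ≤ R →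
    c * (∫ y, φ y ^ 2) - R ≤ ∫ y, (sd 0 φ y ^ 2 + sd 1 φ y ^ 2 + (φ y ^ 2 - j * (Q y ^ 2 * φ y ^ 2))) →
    δ * H1 φ - R ≤ ∫ y, (sd 0 φ y ^ 2 + sd 1 φ y ^ 2 + (φ y ^ 2 - j * (Q y ^ 2 * φ y ^ 2))) := by
  obtain ⟨K, hK0, hK⟩ := (schwartz_SC Q).bdd
  set M := j * K ^ 2 with hM
  have hM0 : 0 ≤ M := by positivity
  refine ⟨c / (c + M), by positivity, fun φ R hR h => ?_⟩
  set B := ∫ y, (sd 0 φ y ^ 2 + sd 1 φ y ^ 2 + (φ y ^ 2 - j * (Q y ^ 2 * φ y ^ 2))) with hB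
  have i1 := (((schwartz_SC (sd 0 φ)).sq.add (schwartz_SC (sd 1 φ)).sq).add (schwartz_SC φ).sq).integrable
  have i2 := ((schwartz_SC φ).sq).integrable
  have h2 : H1 φ - M * (∫ y, φ y ^ 2) ≤ B := by
    rw [H1, ← integral_const_mul, ← integral_sub i1 (i2.const_mul M)]
    refine integral_mono (i1.sub (i2.const_mul M)) (SC_form Q φ j).integrable fun y => ?_
    have : Q y ^ 2 ≤ K ^ 2 := by
      rw [← sq_abs (Q y)]
      have := hK y
      gcongr
    have h3 := mul_le_mul_of_nonneg_left (mul_le_mul_of_nonneg_right this (sq_nonneg (φ y))) hj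
    simp only [hM]
    linarith
  have hcM : 0 < c + M := by positivity
  rw [sub_le_iff_le_add, div_mul_eq_mul_div, div_le_iff₀ hcM]
  nlinarith [mul_le_mul_of_nonneg_left h hM0, mul_le_mul_of_nonneg_left h2 hc.le, mul_nonneg hc.le hR]

end

end Aux

theorem stmt0 (Q : SchwartzMap E2 ℝ)
    (hQpos : ∀ y, 0 < Q y)
    (hQrad : ∀ y z : E2, ‖y‖ = ‖z‖ → Q y = Q z)
    (hQeq : ∀ y, -lap (fun z => Q z) y + Q y = (Q y) ^ 3) :
    ∃ δ : ℝ, 0 < δ ∧ ∃ C : ℝ, 0 < C ∧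
      ∀ ε₁ ε₂ : SchwartzMap E2 ℝ,
        (∫ y : E2, Lplus (fun z => Q z) (fun z => ε₁ z) y * ε₁ y)
            + (∫ y : E2, Lminus (fun z => Q z) (fun z => ε₂ z) y * ε₂ y)
          ≥ δ * (∫ y : E2,
                (∑ j : Fin 2, ((pd j (fun z => ε₁ z) y) ^ 2 + (pd j (fun z => ε₂ z) y) ^ 2))
                  + (ε₁ y) ^ 2 + (ε₂ y) ^ 2)
            - C * ((∫ y : E2, ε₁ y * Q y) ^ 2
                + (∫ y : E2, ε₁ y * ‖y‖ ^ 2 * Q y) ^ 2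
                + (∑ j : Fin 2, (∫ y : E2, ε₁ y * y j * Q y) ^ 2)
                + (∫ y : E2, ε₂ y * Q y) ^ 2) := by
  have H := GS_of Q hQpos hQrad hQeq
  obtain ⟨c1, hc1, C1, hC1, h1⟩ := H.plus
  obtain ⟨c2, hc2, C2, hC2, h2⟩ := H.minus
  obtain ⟨δ1, hδ1, k1⟩ := interp Q 3 (by norm_num) c1 hc1
  obtain ⟨δ2, hδ2, k2⟩ := interp Q 1 (by norm_num) c2 hc2
  refine ⟨min δ1 δ2, lt_min hδ1 hδ2, C1 + C2, by positivity, fun φ ψ => ?_⟩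
  have g1 := h1 _ _ _ (schwartz_pol φ)
  have g2 := h2 _ _ _ (schwartz_pol ψ)
  rw [← tr_mass, ← tr_one hQrad, ← tr_sq hQrad, ← tr_cos hQrad, ← tr_sin hQrad, ← tr_form hQrad] at g1
  rw [← tr_mass, ← tr_one hQrad, ← tr_form hQrad] at g2
  have m1 := k1 φ _ (by positivity) g1
  have m2 := k2 ψ _ (by positivity) g2
  rw [← form_eq] at m1 m2
  simp only [one_mul] at m2
  have n : ∀ φ : SchwartzMap E2 ℝ, 0 ≤ H1 φ := fun φ => integral_nonneg fun y => by positivity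
  have e : (∫ y : E2,
                (∑ j : Fin 2, ((pd j (fun z => φ z) y) ^ 2 + (pd j (fun z => ψ z) y) ^ 2))
                  + (φ y) ^ 2 + (ψ y) ^ 2) = H1 φ + H1 ψ := by
    have i : ∀ φ : SchwartzMap E2 ℝ, Integrable (fun y => sd 0 φ y ^ 2 + sd 1 φ y ^ 2 + φ y ^ 2) := fun φ =>
      (((schwartz_SC (sd 0 φ)).sq.add (schwartz_SC (sd 1 φ)).sq).add (schwartz_SC φ).sq).integrable
    rw [H1, H1, ← integral_add (i φ) (i ψ)]
    refine integral_congr_ae (ae_of_all _ fun y => ?_)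
    simp only [Fin.sum_univ_two, pd_eq]
    ring
  rw [e, Fin.sum_univ_two]
  have l1 := mul_le_mul_of_nonneg_right (min_le_left δ1 δ2) (n φ)
  have l2 := mul_le_mul_of_nonneg_right (min_le_right δ1 δ2) (n ψ)
  simp only [Lplus, Lminus, ge_iff_le]
  have hS : 0 ≤ C2 * ((∫ y : E2, φ y * Q y) ^ 2 + (∫ y : E2, φ y * ‖y‖ ^ 2 * Q y) ^ 2 + (∫ y : E2, φ y * y 0 * Q y) ^ 2 + (∫ y : E2, φ y * y 1 * Q y) ^ 2) := by positivity
  have hS' : 0 ≤ C1 * (∫ y : E2, ψ y * Q y) ^ 2 := by positivity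
  linarith
end
end

section
/- ODE lemma for the translation/Galilean parameters: let k₁ > 0 and C₀ > 0, and let M be the 2×2 real matrix with rows (0, −2) and (k₁, 1/C₀). There exists a constant C > 0 depending only on k₁ and C₀ such that the following holds: for every τ_max > 0, every A ≥ 0, every continuous F : [0, τ_max] → ℝ² with |F(τ)| ≤ A e^{τ/C₀} for all τ ∈ [0, τ_max], and every differentiable x : [0, τ_max] → ℝ² with x(0) = 0 and x'(τ) = M x(τ) + F(τ) for all τ, one has |x(τ)| ≤ C A e^{τ/C₀} for all τ ∈ [0, τ_max]. -/
noncomputable section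


theorem aux_young (p q s : ℝ) (hs : 0 < s) : 2 * (p * q) ≤ s * p ^ 2 + q ^ 2 / s := by
  have h : s * p ^ 2 + q ^ 2 / s - 2 * (p * q) = (s * p - q) ^ 2 / s := by
    field_simp
    ring
  have : 0 ≤ (s * p - q) ^ 2 / s := by positivity
  linarith

theorem aux_pos (k e u v : ℝ) (hk : 0 < k) (h2 : e ^ 2 ≤ k / 2) :
    k / 2 * u ^ 2 + v ^ 2 ≤ k * u ^ 2 + 2 * v ^ 2 + 2 * e * u * v ∧
    k * u ^ 2 + 2 * v ^ 2 + 2 * e * u * v ≤ 3 * (k * u ^ 2 + v ^ 2) := by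
  have h : e ^ 2 * u ^ 2 ≤ k / 2 * u ^ 2 := mul_le_mul_of_nonneg_right h2 (sq_nonneg u)
  have hu : 0 ≤ k * u ^ 2 := by positivity
  constructor
  · nlinarith [sq_nonneg (e * u + v)]
  · nlinarith [sq_nonneg (e * u - v)]

theorem aux_diss (k m e u v g h A : ℝ) (hk : 0 < k) (he : 0 < e)
    (h1 : e * (m ^ 2 + 8 * k) = 4 * k * m) (h2 : e ^ 2 ≤ k / 2) (hg : g ^ 2 + h ^ 2 ≤ A ^ 2) :
    2 * k * u * (-m * u - 2 * v + g) + 4 * v * (k * u + h)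
      + 2 * e * ((-m * u - 2 * v + g) * v + u * (k * u + h))
      + e / 3 * (k * u ^ 2 + 2 * v ^ 2 + 2 * e * u * v)
      ≤ (2 * k / e + 2 * e / k + 8 / e + 2 * e) * A ^ 2 := by
  have y1 := aux_young u (k * g) (e * k / 2) (by positivity)
  have y2 := aux_young u (e * h) (e * k / 2) (by positivity)
  have y3 := aux_young v (2 * h) (e / 2) (by positivity)
  have y4 := aux_young v (e * g) (e / 2) (by positivity)
  have r1 : (k * g) ^ 2 / (e * k / 2) = 2 * k / e * g ^ 2 := by field_simp
  have r2 : (e * h) ^ 2 / (e * k / 2) = 2 * e / k * h ^ 2 := by field_simp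
  have r3 : (2 * h) ^ 2 / (e / 2) = 8 / e * h ^ 2 := by field_simp; ring
  have r4 : (e * g) ^ 2 / (e / 2) = 2 * e * g ^ 2 := by field_simp
  rw [r1] at y1
  rw [r2] at y2
  rw [r3] at y3
  rw [r4] at y4
  have b : ∀ x : ℝ, 0 ≤ x → x * g ^ 2 ≤ x * A ^ 2 ∧ x * h ^ 2 ≤ x * A ^ 2 := fun x hx =>
    ⟨mul_le_mul_of_nonneg_left (by nlinarith [sq_nonneg h]) hx,
      mul_le_mul_of_nonneg_left (by nlinarith [sq_nonneg g]) hx⟩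
  have b1 := (b (2 * k / e) (by positivity)).1
  have b2 := (b (2 * e / k) (by positivity)).2
  have b3 := (b (8 / e) (by positivity)).2
  have b4 := (b (2 * e) (by positivity)).1
  have hV := mul_le_mul_of_nonneg_left (aux_pos k e u v hk h2).2 (by positivity : 0 ≤ e / 3)
  have hd : 0 ≤ e * (m * u + 2 * v) ^ 2 := by positivity
  have h1u : e * (m ^ 2 + 8 * k) * u ^ 2 = 4 * k * m * u ^ 2 := by rw [h1]
  linarith

/-- ODE lemma for the translation/Galilean modulation parameters: solutions of
`x' = Mx + F` with `M = !![0, -2; k₁, 1/C₀]`, `x(0) = 0` and forcing bounded by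
`A e^{τ/C₀}` stay bounded by `C A e^{τ/C₀}`, with `C` depending only on `k₁, C₀`.
Here the system is written componentwise, `x = (a, b)`, and `|·|` is the Euclidean
norm on `ℝ²`. -/
theorem stmt10 (k₁ C₀ : ℝ) (hk : 0 < k₁) (hC : 0 < C₀) :
    ∃ C : ℝ, 0 < C ∧
      ∀ (τmax : ℝ), 0 < τmax → ∀ (A : ℝ), 0 ≤ A →
      ∀ (F₁ F₂ a b : ℝ → ℝ),
        ContinuousOn F₁ (Set.Icc 0 τmax) → ContinuousOn F₂ (Set.Icc 0 τmax) →
        (∀ τ ∈ Set.Icc (0 : ℝ) τmax,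
          Real.sqrt ((F₁ τ) ^ 2 + (F₂ τ) ^ 2) ≤ A * Real.exp (τ / C₀)) →
        a 0 = 0 → b 0 = 0 →
        (∀ τ ∈ Set.Icc (0 : ℝ) τmax,
          HasDerivAt a (-2 * b τ + F₁ τ) τ ∧
          HasDerivAt b (k₁ * a τ + (1 / C₀) * b τ + F₂ τ) τ) →
        ∀ τ ∈ Set.Icc (0 : ℝ) τmax,
          Real.sqrt ((a τ) ^ 2 + (b τ) ^ 2) ≤ C * A * Real.exp (τ / C₀) := by
  set m : ℝ := 1 / C₀ with hm
  have hm0 : 0 < m := by positivity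
  obtain ⟨e, he, h1, h2⟩ : ∃ e : ℝ, 0 < e ∧ e * (m ^ 2 + 8 * k₁) = 4 * k₁ * m ∧
      e ^ 2 ≤ k₁ / 2 := by
    refine ⟨4 * k₁ * m / (m ^ 2 + 8 * k₁), by positivity, by field_simp, ?_⟩
    rw [div_pow, div_le_iff₀ (by positivity)]
    nlinarith [mul_nonneg hk.le (sq_nonneg (m ^ 2 - 8 * k₁))]
  set D : ℝ := 2 * k₁ / e + 2 * e / k₁ + 8 / e + 2 * e with hD
  have hD0 : 0 < D := by positivity
  refine ⟨Real.sqrt ((2 / k₁ + 1) * (3 * D / e)), by positivity, ?_⟩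
  intro T hT A hA F₁ F₂ a b _ _ hF ha hb hd t ht
  have hdiv : ∀ s : ℝ, s / C₀ = m * s := fun s => by rw [hm]; ring
  simp only [hdiv] at hF ⊢
  -- rescaled unknowns
  set E : ℝ → ℝ := fun s => Real.exp (-(m * s)) with hE
  have hEd : ∀ s, HasDerivAt E (E s * -m) s := fun s => by
    have := ((hasDerivAt_id s).const_mul m).neg.exp
    simpa [hE] using this
  have hEE : ∀ s, E s * Real.exp (m * s) = 1 := fun s => by
    rw [hE, ← Real.exp_add]; simp
  set V : ℝ → ℝ := fun s => k₁ * (a s * E s) ^ 2 + 2 * (b s * E s) ^ 2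
    + 2 * e * (a s * E s) * (b s * E s) with hV
  set W : ℝ → ℝ := fun s => Real.exp (e / 3 * s) * (V s - 3 * D / e * A ^ 2) with hW
  have hWd : ∀ s ∈ Set.Icc (0 : ℝ) T, ∃ w, w ≤ 0 ∧ HasDerivAt W w s := by
    intro s hs
    obtain ⟨da, db⟩ := hd s hs
    have du := da.mul (hEd s)
    have dv := db.mul (hEd s)
    have dV := (((du.pow 2).const_mul k₁).add ((dv.pow 2).const_mul 2)).add
      ((du.const_mul (2 * e)).mul dv)
    have dX := ((hasDerivAt_id s).const_mul (e / 3)).exp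
    have dW := dX.mul (dV.sub_const (3 * D / e * A ^ 2))
    refine ⟨_, ?_, dW⟩
    have hg : (F₁ s * E s) ^ 2 + (F₂ s * E s) ^ 2 ≤ A ^ 2 := by
      have h := hF s hs
      rw [Real.sqrt_le_left (by positivity)] at h
      have h' := mul_le_mul_of_nonneg_right h (sq_nonneg (E s))
      calc _ = (F₁ s ^ 2 + F₂ s ^ 2) * E s ^ 2 := by ring
        _ ≤ _ := h'
        _ = A ^ 2 * (E s * Real.exp (m * s)) ^ 2 := by ring
        _ = A ^ 2 := by rw [hEE]; ring
    have key := aux_diss k₁ m e (a s * E s) (b s * E s) (F₁ s * E s) (F₂ s * E s) A hk he h1 h2 hg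
    rw [← hD] at key
    have hx : e / 3 * (3 * D / e * A ^ 2) = D * A ^ 2 := by field_simp
    have fin := mul_nonneg (Real.exp_pos (e / 3 * s)).le (sub_nonneg.2 key)
    simp only [id, Pi.mul_apply, Pi.add_apply, Pi.pow_apply]
    push_cast
    rw [← hx] at fin
    refine le_of_eq_of_le ?_ (neg_nonpos.2 fin)
    ring
  have hanti : AntitoneOn W (Set.Icc 0 T) := by
    apply antitoneOn_of_deriv_nonpos (convex_Icc 0 T)
    · intro s hs
      obtain ⟨w, -, h⟩ := hWd s hs
      exact h.continuousAt.continuousWithinAt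
    · intro s hs
      obtain ⟨w, -, h⟩ := hWd s (interior_subset hs)
      exact h.differentiableAt.differentiableWithinAt
    · intro s hs
      obtain ⟨w, hw, h⟩ := hWd s (interior_subset hs)
      rw [h.deriv]; exact hw
  have hWt : W t ≤ 0 := by
    refine (hanti ⟨le_rfl, hT.le⟩ ht ht.1).trans ?_
    have : 0 ≤ 3 * D / e * A ^ 2 := by positivity
    simp only [hW, hV, ha, hb]
    simpa using this
  have hVt : V t ≤ 3 * D / e * A ^ 2 := by
    have := nonpos_of_mul_nonpos_right hWt (Real.exp_pos _)
    linarith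
  have hlow := (aux_pos k₁ e (a t * E t) (b t * E t) hk h2).1
  have hlow' : k₁ / 2 * (a t * E t) ^ 2 + (b t * E t) ^ 2 ≤ 3 * D / e * A ^ 2 := hlow.trans hVt
  have hsum : (a t * E t) ^ 2 + (b t * E t) ^ 2 ≤ (2 / k₁ + 1) * (3 * D / e * A ^ 2) := by
    refine le_trans ?_ (mul_le_mul_of_nonneg_left hlow' (by positivity))
    have : (2 / k₁ + 1) * (k₁ / 2 * (a t * E t) ^ 2 + (b t * E t) ^ 2)
      = (a t * E t) ^ 2 + (b t * E t) ^ 2 + (k₁ / 2 * (a t * E t) ^ 2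
        + 2 / k₁ * (b t * E t) ^ 2) := by
      field_simp
      ring
    rw [this]
    have : 0 ≤ k₁ / 2 * (a t * E t) ^ 2 + 2 / k₁ * (b t * E t) ^ 2 := by positivity
    linarith
  rw [Real.sqrt_le_left (by positivity), mul_pow, mul_pow, Real.sq_sqrt (by positivity)]
  have h' := mul_le_mul_of_nonneg_right hsum (sq_nonneg (Real.exp (m * t)))
  calc a t ^ 2 + b t ^ 2 = (a t ^ 2 + b t ^ 2) * (E t * Real.exp (m * t)) ^ 2 := by rw [hEE]; ring
    _ = ((a t * E t) ^ 2 + (b t * E t) ^ 2) * Real.exp (m * t) ^ 2 := by ring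
    _ ≤ _ := h'
    _ = _ := by ring
end
end

section
/- Fredholm solvability condition for the profile equation: let B : ℝ² × ℝ² → ℝ be a symmetric bilinear form, α ∈ ℝ², λ ∈ ℝ, and define c₀(α) ∈ ℝ² by c₀(α)ⱼ = ( ∫Q⁴ / (2∫Q²) ) B(eⱼ, α) for j = 1,2. Then for j = 1,2 one has ∫_{ℝ²} [ λ B(α, y) Q(y)³ + (λ²/2) B(y, y) Q(y)³ − λ (c₀(α)·y) Q(y) ] ∂ⱼQ(y) dy = 0; that is, the right-hand side of the equation defining T₂ is L²-orthogonal to ∂₁Q and ∂₂Q. -/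
open MeasureTheory

noncomputable section

lemma int_aux (g : E2 → ℝ) (hg : g.HasTemperateGrowth) (S : SchwartzMap E2 ℝ) :
    Integrable (fun y => g y * S y) := by
  have h := (SchwartzMap.smulLeftCLM ℝ g S).integrable (μ := volume)
  refine h.congr (Filter.Eventually.of_forall fun y => ?_)
  simp [SchwartzMap.smulLeftCLM_apply_apply hg]

def pdS (j : Fin 2) (S : SchwartzMap E2 ℝ) : SchwartzMap E2 ℝ :=
  LineDeriv.lineDerivOp (EuclideanSpace.single j (1:ℝ) : E2) S

lemma pdS_apply (j : Fin 2) (S : SchwartzMap E2 ℝ) (y : E2) :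
    pdS j S y = fderiv ℝ S y (EuclideanSpace.single j 1) :=
  SchwartzMap.lineDerivOp_apply_eq_fderiv _ _ _

lemma parts_aux (l : E2 →L[ℝ] ℝ) (S : SchwartzMap E2 ℝ) (j : Fin 2) :
    ∫ y, l y * pdS j S y = - (l (EuclideanSpace.single j 1) * ∫ y, S y) := by
  have h := integral_mul_fderiv_eq_neg_fderiv_mul_of_integrable (𝕜 := ℝ) (μ := (volume : Measure E2))
    (f := fun y => l y) (g := fun y => S y) (v := EuclideanSpace.single j 1) ?_ ?_ ?_
    (fun x _ => l.differentiableAt) (fun x _ => S.differentiableAt)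
  · simp only [pdS_apply]
    rw [h, ← integral_const_mul]
    congr 1
    refine integral_congr_ae (Filter.Eventually.of_forall fun y => ?_)
    simp
  · simpa using (S.integrable (μ := volume)).const_mul (l (EuclideanSpace.single j 1))
  · simp only [← pdS_apply]
    exact int_aux _ l.hasTemperateGrowth _
  · exact int_aux _ l.hasTemperateGrowth _

lemma exists_pow (Q : SchwartzMap E2 ℝ) (n : ℕ) : ∃ S : SchwartzMap E2 ℝ, ∀ y, S y = Q y ^ (n+1) := by
  induction n with
  | zero => exact ⟨Q, fun y => by simp⟩
  | succ n ih =>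
    obtain ⟨S, hS⟩ := ih
    refine ⟨SchwartzMap.smulLeftCLM ℝ (fun y => Q y) S, fun y => ?_⟩
    rw [SchwartzMap.smulLeftCLM_apply_apply Q.hasTemperateGrowth, hS]
    simp; ring

lemma pd_pow (Q S : SchwartzMap E2 ℝ) (n : ℕ) (hS : ∀ y, S y = Q y ^ (n+1)) (j : Fin 2) (y : E2) :
    pdS j S y = (n+1) * Q y ^ n * pd j (fun z => Q z) y := by
  have : (S : E2 → ℝ) = fun y => Q y ^ (n+1) := funext hS
  rw [pdS_apply, this, ((Q.hasFDerivAt y).pow (n+1)).fderiv]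
  simp [pd]

/-- Fredholm solvability: the right-hand side of the equation defining `T₂` is
`L²`-orthogonal to `∂₁Q` and `∂₂Q`, where
`c₀(α)ⱼ = (∫Q⁴ / (2∫Q²)) B(eⱼ, α)`. -/
theorem stmt12 (Q : SchwartzMap E2 ℝ)
    (hQpos : ∀ y, 0 < Q y)
    (hQrad : ∀ y z : E2, ‖y‖ = ‖z‖ → Q y = Q z)
    (hQeq : ∀ y, -lap (fun z => Q z) y + Q y = (Q y) ^ 3)
    (B : E2 →ₗ[ℝ] E2 →ₗ[ℝ] ℝ) (hB : ∀ x y : E2, B x y = B y x)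
    (α : E2) (lam : ℝ) (j : Fin 2) :
    ∫ y : E2,
        (lam * B α y * (Q y) ^ 3 + (lam ^ 2 / 2) * B y y * (Q y) ^ 3
          - lam * (∑ i : Fin 2,
              ((∫ z : E2, (Q z) ^ 4) / (2 * ∫ z : E2, (Q z) ^ 2))
                * B (EuclideanSpace.single i 1) α * y i) * Q y)
        * pd j (fun z => Q z) y = 0 := by
  obtain ⟨S2, h2⟩ := exists_pow Q 1
  obtain ⟨S4, h4⟩ := exists_pow Q 3
  have d2 := pd_pow Q S2 1 h2 j
  have d4 := pd_pow Q S4 3 h4 j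
  norm_num at h2 h4 d2 d4
  have hpos : 0 < ∫ z : E2, (Q z) ^ 2 := by
    have hi := S2.integrable (μ := (volume : Measure E2))
    simp only [← h2]
    refine (integral_pos_iff_support_of_nonneg (fun y => ?_) hi).2 ?_
    · simp only [h2]; positivity
    · have : Function.support (fun y => S2 y) = Set.univ := by
        ext y
        simp [h2, (hQpos y).ne']
      rw [this]
      simp
  let l : E2 →L[ℝ] ℝ := LinearMap.toContinuousLinearMap (B α)
  have hl : ∀ y, l y = B α y := fun y => rfl
  let b : E2 →L[ℝ] E2 →L[ℝ] ℝ := LinearMap.toContinuousLinearMap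
    ((LinearMap.toContinuousLinearMap : (E2 →ₗ[ℝ] ℝ) ≃ₗ[ℝ] _).toLinearMap ∘ₗ B)
  have hb : ∀ x y, b x y = B x y := fun x y => rfl
  have hbt : (fun y => B y y).HasTemperateGrowth := by
    have : (fun y : E2 => b y y).HasTemperateGrowth :=
      b.bilinear_hasTemperateGrowth (f := fun y => y) (g := fun y => y) (by fun_prop) (by fun_prop)
    exact this
  set c := ((∫ z : E2, (Q z) ^ 4) / (2 * ∫ z : E2, (Q z) ^ 2)) with hc
  have hsum : ∀ y : E2, ∑ i : Fin 2, c * B (EuclideanSpace.single i 1) α * y i = c * B α y := by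
    intro y
    have hy : y = ∑ i : Fin 2, y i • EuclideanSpace.single i (1:ℝ) := by
      ext k
      fin_cases k <;> simp [Fin.sum_univ_two]
    conv_rhs => rw [hy]
    rw [map_sum, Finset.mul_sum]
    refine Finset.sum_congr rfl fun i _ => ?_
    rw [map_smul, hB α, smul_eq_mul]; ring
  have i1 := int_aux _ l.hasTemperateGrowth (pdS j S4)
  have i2 := int_aux _ l.hasTemperateGrowth (pdS j S2)
  have i3 := int_aux _ hbt (pdS j S4)
  have p1 := parts_aux l S4 j
  have p2 := parts_aux l S2 j
  have hodd : ∀ y, pd j (fun z => Q z) (-y) = - pd j (fun z => Q z) y := by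
    intro y
    have he : (fun z => Q z) = fun z => Q (-z) := funext fun z => hQrad _ _ (by simp)
    have hd : HasFDerivAt (fun z => Q (-z)) ((fderiv ℝ Q (-y)).comp (-ContinuousLinearMap.id ℝ E2)) y :=
      HasFDerivAt.comp (g := fun z => Q z) y (Q.hasFDerivAt (-y)) (hasFDerivAt_id y).neg
    rw [← he] at hd
    simp [pd, hd.fderiv]
  have p3 : ∫ y, B y y * pdS j S4 y = 0 := by
    have h := integral_neg_eq_self (fun y => B y y * pdS j S4 y) (volume : Measure E2)
    have h' : ∀ y, B (-y) (-y) * pdS j S4 (-y) = - (B y y * pdS j S4 y) := by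
      intro y
      rw [d4, d4, hodd, hQrad (-y) y (by simp)]
      simp
    simp only [h'] at h
    rw [integral_neg] at h
    linarith
  have key : ∀ y : E2, (lam * B α y * (Q y) ^ 3 + (lam ^ 2 / 2) * B y y * (Q y) ^ 3
          - lam * (∑ i : Fin 2, c * B (EuclideanSpace.single i 1) α * y i) * Q y)
        * pd j (fun z => Q z) y = lam / 4 * (l y * pdS j S4 y) + lam^2/8 * (B y y * pdS j S4 y)
          - lam * c / 2 * (l y * pdS j S2 y) := by
    intro y
    rw [hsum, d2, d4, hl]; ring
  simp only [key]
  have i4 : Integrable (fun y => lam / 4 * (l y * pdS j S4 y) + lam^2/8 * (B y y * pdS j S4 y)) :=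
    (i1.const_mul _).add (i3.const_mul _)
  rw [integral_sub i4 (i2.const_mul _),
    integral_add (i1.const_mul _) (i3.const_mul _), integral_const_mul, integral_const_mul,
    integral_const_mul, p1, p2, p3]
  simp only [h2, h4, hc]
  field_simp
  ring
end
end

section
/- Algebraic cancellation against the scaling direction: for every real-valued Schwartz function f on ℝ² and every symmetric bilinear form B : ℝ² × ℝ² → ℝ, one has ∫_{ℝ²} B(y, y) f(y)³ ( f(y) + y·∇f(y) ) dy = 0. -/
open MeasureTheory

noncomputable section

theorem schwartz_aux (h : SchwartzMap E2 ℝ) (v : E2) :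
    Integrable (fun y => fderiv ℝ (fun z => h z) y v) ∧
    ∫ y : E2, fderiv ℝ (fun z => h z) y v = 0 := by
  have hi : Integrable (fun y => fderiv ℝ (fun z => h z) y v) := by
    have := (LineDeriv.lineDerivOp v h : SchwartzMap E2 ℝ).integrable (μ := volume)
    refine this.congr (Filter.Eventually.of_forall fun y => ?_)
    exact SchwartzMap.lineDerivOp_apply_eq_fderiv v h y
  refine ⟨hi, ?_⟩
  have := integral_mul_fderiv_eq_neg_fderiv_mul_of_integrable (𝕜 := ℝ) (μ := (volume : Measure E2))
    (f := fun _ : E2 => (1:ℝ)) (g := fun z => h z) (v := v) (by simp) (by simpa using hi)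
    (by simpa using h.integrable) (fun x _ => by fun_prop) (fun x _ => h.differentiable x)
  simpa using this

theorem main_aux (f : SchwartzMap E2 ℝ)
    (B : E2 →ₗ[ℝ] E2 →ₗ[ℝ] ℝ) (hB : ∀ x y : E2, B x y = B y x) (i : Fin 2) :
    Integrable (fun y : E2 => B y y * (f y) ^ 4 + 2 * y i * B y (EuclideanSpace.single i 1) * f y ^ 4
      + 4 * y i * B y y * f y ^ 3 * pd i (fun z => f z) y) ∧
    ∫ y : E2, (B y y * (f y) ^ 4 + 2 * y i * B y (EuclideanSpace.single i 1) * f y ^ 4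
      + 4 * y i * B y y * f y ^ 3 * pd i (fun z => f z) y) = 0 := by
  let C : E2 →L[ℝ] E2 →L[ℝ] ℝ := LinearMap.toContinuousLinearMap
    ((LinearMap.toContinuousLinearMap : (E2 →ₗ[ℝ] ℝ) ≃ₗ[ℝ] _).toLinearMap ∘ₗ B)
  have hC : ∀ x y, C x y = B x y := fun x y => rfl
  let P : E2 →L[ℝ] ℝ := EuclideanSpace.proj i
  have hP : ∀ y, P y = y i := fun y => rfl
  have hf : Function.HasTemperateGrowth (fun y => f y) := f.hasTemperateGrowth
  have hPt : Function.HasTemperateGrowth (fun y => P y) := P.hasTemperateGrowth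
  have hCt : Function.HasTemperateGrowth (fun y => C y y) :=
    C.bilinear_hasTemperateGrowth .id' .id'
  have hg : Function.HasTemperateGrowth (fun y => P y * C y y * (f y * f y * f y)) :=
    (hPt.mul hCt).mul ((hf.mul hf).mul hf)
  let h : SchwartzMap E2 ℝ := SchwartzMap.smulLeftCLM ℝ (fun y => P y * C y y * (f y * f y * f y)) f
  have hh : (fun z => h z) = fun y => P y * C y y * (f y) ^ 4 := by
    ext y
    simp only [h, SchwartzMap.smulLeftCLM_apply_apply hg, smul_eq_mul]
    ring
  have key : ∀ y, fderiv ℝ (fun z => h z) y (EuclideanSpace.single i 1) =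
      B y y * (f y) ^ 4 + 2 * y i * B y (EuclideanSpace.single i 1) * f y ^ 4
      + 4 * y i * B y y * f y ^ 3 * pd i (fun z => f z) y := by
    intro y
    have h1 : HasFDerivAt (fun z => f z) (fderiv ℝ (fun z => f z) y) y :=
      (f.differentiable y).hasFDerivAt
    have h2 := ((P.hasFDerivAt (x := y)).mul ((C.hasFDerivAt (x := y)).clm_apply
      (hasFDerivAt_id y))).mul (h1.pow 4)
    rw [hh]
    erw [h2.fderiv]
    have h3 : B (EuclideanSpace.single i 1) y = B y (EuclideanSpace.single i 1) := hB _ _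
    simp [hC, hP, pd, h3]
    ring
  have := schwartz_aux h (EuclideanSpace.single i 1)
  simpa only [key] using this

/-- Algebraic cancellation against the scaling direction:
`∫ B(y,y) f³ (Λf) = 0` for every real Schwartz `f` and symmetric bilinear `B`. -/
theorem stmt18 (f : SchwartzMap E2 ℝ)
    (B : E2 →ₗ[ℝ] E2 →ₗ[ℝ] ℝ) (hB : ∀ x y : E2, B x y = B y x) :
    ∫ y : E2, B y y * (f y) ^ 3 *
      (f y + ∑ i : Fin 2, y i * pd i (fun z => f z) y) = 0 := by
  obtain ⟨i0, e0⟩ := main_aux f B hB 0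
  obtain ⟨i1, e1⟩ := main_aux f B hB 1
  have h := integral_add i0 i1
  rw [e0, e1, add_zero] at h
  have h4 := congrArg (fun t => (1/4 : ℝ) * t) h
  simp only [mul_zero] at h4
  rw [← integral_const_mul] at h4
  rw [← h4]
  congr 1
  ext y
  have hy : B y y = y 0 * B y (EuclideanSpace.single 0 1) + y 1 * B y (EuclideanSpace.single 1 1) := by
    have : y = y 0 • EuclideanSpace.single 0 (1:ℝ) + y 1 • EuclideanSpace.single 1 (1:ℝ) := by
      ext j; fin_cases j <;> simp
    have h5 := congrArg (B y) this
    rw [map_add, map_smul, map_smul] at h5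
    exact h5
  rw [Fin.sum_univ_two]
  linear_combination (f y)^4 / 2 * hy
end
end
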